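/- Let F be a field of characteristic 2, let φ be an anisotropic quadratic form over F of dimension 5 and type (1,3) that is not a Pfister neighbour, and let ψ be an anisotropic quadratic form over F of type (1,1) or (1,2). Then φ_{F(ψ)} is isotropic if and only if there exist nonsingular quadratic forms R₁, R₂ over F of dimension 2, scalars a,b,α,β ∈ F*, a nonsingular completion ρ of ⟨1,a,b⟩ and a form π ∈ GP₃F such that: ψ ≺_w π, αφ ≅ R₁ ⊥ ⟨1,a,b⟩, βψ ≅ R₂ ⊥ Q, and R₁ ⊥ R₂ ⊥ ρ is Witt equivalent to π, where Q = ⟨1⟩ if dim ψ = 3 and Q = ⟨1,a⟩ if dim ψ = 4. -/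

import Mathlib

open QuadraticMap MvPolynomial
open scoped TensorProduct

set_option synthInstance.maxHeartbeats 1000000
set_option maxHeartbeats 1000000


section Defs

variable {K : Type} [CommRing K]

/-- The binary quadratic form `[a,b] : (x,y) ↦ a·x² + x·y + b·y²`. -/
noncomputable def binQF (a b : K) : QuadraticForm K (Fin 2 → K) :=
  (Matrix.of ![![a, 1], ![0, b]]).toQuadraticMap'

/-- The diagonal (totally singular) quadratic form `⟨c₁, …, c_s⟩`. -/
noncomputable def diagQF {s : ℕ} (c : Fin s → K) : QuadraticForm K (Fin s → K) :=
  QuadraticMap.weightedSumSquares K c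

/-- The orthogonal sum `[a₁,b₁] ⊥ ⋯ ⊥ [a_r,b_r]` of binary forms. -/
noncomputable def binsQF {r : ℕ} (a b : Fin r → K) : QuadraticForm K (Fin r → Fin 2 → K) :=
  QuadraticMap.pi fun i => binQF (a i) (b i)

/-- The orthogonal sum of `m` hyperbolic planes `[0,0]`. -/
noncomputable def hypQF (K : Type) [CommRing K] (m : ℕ) :
    QuadraticForm K (Fin m → Fin 2 → K) :=
  binsQF (fun _ => 0) (fun _ => 0)

/-- The `(n+1)`-fold quadratic Pfister form `⟨⟨a₁,…,aₙ⟩⟩_b ⊗ [1,c]`, i.e. the orthogonal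
sum over all subsets `S ⊆ {1,…,n}` of `(∏_{i∈S} aᵢ)·[1,c]`. -/
noncomputable def pfisterQF (n : ℕ) (a : Fin n → K) (c : K) :
    QuadraticForm K (Finset (Fin n) → Fin 2 → K) :=
  QuadraticMap.pi fun S : Finset (Fin n) => (∏ i ∈ S, a i) • binQF 1 c

variable {V W : Type} [AddCommGroup V] [Module K V] [AddCommGroup W] [Module K W]

/-- `φ` has type `(r,s)`: it is isometric to `[a₁,b₁] ⊥ ⋯ ⊥ [a_r,b_r] ⊥ ⟨c₁,…,c_s⟩`. -/
def HasTypeRS (φ : QuadraticForm K V) (r s : ℕ) : Prop :=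
  ∃ (a b : Fin r → K) (c : Fin s → K), φ.Equivalent ((binsQF a b).prod (diagQF c))

/-- `φ` is dominated by `ψ`. -/
def Dominated (φ : QuadraticForm K V) (ψ : QuadraticForm K W) : Prop :=
  ∃ f : V →ₗ[K] W, Function.Injective f ∧ ∀ v, φ v = ψ (f v)

/-- `φ` is weakly dominated by `ψ`: `α·φ` is dominated by `ψ` for some unit `α`. -/
def WeaklyDominated (φ : QuadraticForm K V) (ψ : QuadraticForm K W) : Prop :=
  ∃ α : Kˣ, Dominated ((α : K) • φ) ψ

/-- Witt equivalence of quadratic forms. -/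
def WittEquiv (Q₁ : QuadraticForm K V) (Q₂ : QuadraticForm K W) : Prop :=
  ∃ k l : ℕ, (Q₁.prod (hypQF K k)).Equivalent (Q₂.prod (hypQF K l))

/-- `φ` is a Pfister neighbour: there is a quadratic Pfister form `π` with
`2·dim φ > dim π` and `φ ≺_w π`. -/
def IsPfisterNeighbour (φ : QuadraticForm K V) : Prop :=
  ∃ (n : ℕ) (a : Fin n → Kˣ) (c : K),
    2 * Module.finrank K V > 2 ^ (n + 1) ∧
      WeaklyDominated φ (pfisterQF n (fun i => (a i : K)) c)

/-- The Artin–Schreier set `℘(K) = {t² + t : t ∈ K}`. -/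
def ArtinSchreier (K : Type) [CommRing K] : Set K := {x : K | ∃ t : K, x = t ^ 2 + t}

end Defs

section FunField

variable (F : Type) [Field F]

/-- The coefficient matrix of a quadratic form on `Fin n → F` with respect to the
standard basis: diagonal entries `ψ(eᵢ)`, above-diagonal entries `b_ψ(eᵢ,eⱼ)`. -/
noncomputable def coeffMat {n : ℕ} (ψ : QuadraticForm F (Fin n → F)) :
    Matrix (Fin n) (Fin n) F :=
  Matrix.of fun i j =>
    if i = j then ψ (Pi.single i 1)
    else if i < j then polar ψ (Pi.single i 1) (Pi.single j 1) else 0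

/-- The homogeneous degree 2 polynomial `P_ψ` associated to a quadratic form `ψ`. -/
noncomputable def qfPoly {n : ℕ} (ψ : QuadraticForm F (Fin n → F)) :
    MvPolynomial (Fin n) F :=
  ∑ i : Fin n, ∑ j : Fin n, MvPolynomial.C (coeffMat F ψ i j) * (X i * X j)

/-- The affine coordinate ring `F[x₁,…,xₙ]/(P_ψ)` of the quadric `ψ = 0`. -/
def FunFieldRing {n : ℕ} (ψ : QuadraticForm F (Fin n → F)) : Type :=
  MvPolynomial (Fin n) F ⧸ Ideal.span {qfPoly F ψ}

noncomputable instance {n : ℕ} (ψ : QuadraticForm F (Fin n → F)) :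
    CommRing (FunFieldRing F ψ) :=
  inferInstanceAs (CommRing (MvPolynomial (Fin n) F ⧸ Ideal.span {qfPoly F ψ}))

noncomputable instance {n : ℕ} (ψ : QuadraticForm F (Fin n → F)) :
    Algebra F (FunFieldRing F ψ) :=
  inferInstanceAs (Algebra F (MvPolynomial (Fin n) F ⧸ Ideal.span {qfPoly F ψ}))

/-- The function field `F(ψ)` of the quadric `ψ = 0`. -/
def FunField {n : ℕ} (ψ : QuadraticForm F (Fin n → F)) : Type :=
  FractionRing (FunFieldRing F ψ)

noncomputable instance {n : ℕ} (ψ : QuadraticForm F (Fin n → F)) :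
    CommRing (FunField F ψ) :=
  inferInstanceAs (CommRing (FractionRing (FunFieldRing F ψ)))

noncomputable instance {n : ℕ} (ψ : QuadraticForm F (Fin n → F)) :
    Algebra (FunFieldRing F ψ) (FunField F ψ) :=
  inferInstanceAs (Algebra (FunFieldRing F ψ) (FractionRing (FunFieldRing F ψ)))

noncomputable instance {n : ℕ} (ψ : QuadraticForm F (Fin n → F)) :
    Algebra F (FunField F ψ) :=
  inferInstanceAs (Algebra F (FractionRing (FunFieldRing F ψ)))

/-- The canonical map `F → F(ψ)`. -/
noncomputable def funFieldMap {n : ℕ} (ψ : QuadraticForm F (Fin n → F)) :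
    F →+* FunField F ψ :=
  algebraMap F (FunField F ψ)

/-- Scalar extension of a quadratic form on `Fin n → F` along a ring homomorphism
`f : F → K`. -/
noncomputable def extendQF {K : Type} [CommRing K] (f : F →+* K) {n : ℕ}
    (φ : QuadraticForm F (Fin n → F)) : QuadraticForm K (Fin n → K) :=
  ((coeffMat F φ).map f).toQuadraticMap'

end FunField


section Quat

variable (K : Type) [CommRing K]

/-- Defining relations for the char-2 quaternion algebra `[a,b)`: generators `i,j` with
`i² + i = a`, `j² = b`, `j·i = i·j + j` (i.e. `j·i·j⁻¹ = i + 1`). -/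
inductive QuatRel (a b : K) : FreeAlgebra K (Fin 2) → FreeAlgebra K (Fin 2) → Prop
  | i_sq : QuatRel a b (FreeAlgebra.ι K 0 * FreeAlgebra.ι K 0 + FreeAlgebra.ι K 0)
      (algebraMap K _ a)
  | j_sq : QuatRel a b (FreeAlgebra.ι K 1 * FreeAlgebra.ι K 1) (algebraMap K _ b)
  | swap : QuatRel a b (FreeAlgebra.ι K 1 * FreeAlgebra.ι K 0)
      (FreeAlgebra.ι K 0 * FreeAlgebra.ι K 1 + FreeAlgebra.ι K 1)

/-- The quaternion algebra `[a,b)` over `K` (characteristic two convention). -/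
def QuatAlg (a b : K) : Type := RingQuot (QuatRel K a b)

noncomputable instance (a b : K) : Ring (QuatAlg K a b) :=
  inferInstanceAs (Ring (RingQuot (QuatRel K a b)))
noncomputable instance (a b : K) : Algebra K (QuatAlg K a b) :=
  inferInstanceAs (Algebra K (RingQuot (QuatRel K a b)))

/-- `[a,b)` is split over `K`: isomorphic to the `2×2` matrix algebra. -/
def QuatSplit (a b : K) : Prop :=
  Nonempty (QuatAlg K a b ≃ₐ[K] Matrix (Fin 2) (Fin 2) K)

end Quat

section Sqrt

variable (F : Type) [Field F]

/-- The field `F(√c₁,…,√c_s)` obtained by adjoining square roots of the `cᵢ`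
(inside an algebraic closure of `F`). -/
noncomputable def sqrtExt {s : ℕ} (c : Fin s → F) :
    IntermediateField F (AlgebraicClosure F) :=
  IntermediateField.adjoin F
    {y : AlgebraicClosure F | ∃ i, y ^ 2 = algebraMap F (AlgebraicClosure F) (c i)}

/-- The subfield `F² = {x² : x ∈ F}` of squares of a field of characteristic 2. -/
noncomputable def sqSubfield : Subfield F := Subfield.closure (Set.range fun x : F => x ^ 2)

set_option synthInstance.maxHeartbeats 1000000 in
/-- The norm degree `[F²(cᵢ·cⱼ) : F²]` of a diagonal form `⟨c₁,…,c_s⟩`. -/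
noncomputable def normDegree {s : ℕ} (c : Fin s → F) : ℕ :=
  Module.finrank (sqSubfield F)
    (IntermediateField.adjoin (sqSubfield F)
      (Set.range fun p : Fin s × Fin s => c p.1 * c p.2))

end Sqrt

/-- A ring is a division algebra if it is nontrivial and every nonzero element is a unit. -/
def IsDivisionAlgebra (T : Type) [Ring T] : Prop :=
  (0 : T) ≠ 1 ∧ ∀ x : T, x ≠ 0 → IsUnit x

set_option linter.unusedSectionVars false

section Blocks

variable {k : Type} [CommRing k] {ι κ μ : Type} [Fintype ι] [Fintype κ] [Fintype μ]

/-- The value of the block form `⊥ᵢ [aᵢ,bᵢ]`, where `d i = (aᵢ, bᵢ)`. -/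
def bq (d : ι → k × k) (v : ι → Fin 2 → k) : k :=
  ∑ i, ((d i).1 * v i 0 ^ 2 + v i 0 * v i 1 + (d i).2 * v i 1 ^ 2)

/-- The common polar form of all block forms indexed by `ι` in characteristic two. -/
def bb (v w : ι → Fin 2 → k) : k := ∑ i, (v i 0 * w i 1 + v i 1 * w i 0)

/-- `bb` as a bilinear map. -/
def bbL : (ι → Fin 2 → k) →ₗ[k] (ι → Fin 2 → k) →ₗ[k] k :=
  LinearMap.mk₂ k bb
    (fun x y z => by simp only [bb, Pi.add_apply, ← Finset.sum_add_distrib]; congr! 1; ring)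
    (fun c x y => by
      simp only [bb, Pi.smul_apply, smul_eq_mul, Finset.mul_sum]; congr! 1; ring)
    (fun x y z => by simp only [bb, Pi.add_apply, ← Finset.sum_add_distrib]; congr! 1; ring)
    (fun c x y => by
      simp only [bb, Pi.smul_apply, smul_eq_mul, Finset.mul_sum]; congr! 1; ring)

@[simp] lemma bbL_apply (v w : ι → Fin 2 → k) : bbL v w = bb v w := rfl

lemma bb_comm (v w : ι → Fin 2 → k) : bb v w = bb w v := by
  simp only [bb]; congr! 1; ring

lemma bb_add_left (x y z : ι → Fin 2 → k) : bb (x + y) z = bb x z + bb y z :=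
  LinearMap.map_add₂ bbL x y z

lemma bb_smul_left (c : k) (x z : ι → Fin 2 → k) : bb (c • x) z = c * bb x z :=
  LinearMap.map_smul₂ bbL c x z

lemma bb_add_right (x y z : ι → Fin 2 → k) : bb x (y + z) = bb x y + bb x z :=
  map_add (bbL x) y z

lemma bb_smul_right (c : k) (x z : ι → Fin 2 → k) : bb x (c • z) = c * bb x z :=
  map_smul (bbL x) c z

@[simp] lemma bb_zero_left (x : ι → Fin 2 → k) : bb 0 x = 0 := LinearMap.map_zero₂ bbL x

@[simp] lemma bb_zero_right (x : ι → Fin 2 → k) : bb x 0 = 0 := map_zero (bbL x)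

@[simp] lemma bb_self [CharP k 2] (x : ι → Fin 2 → k) : bb x x = 0 := by
  apply Finset.sum_eq_zero
  intro i _
  rw [mul_comm]
  exact CharTwo.add_self_eq_zero _

lemma eq_zero_of_bb (x : ι → Fin 2 → k) (h : ∀ y, bb x y = 0) : x = 0 := by
  classical
  funext i j
  have key : ∀ l : Fin 2, bb x (Pi.single i (Pi.single l 1)) =
      x i 0 * (Pi.single l 1 : Fin 2 → k) 1 + x i 1 * (Pi.single l 1 : Fin 2 → k) 0 := by
    intro l
    simp only [bb]
    rw [Finset.sum_eq_single i]
    · simp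
    · intro b _ hb; simp [Pi.single_eq_of_ne hb]
    · simp
  fin_cases j
  · simpa [h] using (key 1).symm
  · simpa [h] using (key 0).symm

lemma bq_add (d : ι → k × k) [CharP k 2] (x y : ι → Fin 2 → k) :
    bq d (x + y) = bq d x + bq d y + bb x y := by
  simp only [bq, bb, ← Finset.sum_add_distrib]
  refine Finset.sum_congr rfl fun i _ => ?_
  simp only [Pi.add_apply, CharTwo.add_sq]
  ring

lemma bq_smul (d : ι → k × k) (c : k) (x : ι → Fin 2 → k) :
    bq d (c • x) = c ^ 2 * bq d x := by
  simp only [bq, Finset.mul_sum, Pi.smul_apply, smul_eq_mul]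
  congr! 1
  ring

@[simp] lemma bq_zero (d : ι → k × k) : bq d 0 = 0 := by simp [bq]

lemma bq_single [DecidableEq ι] (d : ι → k × k) (i : ι) (x : Fin 2 → k) :
    bq d (Pi.single i x) = (d i).1 * x 0 ^ 2 + x 0 * x 1 + (d i).2 * x 1 ^ 2 := by
  simp only [bq]
  rw [Finset.sum_eq_single i]
  · simp
  · intro b _ hb; simp [Pi.single_eq_of_ne hb]
  · simp

/-- Scalar extension of block coefficients. -/
def mapD {L : Type} [CommRing L] (f : k →+* L) (d : ι → k × k) : ι → L × L :=
  fun i => (f (d i).1, f (d i).2)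

lemma bq_map {L : Type} [CommRing L] (f : k →+* L) (d : ι → k × k) (x : ι → Fin 2 → k) :
    bq (mapD f d) (fun i j => f (x i j)) = f (bq d x) := by
  simp [bq, mapD, map_sum]

lemma bb_map {L : Type} [CommRing L] (f : k →+* L) (x y : ι → Fin 2 → k) :
    bb (fun i j => f (x i j)) (fun i j => f (y i j)) = f (bb x y) := by
  simp [bb, map_sum]

end Blocks

section BlocksField

variable {k : Type} [Field k] {ι κ μ : Type} [Fintype ι] [Fintype κ] [Fintype μ]

lemma finrank_block : Module.finrank k (ι → Fin 2 → k) = 2 * Fintype.card ι := by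
  simp [Module.finrank_pi_fintype, mul_comm]

/-- A subspace and a second one orthogonal to it have complementary dimensions at most. -/
lemma finrank_add_le_of_bb (A B : Submodule k (ι → Fin 2 → k))
    (h : ∀ a ∈ A, ∀ b ∈ B, bb a b = 0) :
    Module.finrank k A + Module.finrank k B ≤ 2 * Fintype.card ι := by
  have h1 := Subspace.finrank_add_finrank_dualAnnihilator_eq B
  have hinj : Function.Injective (bbL : (ι → Fin 2 → k) →ₗ[k] _) := by
    rw [← LinearMap.ker_eq_bot, LinearMap.ker_eq_bot']
    intro x hx
    exact eq_zero_of_bb x fun y => by rw [← bbL_apply, hx]; rfl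
  have h2 : Module.finrank k A ≤ Module.finrank k B.dualAnnihilator := by
    have hle : A.map (bbL : (ι → Fin 2 → k) →ₗ[k] Module.Dual k _) ≤ B.dualAnnihilator := by
      rintro _ ⟨a, ha, rfl⟩
      rw [Submodule.mem_dualAnnihilator]
      exact fun b hb => h a ha b hb
    have := Submodule.finrank_mono hle
    rwa [← (Submodule.equivMapOfInjective _ hinj A).finrank_eq] at this
  rw [finrank_block] at h1
  omega

/-- The block form has a totally isotropic subspace of half its dimension. -/
def HypI (d : ι → k × k) : Prop :=
  ∃ M : Submodule k (ι → Fin 2 → k), (∀ x ∈ M, bq d x = 0) ∧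
    Fintype.card ι ≤ Module.finrank k M

/-- Coordinates of a vector of an orthogonal sum. -/
def sumSplit : (ι ⊕ κ → Fin 2 → k) ≃ₗ[k] (ι → Fin 2 → k) × (κ → Fin 2 → k) :=
  LinearEquiv.sumArrowLequivProdArrow ι κ k (Fin 2 → k)

lemma bq_sum (d : ι → k × k) (e : κ → k × k) (z) :
    bq (Sum.elim d e) z = bq d (sumSplit z).1 + bq e (sumSplit z).2 := by
  simp only [bq, Fintype.sum_sum_type]; rfl

lemma bb_sum (z w : ι ⊕ κ → Fin 2 → k) :
    bb z w = bb (sumSplit z).1 (sumSplit w).1 + bb (sumSplit z).2 (sumSplit w).2 := by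
  simp only [bb, Fintype.sum_sum_type]; rfl

lemma bq_pair (d : ι → k × k) (e : κ → k × k) (x y) :
    bq (Sum.elim d e) (sumSplit.symm (x, y)) = bq d x + bq e y := by
  simp [bq_sum]

lemma bq_comp_equiv (d : ι → k × k) (e : κ ≃ ι) (x : ι → Fin 2 → k) :
    bq (d ∘ e) (x ∘ e) = bq d x := by
  simp only [bq, Function.comp]
  exact e.sum_comp (fun i => (d i).1 * x i 0 ^ 2 + x i 0 * x i 1 + (d i).2 * x i 1 ^ 2)

lemma HypI.comp_equiv {d : ι → k × k} (h : HypI d) (e : κ ≃ ι) : HypI (d ∘ e) := by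
  obtain ⟨M, hM, hc⟩ := h
  refine ⟨M.map (LinearEquiv.funCongrLeft k (Fin 2 → k) e).toLinearMap, ?_, ?_⟩
  · rintro _ ⟨x, hx, rfl⟩
    rw [← hM x hx]
    exact bq_comp_equiv d e x
  · rw [LinearEquiv.finrank_map_eq, Fintype.card_congr e]; exact hc

lemma HypI.sum {d : ι → k × k} {e : κ → k × k} (h : HypI d) (h' : HypI e) :
    HypI (Sum.elim d e) := by
  obtain ⟨M, hM, hc⟩ := h
  obtain ⟨N, hN, hc'⟩ := h'
  refine ⟨(LinearMap.range (M.subtype.prodMap N.subtype)).map sumSplit.symm.toLinearMap,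
    ?_, ?_⟩
  · rintro _ ⟨_, ⟨⟨⟨x, hx⟩, ⟨y, hy⟩⟩, rfl⟩, rfl⟩
    simp [bq_pair, hM x hx, hN y hy]
  · rw [LinearEquiv.finrank_map_eq, Fintype.card_sum, LinearMap.finrank_range_of_inj,
      Module.finrank_prod]
    · omega
    · exact Function.Injective.prodMap M.subtype_injective N.subtype_injective

/-- The graph of an isometry is a totally isotropic subspace. -/
lemma HypI.of_isometry [CharP k 2] {d : ι → k × k} {e : κ → k × k}
    (hc : Fintype.card κ ≤ Fintype.card ι)
    (Φ : (ι → Fin 2 → k) →ₗ[k] (κ → Fin 2 → k)) (h : ∀ x, bq e (Φ x) = bq d x) :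
    HypI (Sum.elim d e) := by
  refine ⟨(LinearMap.graph Φ).map sumSplit.symm.toLinearMap, ?_, ?_⟩
  · rintro _ ⟨⟨x, y⟩, hxy, rfl⟩
    change y = Φ x at hxy
    subst hxy
    simp only [LinearEquiv.coe_coe, bq_pair, h]
    exact CharTwo.add_self_eq_zero _
  · rw [LinearEquiv.finrank_map_eq, Fintype.card_sum, LinearMap.graph_eq_range_prod,
      LinearMap.finrank_range_of_inj, finrank_block]
    · omega
    · intro x y hxy
      exact (Prod.ext_iff.1 hxy).1

lemma HypI.self [CharP k 2] (d : ι → k × k) : HypI (Sum.elim d d) :=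
  HypI.of_isometry le_rfl LinearMap.id fun _ => rfl

lemma HypI.bb_eq_zero [CharP k 2] {d : ι → k × k} {M : Submodule k (ι → Fin 2 → k)}
    (h : ∀ x ∈ M, bq d x = 0) {x y} (hx : x ∈ M) (hy : y ∈ M) : bb x y = 0 := by
  have := bq_add d x y
  rw [h _ (M.add_mem hx hy), h x hx, h y hy] at this
  simpa using this.symm

/-- Cancellation of metabolic summands. -/
lemma HypI.cancel [CharP k 2] {d : ι → k × k} {e : κ → k × k}
    (h : HypI (Sum.elim d e)) (he : HypI e) : HypI d := by
  obtain ⟨L, hL, hLc⟩ := h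
  obtain ⟨N, hN, hNc⟩ := he
  set p1 : (ι ⊕ κ → Fin 2 → k) →ₗ[k] (ι → Fin 2 → k) :=
    LinearMap.fst k _ _ ∘ₗ sumSplit.toLinearMap with hp1
  set p2 : (ι ⊕ κ → Fin 2 → k) →ₗ[k] (κ → Fin 2 → k) :=
    LinearMap.snd k _ _ ∘ₗ sumSplit.toLinearMap with hp2
  let K := L ⊓ N.comap p2
  let P := L.map p2
  let A := (L ⊓ LinearMap.ker p1).map p2
  have hqK : ∀ x ∈ K.map p1, bq d x = 0 := by
    rintro _ ⟨z, ⟨hz, hz'⟩, rfl⟩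
    have := hL z hz
    rw [bq_sum] at this
    have h2 := hN _ hz'
    simp only [hp2, LinearMap.comp_apply, LinearEquiv.coe_coe, LinearMap.snd_apply] at h2
    rw [h2, add_zero] at this
    exact this
  refine ⟨K.map p1, hqK, ?_⟩
  have hker : ∀ z, p1 z = 0 → p2 z = 0 → z = 0 := by
    intro z h1 h2
    apply sumSplit.injective
    rw [map_zero]
    exact Prod.ext h1 h2
  -- rank–nullity for the three restricted projections
  have e1 : Module.finrank k P + Module.finrank k (L ⊓ LinearMap.ker p2 : Submodule k _) =
      Module.finrank k L := by
    have := LinearMap.finrank_range_add_finrank_ker (p2.domRestrict L)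
    rw [LinearMap.range_domRestrict, LinearMap.ker_domRestrict] at this
    rw [← this]; congr 1
    rw [← Submodule.finrank_map_subtype_eq, Submodule.map_comap_subtype]
  have e2 : Module.finrank k (K.map p2) + Module.finrank k (K ⊓ LinearMap.ker p2 : Submodule k _) =
      Module.finrank k K := by
    have := LinearMap.finrank_range_add_finrank_ker (p2.domRestrict K)
    rw [LinearMap.range_domRestrict, LinearMap.ker_domRestrict] at this
    rw [← this]; congr 1
    rw [← Submodule.finrank_map_subtype_eq, Submodule.map_comap_subtype]
  have e3 : Module.finrank k (K.map p1) + Module.finrank k (K ⊓ LinearMap.ker p1 : Submodule k _) =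
      Module.finrank k K := by
    have := LinearMap.finrank_range_add_finrank_ker (p1.domRestrict K)
    rw [LinearMap.range_domRestrict, LinearMap.ker_domRestrict] at this
    rw [← this]; congr 1
    rw [← Submodule.finrank_map_subtype_eq, Submodule.map_comap_subtype]
  have e4 : K ⊓ LinearMap.ker p2 = L ⊓ LinearMap.ker p2 := by
    apply le_antisymm
    · exact inf_le_inf_right _ inf_le_left
    · rintro z ⟨hz, hz'⟩
      refine ⟨⟨hz, ?_⟩, hz'⟩
      rw [SetLike.mem_coe, Submodule.mem_comap, LinearMap.mem_ker.1 hz']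
      exact N.zero_mem
  have e5 : K.map p2 = P ⊓ N := by
    ext y; constructor
    · rintro ⟨z, ⟨hz, hz'⟩, rfl⟩
      exact ⟨⟨z, hz, rfl⟩, hz'⟩
    · rintro ⟨⟨z, hz, rfl⟩, hy⟩
      exact ⟨z, ⟨hz, hy⟩, rfl⟩
  have e6 := Submodule.finrank_sup_add_finrank_inf_eq P N
  let B := K ⊓ LinearMap.ker p1
  have e7 : Module.finrank k (B.map p2) = Module.finrank k B := by
    have := LinearMap.finrank_range_add_finrank_ker (p2.domRestrict B)
    rw [LinearMap.range_domRestrict] at this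
    have hk : LinearMap.ker (p2.domRestrict B) = ⊥ := by
      rw [LinearMap.ker_eq_bot']
      rintro ⟨z, hz⟩ hz0
      exact Subtype.ext (hker z hz.2 hz0)
    rw [hk, finrank_bot] at this
    simpa using this
  have e8 := finrank_add_le_of_bb (B.map p2) (P ⊔ N) (by
    rintro _ ⟨z, ⟨⟨hzL, hzN⟩, hz1⟩, rfl⟩ y hy
    obtain ⟨y1, ⟨w, hw, rfl⟩, y2, hy2, rfl⟩ := Submodule.mem_sup.1 hy
    have h1 := HypI.bb_eq_zero hL hzL hw
    rw [bb_sum] at h1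
    have hz1' : (sumSplit z).1 = 0 := hz1
    rw [hz1', bb_zero_left, zero_add] at h1
    have h2 := HypI.bb_eq_zero hN hzN hy2
    rw [bb_add_right, h2, add_zero]
    exact h1)
  rw [e4] at e2
  rw [e5] at e2
  rw [Fintype.card_sum] at hLc
  change Module.finrank k (K.map p1) + Module.finrank k B = _ at e3
  omega

lemma HypI.trans [CharP k 2] {d : ι → k × k} {e : κ → k × k} {f : μ → k × k}
    (h : HypI (Sum.elim d e)) (h' : HypI (Sum.elim e f)) : HypI (Sum.elim d f) := by
  have h1 := h.sum h'
  let E : (ι ⊕ μ) ⊕ (κ ⊕ κ) ≃ (ι ⊕ κ) ⊕ (κ ⊕ μ) :=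
    { toFun := Sum.elim (Sum.elim (fun i => .inl (.inl i)) (fun i => .inr (.inr i)))
        (Sum.elim (fun i => .inl (.inr i)) (fun i => .inr (.inl i)))
      invFun := Sum.elim (Sum.elim (fun i => .inl (.inl i)) (fun i => .inr (.inl i)))
        (Sum.elim (fun i => .inr (.inr i)) (fun i => .inl (.inr i)))
      left_inv := by rintro ((_ | _) | (_ | _)) <;> rfl
      right_inv := by rintro ((_ | _) | (_ | _)) <;> rfl }
  have h2 := h1.comp_equiv E
  have h3 : Sum.elim (Sum.elim d e) (Sum.elim e f) ∘ E =
      Sum.elim (Sum.elim d f) (Sum.elim e e) := by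
    funext x
    rcases x with ((_ | _) | (_ | _)) <;> rfl
  rw [h3] at h2
  exact h2.cancel (HypI.self e)

end BlocksField

section BlocksTwo

variable {k : Type} [Field k] {ι κ μ : Type} [Fintype ι] [Fintype κ] [Fintype μ]

lemma exists_bb_eq (φ : Module.Dual k (ι → Fin 2 → k)) : ∃ f, ∀ x, bb x f = φ x := by
  have hinj : Function.Injective (bbL : (ι → Fin 2 → k) →ₗ[k] Module.Dual k _) := by
    rw [← LinearMap.ker_eq_bot, LinearMap.ker_eq_bot']
    intro x hx
    exact eq_zero_of_bb x fun y => by rw [← bbL_apply, hx]; rfl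
  obtain ⟨f, hf⟩ := (LinearMap.injective_iff_surjective_of_finrank_eq_finrank
    (Subspace.dual_finrank_eq).symm).1 hinj φ
  exact ⟨f, fun x => by rw [bb_comm, ← hf]; rfl⟩

/-- A Lagrangian together with a dual family. -/
lemma HypI.exists_dual [CharP k 2] [DecidableEq ι] {d : ι → k × k} (h : HypI d) :
    ∃ m f : ι → ι → Fin 2 → k, (∀ i, bq d (m i) = 0) ∧ (∀ i j, bb (m i) (m j) = 0) ∧
      ∀ i j, bb (m i) (f j) = if i = j then 1 else 0 := by
  obtain ⟨M, hM, hc⟩ := h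
  let b := Module.finBasis k M
  obtain ⟨emb⟩ : Nonempty (ι ↪ Fin (Module.finrank k M)) :=
    Function.Embedding.nonempty_of_card_le (by simpa using hc)
  obtain ⟨g, hg⟩ := LinearMap.exists_leftInverse_of_injective M.subtype
    (LinearMap.ker_eq_bot.2 M.subtype_injective)
  choose f hf using fun j => exists_bb_eq ((b.coord (emb j)) ∘ₗ g)
  refine ⟨fun i => b (emb i), f, fun i => hM _ (b (emb i)).2,
    fun i j => HypI.bb_eq_zero hM (b (emb i)).2 (b (emb j)).2, fun i j => ?_⟩
  have : g (b (emb i)) = b (emb i) := LinearMap.congr_fun hg (b (emb i))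
  rw [hf, LinearMap.comp_apply, this, Module.Basis.coord_apply, Module.Basis.repr_self,
    Finsupp.single_apply]
  simp [emb.injective.eq_iff]

lemma HypI.of_dual [CharP k 2] [DecidableEq ι] {d : ι → k × k} (m f : ι → ι → Fin 2 → k)
    (h1 : ∀ i, bq d (m i) = 0) (h2 : ∀ i j, bb (m i) (m j) = 0)
    (h3 : ∀ i j, bb (m i) (f j) = if i = j then 1 else 0) : HypI d := by
  have hli : LinearIndependent k m := by
    rw [Fintype.linearIndependent_iff]
    intro c hc j
    have := congrArg (fun x => bbL x (f j)) hc
    simpa [map_sum, LinearMap.sum_apply, h3] using this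
  refine ⟨Submodule.span k (Set.range m), ?_, (finrank_span_eq_card hli).ge⟩
  have h4 : ∀ x ∈ Submodule.span k (Set.range m), ∀ i, bb x (m i) = 0 := by
    intro x hx
    induction hx using Submodule.span_induction with
    | mem x hx => obtain ⟨j, rfl⟩ := hx; exact fun i => h2 j i
    | zero => simp
    | add x y _ _ hx hy => intro i; rw [bb_add_left, hx, hy, add_zero]
    | smul c x _ hx => intro i; rw [bb_smul_left, hx, mul_zero]
  have h5 : ∀ x ∈ Submodule.span k (Set.range m), ∀ y ∈ Submodule.span k (Set.range m),
      bb x y = 0 := by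
    intro x hx y hy
    induction hy using Submodule.span_induction with
    | mem y hy => obtain ⟨j, rfl⟩ := hy; exact h4 x hx j
    | zero => simp
    | add y z _ _ hy hz => rw [bb_add_right, hy, hz, add_zero]
    | smul c y _ hy => rw [bb_smul_right, hy, mul_zero]
  intro x hx
  induction hx using Submodule.span_induction with
  | mem x hx => obtain ⟨j, rfl⟩ := hx; exact h1 j
  | zero => simp
  | add x y hx hy hx' hy' => rw [bq_add, hx', hy', h5 x hx y hy]; simp
  | smul c x _ hx => rw [bq_smul, hx, mul_zero]

lemma HypI.map [CharP k 2] {L : Type} [Field L] [CharP L 2] (f : k →+* L)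
    {d : ι → k × k} (h : HypI d) : HypI (mapD f d) := by
  classical
  obtain ⟨m, g, h1, h2, h3⟩ := h.exists_dual
  refine HypI.of_dual (fun i a b => f (m i a b)) (fun i a b => f (g i a b)) ?_ ?_ ?_
  · intro i; rw [bq_map, h1, map_zero]
  · intro i j; rw [bb_map, h2, map_zero]
  · intro i j; rw [bb_map, h3]; split_ifs <;> simp

/-- Simultaneous scaling `c[a,b] ≅ [ca, b/c]` of all blocks. -/
def scD (c : k) (d : ι → k × k) : ι → k × k := fun i => (c * (d i).1, (d i).2 / c)

/-- The linear map realising `bq (scD c d) ≅ c • bq d`. -/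
def scMap (c : k) (x : ι → Fin 2 → k) : ι → Fin 2 → k := fun i => ![x i 0, c * x i 1]

lemma bq_scMap {c : k} (hc : c ≠ 0) (d : ι → k × k) (x : ι → Fin 2 → k) :
    bq (scD c d) (scMap c x) = c * bq d x := by
  simp only [bq, scD, scMap, Finset.mul_sum]
  refine Finset.sum_congr rfl fun i _ => ?_
  simp only [Matrix.cons_val_zero, Matrix.cons_val_one]
  field_simp

/-- `scMap` as a linear equivalence. -/
def scEquiv (c : k) (hc : c ≠ 0) : (ι → Fin 2 → k) ≃ₗ[k] (ι → Fin 2 → k) where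
  toFun := scMap c
  invFun := scMap c⁻¹
  map_add' x y := by
    funext i j; fin_cases j <;> simp [scMap, mul_add]
  map_smul' a x := by
    funext i j; fin_cases j <;> simp [scMap]; ring
  left_inv x := by
    funext i j; fin_cases j <;> simp [scMap, hc]
  right_inv x := by
    funext i j; fin_cases j <;> simp [scMap, hc]

lemma bq_scEquiv {c : k} (hc : c ≠ 0) (d : ι → k × k) (x : ι → Fin 2 → k) :
    bq (scD c d) (scEquiv c hc x) = c * bq d x := bq_scMap hc d x

lemma HypI.scale {c : k} (hc : c ≠ 0) {d : ι → k × k} (h : HypI d) : HypI (scD c d) := by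
  obtain ⟨M, hM, hr⟩ := h
  refine ⟨M.map (scEquiv c hc).toLinearMap, ?_, by rwa [LinearEquiv.finrank_map_eq]⟩
  rintro _ ⟨x, hx, rfl⟩
  simp [bq_scEquiv, hM x hx]

/-- If the sum is metabolic and the second summand is anisotropic of the same size, then the
Lagrangian is the graph of an isometry. -/
lemma HypI.exists_isometry {d : ι → k × k} {e : κ → k × k} (h : HypI (Sum.elim d e))
    (hc : Fintype.card ι = Fintype.card κ) (he : ∀ y, bq e y = 0 → y = 0) [CharP k 2] :
    ∃ Φ : (ι → Fin 2 → k) →ₗ[k] (κ → Fin 2 → k), ∀ x, bq e (Φ x) = bq d x := by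
  obtain ⟨M, hM, hr⟩ := h
  let p1 : M →ₗ[k] (ι → Fin 2 → k) := LinearMap.fst k _ _ ∘ₗ sumSplit.toLinearMap ∘ₗ M.subtype
  have hinj : Function.Injective p1 := by
    rw [← LinearMap.ker_eq_bot, LinearMap.ker_eq_bot']
    rintro ⟨z, hz⟩ hz0
    have h0 : (sumSplit z).1 = 0 := hz0
    have h1 := hM z hz
    rw [bq_sum, h0, bq_zero, zero_add] at h1
    have h2 := he _ h1
    refine Subtype.ext (sumSplit.injective ?_)
    rw [show sumSplit z = ((sumSplit z).1, (sumSplit z).2) from rfl, h0, h2]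
    exact (map_zero sumSplit).symm
  have hle := LinearMap.finrank_le_finrank_of_injective hinj
  rw [Fintype.card_sum] at hr
  rw [finrank_block] at hle
  have hsurj := (LinearMap.injective_iff_surjective_of_finrank_eq_finrank
    (f := p1) (by rw [finrank_block]; omega)).1 hinj
  let E := LinearEquiv.ofBijective p1 ⟨hinj, hsurj⟩
  refine ⟨LinearMap.snd k _ _ ∘ₗ sumSplit.toLinearMap ∘ₗ M.subtype ∘ₗ E.symm.toLinearMap,
    fun x => ?_⟩
  have h1 := hM _ (E.symm x).2
  rw [bq_sum] at h1
  have h2 : (sumSplit ((E.symm x : M) : ι ⊕ κ → Fin 2 → k)).1 = x := E.apply_symm_apply x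
  rw [h2] at h1
  exact (CharTwo.add_eq_zero.1 h1).symm

/-- If the sum is metabolic, then large subspaces of the first summand are isotropic. -/
lemma HypI.exists_isotropic {d : ι → k × k} {e : κ → k × k} (h : HypI (Sum.elim d e))
    (U : Submodule k (ι → Fin 2 → k))
    (hU : Fintype.card ι + Fintype.card κ < Module.finrank k U) :
    ∃ x ∈ U, x ≠ 0 ∧ bq d x = 0 := by
  obtain ⟨M, hM, hr⟩ := h
  let j : (ι → Fin 2 → k) →ₗ[k] (ι ⊕ κ → Fin 2 → k) :=
    sumSplit.symm.toLinearMap ∘ₗ LinearMap.inl k _ _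
  have hj : Function.Injective j := fun x y hxy =>
    (Prod.ext_iff.1 (sumSplit.symm.injective hxy)).1
  have h1 := Submodule.finrank_sup_add_finrank_inf_eq M (U.map j)
  rw [← (Submodule.equivMapOfInjective j hj U).finrank_eq] at h1
  have h2 := Submodule.finrank_le (M ⊔ U.map j)
  rw [finrank_block, Fintype.card_sum] at h2
  rw [Fintype.card_sum] at hr
  have h3 : M ⊓ U.map j ≠ ⊥ := by
    intro h0
    rw [h0, finrank_bot] at h1
    omega
  obtain ⟨_, ⟨hz, x, hx, rfl⟩, hz0⟩ := Submodule.exists_mem_ne_zero_of_ne_bot h3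
  refine ⟨x, hx, fun h => hz0 (by rw [h, map_zero]), ?_⟩
  have := hM _ hz
  simpa [j, bq_pair] using this

end BlocksTwo

lemma exists_equiv_of_map_univ_eq {α ι κ : Type} [Fintype ι] [Fintype κ] (d : ι → α) (e : κ → α)
    (h : Multiset.map d Finset.univ.val = Multiset.map e Finset.univ.val) :
    ∃ E : ι ≃ κ, d = e ∘ E := by
  classical
  have hcard : ∀ y, Nonempty ({i // d i = y} ≃ {i // e i = y}) := by
    intro y
    rw [← Fintype.card_eq]
    have := congrArg (Multiset.count y) h
    rw [Multiset.count_map, Multiset.count_map] at this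
    rw [Fintype.card_subtype, Fintype.card_subtype]
    simpa [Finset.card, Finset.filter, eq_comm] using this
  let F : ∀ y, {i // d i = y} ≃ {i // e i = y} := fun y => (hcard y).some
  refine ⟨((Equiv.sigmaFiberEquiv d).symm.trans (Equiv.sigmaCongrRight F)).trans
    (Equiv.sigmaFiberEquiv e), ?_⟩
  funext i
  exact ((F (d i)) ⟨i, rfl⟩).2.symm

section WittGroup

variable {k : Type} [Field k] {ι κ : Type} [Fintype ι] [Fintype κ]

/-- A multiset of binary blocks whose orthogonal sum is metabolic. -/
def HypM (s : Multiset (k × k)) : Prop :=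
  ∃ (n : ℕ) (d : Fin n → k × k), Multiset.map d Finset.univ.val = s ∧ HypI d

lemma hypM_iff (d : ι → k × k) : HypM (Multiset.map d Finset.univ.val) ↔ HypI d := by
  constructor
  · rintro ⟨n, e, he, h⟩
    obtain ⟨E, rfl⟩ := exists_equiv_of_map_univ_eq d e he.symm
    exact h.comp_equiv E
  · intro h
    obtain ⟨E⟩ : Nonempty (Fin (Fintype.card ι) ≃ ι) := ⟨(Fintype.equivFin ι).symm⟩
    refine ⟨_, d ∘ E, ?_, h.comp_equiv E⟩
    have := Multiset.map_univ_val_equiv E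
    rw [← this, Multiset.map_map]

lemma exists_family (s : Multiset (k × k)) :
    ∃ (n : ℕ) (d : Fin n → k × k), Multiset.map d Finset.univ.val = s := by
  induction s using Quotient.inductionOn with
  | h l => exact ⟨l.length, l.get, by simp [Fin.univ_val_map]⟩

lemma map_univ_sum (d : ι → k × k) (e : κ → k × k) :
    Multiset.map (Sum.elim d e) Finset.univ.val =
      Multiset.map d Finset.univ.val + Multiset.map e Finset.univ.val := by
  rw [← Finset.univ_disjSum_univ]
  simp [Finset.disjSum, Multiset.disjSum]

lemma hypM_add_iff (d : ι → k × k) (e : κ → k × k) :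
    HypM (Multiset.map d Finset.univ.val + Multiset.map e Finset.univ.val) ↔
      HypI (Sum.elim d e) := by
  rw [← map_univ_sum, hypM_iff]

variable (k) in
/-- Witt equivalence of multisets of binary blocks. -/
def wittCon [CharP k 2] : AddCon (Multiset (k × k)) where
  r s t := HypM (s + t)
  iseqv :=
    { refl := fun s => by
        obtain ⟨n, d, rfl⟩ := exists_family s
        exact (hypM_add_iff d d).2 (HypI.self d)
      symm := fun {s t} h => by rwa [add_comm]
      trans := fun {s t u} h h' => by
        obtain ⟨n, d, rfl⟩ := exists_family s
        obtain ⟨n', d', rfl⟩ := exists_family t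
        obtain ⟨n'', d'', rfl⟩ := exists_family u
        rw [hypM_add_iff] at *
        exact h.trans h' }
  add' := fun {s t u v} h h' => by
    have : s + u + (t + v) = (s + t) + (u + v) := by abel
    rw [this]
    obtain ⟨n, d, hd⟩ := exists_family (s + t)
    obtain ⟨n', d', hd'⟩ := exists_family (u + v)
    rw [← hd, ← hd', hypM_add_iff]
    rw [← hd, hypM_iff] at h
    rw [← hd', hypM_iff] at h'
    exact h.sum h'

variable (k) in
/-- The Witt group of nonsingular quadratic forms in characteristic two. -/
def W [CharP k 2] : Type := (wittCon k).Quotient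

variable [CharP k 2]

noncomputable instance : AddCommMonoid (W k) := inferInstanceAs (AddCommMonoid (wittCon k).Quotient)

variable (k) in
/-- The class of a multiset of blocks. -/
def W.mk : Multiset (k × k) →+ W k := (wittCon k).mk'

lemma W.mk_surjective : Function.Surjective (W.mk k) := (wittCon k).mk'_surjective

lemma W.mk_eq_iff {s t : Multiset (k × k)} : W.mk k s = W.mk k t ↔ HypM (s + t) :=
  (wittCon k).eq

lemma W.add_self (x : W k) : x + x = 0 := by
  obtain ⟨s, rfl⟩ := W.mk_surjective x
  rw [← map_add, ← map_zero (W.mk k), W.mk_eq_iff, add_zero]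
  exact (wittCon k).refl s

noncomputable instance : Neg (W k) := ⟨id⟩

noncomputable instance : AddCommGroup (W k) where
  zsmul := zsmulRec
  neg_add_cancel := W.add_self

/-- The class of `[a,b]`. -/
noncomputable def w (a b : k) : W k := W.mk k {(a, b)}

/-- The class of a block form. -/
noncomputable def cl (d : ι → k × k) : W k := ∑ i, w (d i).1 (d i).2

lemma cl_eq_mk (d : ι → k × k) : cl d = W.mk k (Multiset.map d Finset.univ.val) := by
  simp only [cl, w]
  rw [← map_sum]
  congr 1
  rw [Finset.sum]
  have := Multiset.sum_map_singleton (Multiset.map d Finset.univ.val)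
  rw [Multiset.map_map] at this
  exact this

lemma cl_eq_iff {d : ι → k × k} {e : κ → k × k} : cl d = cl e ↔ HypI (Sum.elim d e) := by
  rw [cl_eq_mk, cl_eq_mk, W.mk_eq_iff, hypM_add_iff]

lemma cl_eq_zero_iff {d : ι → k × k} : cl d = 0 ↔ HypI d := by
  rw [cl_eq_mk, ← map_zero (W.mk k), W.mk_eq_iff, add_zero, hypM_iff]

lemma cl_sum (d : ι → k × k) (e : κ → k × k) : cl (Sum.elim d e) = cl d + cl e := by
  simp [cl]

lemma W.eq_iff_add {x y : W k} : x = y ↔ x + y = 0 :=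
  ⟨fun h => h ▸ W.add_self x, fun h => by
    rw [← add_zero x, ← W.add_self y, ← add_assoc, h, zero_add]⟩

lemma W.induction {p : W k → Prop} (x : W k) (h0 : p 0) (hw : ∀ a b, p (w a b))
    (hadd : ∀ x y, p x → p y → p (x + y)) : p x := by
  obtain ⟨s, rfl⟩ := W.mk_surjective x
  induction s using Multiset.induction with
  | empty => simpa using h0
  | cons a s ih => rw [← Multiset.singleton_add, map_add]; exact hadd _ _ (hw a.1 a.2) ih

end WittGroup

section WittRelations

variable {k : Type} [Field k] [CharP k 2] {ι κ : Type} [Fintype ι] [Fintype κ]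

lemma cl_eq_of_isometry {d : ι → k × k} {e : κ → k × k}
    (hc : Fintype.card κ ≤ Fintype.card ι)
    (Φ : (ι → Fin 2 → k) →ₗ[k] (κ → Fin 2 → k)) (h : ∀ x, bq e (Φ x) = bq d x) :
    cl d = cl e :=
  cl_eq_iff.2 (HypI.of_isometry hc Φ h)

lemma cl_one (a b : k) : cl (fun _ : Fin 1 => (a, b)) = w a b := by simp [cl]

lemma cl_two (a b c d : k) : cl ![(a, b), (c, d)] = w a b + w c d := by simp [cl, Fin.sum_univ_two]

lemma w_eq_of_isometry {a b c d : k} (p q r s : k)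
    (h : ∀ x y, c * (p * x + q * y) ^ 2 + (p * x + q * y) * (r * x + s * y) +
      d * (r * x + s * y) ^ 2 = a * x ^ 2 + x * y + b * y ^ 2) : w a b = w c d := by
  rw [← cl_one, ← cl_one]
  refine cl_eq_of_isometry le_rfl
    (LinearMap.pi fun i => (Matrix.toLin' !![p, q; r, s]) ∘ₗ LinearMap.proj i) fun x => ?_
  simpa [bq, Matrix.toLin'_apply, Matrix.mulVec, dotProduct, Fin.sum_univ_two, Matrix.vecHead,
    Matrix.vecTail] using h (x 0 0) (x 0 1)

lemma w_swap (a b : k) : w a b = w b a :=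
  w_eq_of_isometry 0 1 1 0 fun x y => by ring

lemma two_eq_zero' : (2 : k) = 0 := CharTwo.two_eq_zero

lemma w_shift (a b t : k) : w a b = w a (b + a * t ^ 2 + t) :=
  w_eq_of_isometry 1 t 0 1 fun x y => by
    linear_combination (a * t * x * y + a * t ^ 2 * y ^ 2 + t * y ^ 2) * two_eq_zero' (k := k)

@[simp] lemma w_zero_left (b : k) : w 0 b = 0 := by
  rw [← cl_one, cl_eq_zero_iff]
  refine ⟨Submodule.span k {fun _ => ![1, 0]}, ?_, ?_⟩
  · intro x hx
    obtain ⟨c, rfl⟩ := Submodule.mem_span_singleton.1 hx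
    simp [bq]
  · rw [finrank_span_singleton]
    · simp
    · intro h
      have := congrFun (congrFun h 0) 0
      simp at this

@[simp] lemma w_zero_right (b : k) : w b 0 = 0 := by rw [w_swap, w_zero_left]

lemma w_sq (a b t : k) : w (t ^ 2 * a) b = w a (t ^ 2 * b) := by
  by_cases ht : t = 0
  · simp [ht]
  · exact w_eq_of_isometry t 0 0 t⁻¹ fun x y => by field_simp; ring

/-- The chain relation. -/
lemma w_chain (a b c d t : k) :
    w a b + w c d = w (a + t ^ 2 * c) b + w c (d + t ^ 2 * b) := by
  rw [← cl_two, ← cl_two]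
  refine (cl_eq_of_isometry le_rfl
    { toFun := fun x => ![![x 0 0, x 0 1 + t * x 1 1], ![x 1 0 + t * x 0 0, x 1 1]]
      map_add' := fun x y => by
        ext i j; fin_cases i <;> fin_cases j <;> simp <;> ring
      map_smul' := fun c x => by
        ext i j; fin_cases i <;> fin_cases j <;> simp <;> ring } fun x => ?_).symm
  simp [bq, Fin.sum_univ_two]
  linear_combination (b * x 0 1 * t * x 1 1 + x 0 0 * t * x 1 1 + c * x 1 0 * t * x 0 0) *
    two_eq_zero' (k := k)

lemma w_add_right (a b d : k) : w a (b + d) = w a b + w a d := by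
  have := w_chain a b a d 1
  rw [this, one_pow, one_mul, one_mul, CharTwo.add_self_eq_zero, w_zero_left, zero_add, add_comm]

lemma w_one_sq (z : k) : w 1 (z ^ 2) = w 1 z := by
  rw [w_shift 1 (z ^ 2) z]
  congr 1
  linear_combination z ^ 2 * two_eq_zero' (k := k)

/-- The universal property of the Witt group. -/
noncomputable def W.lift {A : Type} [AddCommMonoid A] (f : Multiset (k × k) →+ A)
    (h : ∀ s t, wittCon k s t → f s = f t) : W k →+ A :=
  (wittCon k).lift f fun s t hst => h s t hst

lemma W.lift_w {A : Type} [AddCommMonoid A] (f : Multiset (k × k) →+ A)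
    (h : ∀ s t, wittCon k s t → f s = f t) (a b : k) : W.lift f h (w a b) = f {(a, b)} :=
  AddCon.lift_coe _ _

/-- Multiplication of Witt classes by `⟨c⟩` (zero when `c = 0`). -/
noncomputable def sc (c : k) : W k →+ W k := by
  classical
  exact if h : c = 0 then 0 else
    W.lift ((W.mk k).comp
      (Multiset.mapAddMonoidHom fun p : k × k => (c * p.1, p.2 / c))) (by
        intro s t hst
        simp only [AddMonoidHom.comp_apply, Multiset.coe_mapAddMonoidHom]
        rw [W.mk_eq_iff, ← Multiset.map_add]
        change HypM (s + t) at hst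
        obtain ⟨n, d, hd⟩ := exists_family (s + t)
        rw [← hd, hypM_iff] at hst
        rw [← hd, Multiset.map_map, hypM_iff]
        exact hst.scale h)

@[simp] lemma sc_zero (x : W k) : sc 0 x = 0 := by simp [sc]

lemma sc_w {c : k} (hc : c ≠ 0) (a b : k) : sc c (w a b) = w (c * a) (b / c) := by
  rw [sc, dif_neg hc]
  exact (W.lift_w _ _ _ _).trans (by simp [w])

lemma sc_mul (c d : k) (x : W k) : sc (c * d) x = sc c (sc d x) := by
  by_cases hc : c = 0
  · simp [hc]
  by_cases hd : d = 0
  · simp [hd]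
  induction x using W.induction with
  | h0 => simp
  | hw a b => rw [sc_w hd, sc_w hc, sc_w (mul_ne_zero hc hd)]; congr 1; ring; field_simp
  | hadd x y hx hy => simp only [map_add, hx, hy]

@[simp] lemma sc_one (x : W k) : sc 1 x = x := by
  induction x using W.induction with
  | h0 => simp
  | hw a b => rw [sc_w one_ne_zero]; simp
  | hadd x y hx hy => simp only [map_add, hx, hy]

lemma sc_sq {t : k} (ht : t ≠ 0) (x : W k) : sc (t ^ 2) x = x := by
  induction x using W.induction with
  | h0 => simp
  | hw a b =>
    rw [sc_w (pow_ne_zero 2 ht), w_sq]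
    congr 1
    field_simp
  | hadd x y hx hy => simp only [map_add, hx, hy]

lemma sc_comm (c d : k) (x : W k) : sc c (sc d x) = sc d (sc c x) := by
  rw [← sc_mul, mul_comm, sc_mul]

lemma sc_sc {c : k} (hc : c ≠ 0) (x : W k) : sc c (sc c x) = x := by
  rw [← sc_mul, ← pow_two, sc_sq hc]

lemma sc_cl {c : k} (hc : c ≠ 0) (d : ι → k × k) : sc c (cl d) = cl (scD c d) := by
  simp only [cl, map_sum, sc_w hc, scD]

lemma sc_inv (c : k) (x : W k) : sc c⁻¹ x = sc c x := by
  by_cases hc : c = 0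
  · simp [hc]
  · rw [show c⁻¹ = c * (c⁻¹) ^ 2 by field_simp, sc_mul, sc_sq (inv_ne_zero hc)]

lemma sc_div (c d : k) (x : W k) : sc (c / d) x = sc c (sc d x) := by
  rw [div_eq_mul_inv, sc_mul, sc_inv]

/-- Scalar extension of Witt classes. -/
noncomputable def W.map {L : Type} [Field L] [CharP L 2] (f : k →+* L) : W k →+ W L :=
  W.lift ((W.mk L).comp
    (Multiset.mapAddMonoidHom fun p : k × k => (f p.1, f p.2))) (by
      intro s t hst
      simp only [AddMonoidHom.comp_apply, Multiset.coe_mapAddMonoidHom]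
      rw [W.mk_eq_iff, ← Multiset.map_add]
      change HypM (s + t) at hst
      obtain ⟨n, d, hd⟩ := exists_family (s + t)
      rw [← hd, hypM_iff] at hst
      rw [← hd, Multiset.map_map, hypM_iff]
      exact hst.map f)

variable {L : Type} [Field L] [CharP L 2] (f : k →+* L)

@[simp] lemma W.map_w (a b : k) : W.map f (w a b) = w (f a) (f b) :=
  (W.lift_w _ _ _ _).trans (by simp [w])

lemma W.map_cl (d : ι → k × k) : W.map f (cl d) = cl (mapD f d) := by
  simp [cl, mapD]

lemma W.map_sc (c : k) (x : W k) : W.map f (sc c x) = sc (f c) (W.map f x) := by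
  by_cases hc : c = 0
  · simp [hc]
  induction x using W.induction with
  | h0 => simp
  | hw a b => rw [sc_w hc, W.map_w, W.map_w, sc_w ((map_ne_zero f).2 hc)]; simp
  | hadd x y hx hy => simp only [map_add, hx, hy]

/-- Two forms of the same class, the second anisotropic, of the same size: values transfer. -/
lemma exists_isometry_of_cl_eq {d : ι → k × k} {e : κ → k × k} (h : cl d = cl e)
    (hc : Fintype.card ι = Fintype.card κ) (he : ∀ y, bq e y = 0 → y = 0) :
    ∃ Φ : (ι → Fin 2 → k) →ₗ[k] (κ → Fin 2 → k), ∀ x, bq e (Φ x) = bq d x :=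
  (cl_eq_iff.1 h).exists_isometry hc he

lemma exists_isotropic_of_cl_eq {d : ι → k × k} {e : κ → k × k} (h : cl d = cl e)
    (hc : Fintype.card κ < Fintype.card ι) : ∃ x, x ≠ 0 ∧ bq d x = 0 := by
  obtain ⟨x, -, hx⟩ := (cl_eq_iff.1 h).exists_isotropic ⊤ (by
    rw [finrank_top, finrank_block]; omega)
  exact ⟨x, hx⟩

/-- A subspace of dimension more than half is isotropic when the class vanishes. -/
lemma exists_isotropic_of_cl_eq_zero {d : ι → k × k} (h : cl d = 0)
    (U : Submodule k (ι → Fin 2 → k)) (hU : Fintype.card ι < Module.finrank k U) :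
    ∃ x ∈ U, x ≠ 0 ∧ bq d x = 0 := by
  have h' : cl d = cl (Fin.elim0 : Fin 0 → k × k) := by rw [h]; simp [cl]
  exact (cl_eq_iff.1 h').exists_isotropic U (by simpa using hU)

end WittRelations

lemma binQF_apply {K : Type} [CommRing K] (a b : K) (x : Fin 2 → K) :
    binQF a b x = a * x 0 ^ 2 + x 0 * x 1 + b * x 1 ^ 2 := by
  simp only [binQF, Matrix.toQuadraticMap', Matrix.toQuadraticForm',
    LinearMap.BilinMap.toQuadraticMap_apply, Matrix.toLinearMap₂'_apply, Fin.sum_univ_two]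
  simp
  ring

section Splitting

variable {k : Type} [Field k] [CharP k 2] {ι : Type} [Fintype ι]

/-- The block form as a quadratic form. -/
noncomputable def bqForm (d : ι → k × k) : QuadraticForm k (ι → Fin 2 → k) :=
  QuadraticMap.pi fun i => binQF (d i).1 (d i).2

@[simp] lemma bqForm_apply (d : ι → k × k) (x) : bqForm d x = bq d x := by
  simp [bqForm, QuadraticMap.pi_apply, bq, binQF_apply]

lemma polar_bqForm (d : ι → k × k) (x y) : polar (bqForm d) x y = bb x y := by
  simp only [polar, bqForm_apply, bq_add]; ring

variable {V : Type} [AddCommGroup V] [Module k V]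

lemma polar_self_two (Q : QuadraticForm k V) (x : V) : polar Q x x = 0 := by
  rw [QuadraticMap.polar_self]; simp [two_eq_zero' (k := k)]

/-- The orthogonal complement of two vectors. -/
def perpPair (Q : QuadraticForm k V) (v u : V) : Submodule k V :=
  LinearMap.ker (Q.polarBilin v) ⊓ LinearMap.ker (Q.polarBilin u)

lemma mem_perpPair {Q : QuadraticForm k V} {v u x : V} :
    x ∈ perpPair Q v u ↔ polar Q v x = 0 ∧ polar Q u x = 0 := Iff.rfl

/-- Splitting off the plane spanned by a symplectic pair. -/
def splitPair (Q : QuadraticForm k V) (v u : V) (h : polar Q v u = 1) :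
    V ≃ₗ[k] (Fin 2 → k) × perpPair Q v u where
  toFun x := (![polar Q u x, polar Q v x],
    ⟨x + polar Q u x • v + polar Q v x • u, by
      have h' : polar Q u v = 1 := by rw [polar_comm, h]
      rw [mem_perpPair]
      simp only [polar_add_right, polar_smul_right, polar_self_two, h, h', smul_eq_mul]
      constructor
      · linear_combination (polar Q v x) * two_eq_zero' (k := k)
      · linear_combination (polar Q u x) * two_eq_zero' (k := k)⟩)
  invFun y := y.1 0 • v + y.1 1 • u + y.2
  map_add' x y := by
    refine Prod.ext ?_ (Subtype.ext ?_)
    · ext j; fin_cases j <;> simp [polar_add_right]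
    · simp only [polar_add_right, Prod.snd_add, Submodule.coe_add]; module
  map_smul' c x := by
    refine Prod.ext ?_ (Subtype.ext ?_)
    · ext j; fin_cases j <;> simp [polar_smul_right]
    · simp only [polar_smul_right, Prod.smul_snd, Submodule.coe_smul, RingHom.id_apply,
        smul_eq_mul]; module
  left_inv x := by
    simp only [Matrix.cons_val_zero, Matrix.cons_val_one]
    have h2 : ∀ y : V, y + y = 0 := fun y => by
      rw [← two_smul k, two_eq_zero', zero_smul]
    have h1 := h2 (polar Q u x • v)
    have h3 := h2 (polar Q v x • u)
    grind
  right_inv y := by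
    have h' : polar Q u v = 1 := by rw [polar_comm, h]
    obtain ⟨a, ⟨z, hz⟩⟩ := y
    obtain ⟨hz1, hz2⟩ := mem_perpPair.1 hz
    have e1 : polar Q u (a 0 • v + a 1 • u + z) = a 0 := by
      simp [polar_add_right, polar_smul_right, h', hz2, two_eq_zero' (k := k)]
    have e2 : polar Q v (a 0 • v + a 1 • u + z) = a 1 := by
      simp [polar_add_right, polar_smul_right, h, hz1, two_eq_zero' (k := k)]
    have h2 : ∀ y : V, y + y = 0 := fun y => by
      rw [← two_smul k, two_eq_zero', zero_smul]
    refine Prod.ext ?_ (Subtype.ext ?_)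
    · ext j; fin_cases j
      · exact e1
      · exact e2
    · simp only [e1, e2]
      have h3 := h2 (a 0 • v)
      have h4 := h2 (a 1 • u)
      grind

lemma splitPair_form (Q : QuadraticForm k V) (v u : V) (h : polar Q v u = 1) (x : V) :
    Q x = Q v * (splitPair Q v u h x).1 0 ^ 2 +
      (splitPair Q v u h x).1 0 * (splitPair Q v u h x).1 1 +
      Q u * (splitPair Q v u h x).1 1 ^ 2 + Q (splitPair Q v u h x).2 := by
  set y := splitPair Q v u h x with hy
  have hx : x = y.1 0 • v + y.1 1 • u + y.2 := ((splitPair Q v u h).left_inv x).symm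
  obtain ⟨hz1, hz2⟩ := mem_perpPair.1 y.2.2
  rw [hx, QuadraticMap.map_add Q (y.1 0 • v + y.1 1 • u) (y.2 : V),
    QuadraticMap.map_add Q (y.1 0 • v)]
  simp only [polar_add_left, polar_smul_left, polar_smul_right, QuadraticMap.map_smul, hz1, hz2,
    h, smul_eq_mul]
  ring

lemma exists_symplectic {Q : QuadraticForm k V} (hQ : ∀ x, (∀ y, polar Q x y = 0) → x = 0)
    {v : V} (hv : v ≠ 0) : ∃ u, polar Q v u = 1 := by
  by_contra hcon
  refine hv (hQ v fun y => ?_)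
  by_contra hy
  exact hcon ⟨(polar Q v y)⁻¹ • y, by rw [polar_smul_right, smul_eq_mul, inv_mul_cancel₀ hy]⟩

lemma perpPair_nondeg {Q : QuadraticForm k V} (hQ : ∀ x, (∀ y, polar Q x y = 0) → x = 0)
    {v u : V} (h : polar Q v u = 1) (x : perpPair Q v u)
    (hx : ∀ y, polar (Q.comp (perpPair Q v u).subtype) x y = 0) : x = 0 := by
  refine Subtype.ext (hQ _ fun y => ?_)
  set z := splitPair Q v u h y with hz
  have hy : y = z.1 0 • v + z.1 1 • u + z.2 := ((splitPair Q v u h).left_inv y).symm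
  obtain ⟨hz1, hz2⟩ := mem_perpPair.1 x.2
  have h3 : polar Q x z.2 = 0 := by
    have := hx z.2
    simpa [polar] using this
  rw [hy]
  simp only [polar_add_right, polar_smul_right, polar_comm Q (x : V) v, polar_comm Q (x : V) u,
    hz1, hz2, h3]
  simp

/-- Every nonsingular form is a block form. -/
lemma exists_block_decomposition : ∀ (n : ℕ) (V : Type) [AddCommGroup V] [Module k V]
    [FiniteDimensional k V] (Q : QuadraticForm k V), (∀ x, (∀ y, polar Q x y = 0) → x = 0) →
    Module.finrank k V = n → ∃ (r : ℕ) (d : Fin r → k × k) (e : V ≃ₗ[k] (Fin r → Fin 2 → k)),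
      2 * r = n ∧ ∀ x, bq d (e x) = Q x := by
  intro n
  induction n using Nat.strong_induction_on with
  | _ n ih =>
    intro V _ _ _ Q hQ hn
    rcases Nat.eq_zero_or_pos n with rfl | hpos
    · have := Module.finrank_zero_iff.1 hn
      refine ⟨0, fun _ => 0, 0, rfl, fun x => ?_⟩
      rw [Subsingleton.elim x 0]; simp [bq]
    · have : Nontrivial V := Module.nontrivial_of_finrank_pos (R := k) (by omega)
      obtain ⟨v, hv⟩ := exists_ne (0 : V)
      obtain ⟨u, hu⟩ := exists_symplectic hQ hv
      have hfr := (splitPair Q v u hu).finrank_eq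
      rw [Module.finrank_prod, Module.finrank_fin_fun] at hfr
      obtain ⟨r, d, e, hr, he⟩ := ih (n - 2) (by omega) (perpPair Q v u)
        (Q.comp (perpPair Q v u).subtype) (perpPair_nondeg hQ hu) (by omega)
      refine ⟨r + 1, Fin.cons (Q v, Q u) d, (splitPair Q v u hu).trans
        ((LinearEquiv.prodCongr (LinearEquiv.refl k _) e).trans
          (Fin.consLinearEquiv k fun _ => Fin 2 → k)), by omega, fun x => ?_⟩
      rw [splitPair_form Q v u hu x]
      have := he (splitPair Q v u hu x).2
      simp only [bq, QuadraticMap.comp_apply, Submodule.subtype_apply] at this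
      rw [← this]
      simp [bq, Fin.sum_univ_succ]

/-- Splitting off a plane containing a given vector. -/
lemma exists_extract (d : ι → k × k) {v : ι → Fin 2 → k} (hv : v ≠ 0) :
    ∃ (c : k) (r : ℕ) (d' : Fin r → k × k)
      (e : (ι → Fin 2 → k) ≃ₗ[k] (Fin 2 → k) × (Fin r → Fin 2 → k)),
      r + 1 = Fintype.card ι ∧ e v = (![1, 0], 0) ∧ (∀ x, (e x).1 1 = bb v x) ∧
      (∀ x, bq d x = bq d v * (e x).1 0 ^ 2 + (e x).1 0 * (e x).1 1 + c * (e x).1 1 ^ 2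
        + bq d' (e x).2) ∧
      cl d = w (bq d v) c + cl d' := by
  have hQ : ∀ x, (∀ y, polar (bqForm d) x y = 0) → x = 0 := fun x hx =>
    eq_zero_of_bb x fun y => by rw [← polar_bqForm d, hx]
  obtain ⟨u, hu⟩ := exists_symplectic hQ hv
  have hfr := (splitPair (bqForm d) v u hu).finrank_eq
  rw [Module.finrank_prod, Module.finrank_fin_fun, finrank_block] at hfr
  obtain ⟨r, d', e, hr, he⟩ := exists_block_decomposition _ (perpPair (bqForm d) v u)
    ((bqForm d).comp (perpPair (bqForm d) v u).subtype) (perpPair_nondeg hQ hu) rfl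
  have hform : ∀ x, bq d x = bq d v * (splitPair (bqForm d) v u hu x).1 0 ^ 2 +
      (splitPair (bqForm d) v u hu x).1 0 * (splitPair (bqForm d) v u hu x).1 1 +
      bq d u * (splitPair (bqForm d) v u hu x).1 1 ^ 2 +
      bq d' (e (splitPair (bqForm d) v u hu x).2) := fun x => by
    have := splitPair_form (bqForm d) v u hu x
    rw [he]
    simpa using this
  let E := (splitPair (bqForm d) v u hu).trans (LinearEquiv.prodCongr (LinearEquiv.refl k _) e)
  refine ⟨bq d u, r, d', E, by omega, ?_, fun x => ?_, hform, ?_⟩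
  · have h1 : splitPair (bqForm d) v u hu v = (![1, 0], 0) := by
      apply (splitPair (bqForm d) v u hu).symm.injective
      rw [LinearEquiv.symm_apply_apply]
      change v = (1 : k) • v + (0 : k) • u + 0
      simp
    rw [LinearEquiv.trans_apply, h1]
    simp
  · exact polar_bqForm d v x
  · have h2 : w (bq d v) (bq d u) + cl d' =
        cl (Fin.cons (bq d v, bq d u) d' : Fin (r+1) → k × k) := by
      simp [cl, Fin.sum_univ_succ]
    rw [h2]
    refine cl_eq_of_isometry (by simp; omega)
      (E.trans (Fin.consLinearEquiv k fun _ => Fin 2 → k)).toLinearMap fun x => ?_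
    rw [hform x]
    simp [bq, Fin.sum_univ_succ, E]

end Splitting

section Roundness

variable {k : Type} [Field k] [CharP k 2] {ι κ : Type} [Fintype ι] [Fintype κ]

/-- The class of `[1,y]`. -/
noncomputable def nn (y : k) : W k := w 1 y

lemma nn_add (x y : k) : nn (x + y) = nn x + nn y := w_add_right 1 x y

@[simp] lemma nn_zero : nn (0 : k) = 0 := w_zero_right 1

lemma nn_sq (x : k) : nn (x ^ 2) = nn x := w_one_sq x

lemma sc_nn (a y : k) : sc a (nn y) = w a (y / a) := by
  by_cases ha : a = 0
  · simp [ha]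
  · rw [nn, sc_w ha, mul_one]

/-- Values of `[1,z]` are similarity factors. -/
lemma sc_value (z x y : k) (h : x ≠ 0 ∨ y ≠ 0) :
    sc (x ^ 2 + x * y + z * y ^ 2) (nn z) = nn z := by
  by_cases hy : y = 0
  · subst hy
    rw [show x ^ 2 + x * 0 + z * 0 ^ 2 = x ^ 2 by ring, sc_sq (by simpa using h)]
  · set t := x / y with ht
    have h1 : x ^ 2 + x * y + z * y ^ 2 = y ^ 2 * (t ^ 2 + t + z) := by
      rw [ht]; field_simp
    have h2 : nn z = w 1 (t ^ 2 + t + z) := by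
      rw [nn, w_shift 1 z t]; congr 1; ring
    rw [h1, sc_mul, sc_sq hy, h2]
    by_cases hN : t ^ 2 + t + z = 0
    · simp [hN]
    · conv_lhs => rw [sc_w hN, mul_one, div_self hN]
      exact w_swap _ _

lemma sc_one_add (c : k) (hc : c ≠ 0) (hc1 : 1 + c ≠ 0) (y : W k) :
    sc (1 + c) (y + sc c y) = y + sc c y := by
  induction y using W.induction with
  | h0 => simp
  | hw a b =>
    rw [map_add, sc_w hc, sc_w hc1, sc_w hc1, w_chain a b (c * a) (b / c) 1,
      w_swap (a + 1 ^ 2 * (c * a)), w_swap (c * a),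
      w_chain b (a + 1 ^ 2 * (c * a)) (b / c + 1 ^ 2 * b) (c * a) (c / (1 + c))]
    rw [w_swap ((1 + c) * a)]
    congr 1
    · congr 1
      · field_simp
        linear_combination (-b * c) * two_eq_zero' (k := k)
      · ring
    · rw [show (1 + c) * (c * a) = (1 + c) ^ 2 * ((c * a) / (1 + c)) by field_simp, w_sq,
        w_swap]
      congr 1
      · field_simp
      · field_simp
        linear_combination (-c * a) * two_eq_zero' (k := k)
  | hadd x y hx hy =>
    have : x + y + sc c (x + y) = (x + sc c x) + (y + sc c y) := by rw [map_add]; abel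
    rw [this, map_add, hx, hy]

/-- Every nonzero value is a similarity factor (and the class vanishes if the form is
isotropic). -/
def IsRound (d : ι → k × k) : Prop := ∀ v, v ≠ 0 → sc (bq d v) (cl d) = cl d

/-- The orthogonal sum `d ⊥ b·d`. -/
def dbl (b : k) (d : ι → k × k) : ι ⊕ ι → k × k := Sum.elim d (scD b d)

lemma cl_dbl {b : k} (hb : b ≠ 0) (d : ι → k × k) : cl (dbl b d) = cl d + sc b (cl d) := by
  rw [dbl, cl_sum, sc_cl hb]

lemma IsRound.dbl {d : ι → k × k} (h : IsRound d) {b : k} (hb : b ≠ 0) : IsRound (dbl b d) := by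
  intro v hv
  rw [cl_dbl hb]
  set y := cl d with hy
  set v1 := (sumSplit v).1 with hv1
  set v2 := (scEquiv b hb).symm (sumSplit v).2 with hv2
  have hN : bq (_root_.dbl b d) v = bq d v1 + b * bq d v2 := by
    rw [_root_.dbl, bq_sum, ← bq_scEquiv hb, hv2, LinearEquiv.apply_symm_apply]
  have hne : v1 ≠ 0 ∨ v2 ≠ 0 := by
    by_contra hcon
    push Not at hcon
    apply hv
    apply sumSplit.injective
    rw [map_zero]
    refine Prod.ext hcon.1 ?_
    have := hcon.2
    rw [hv2, LinearEquiv.map_eq_zero_iff] at this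
    exact this
  rw [hN]
  by_cases hy0 : y = 0
  · simp [hy0]
  have hA : v1 ≠ 0 → sc (bq d v1) y = y := h v1
  have hB : v2 ≠ 0 → sc (bq d v2) y = y := h v2
  by_cases h1 : v1 = 0
  · have h2 : v2 ≠ 0 := by simpa [h1] using hne
    rw [h1, bq_zero, zero_add, sc_mul, map_add, hB h2, sc_comm, hB h2, map_add, sc_sc hb, add_comm]
  by_cases h2 : v2 = 0
  · rw [h2, bq_zero, mul_zero, add_zero, map_add, hA h1, sc_comm, hA h1]
  have hA0 : bq d v1 ≠ 0 := fun h0 => hy0 (by rw [← hA h1, h0, sc_zero])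
  have hB0 : bq d v2 ≠ 0 := fun h0 => hy0 (by rw [← hB h2, h0, sc_zero])
  set c := b * bq d v2 / bq d v1 with hc
  have hc0 : c ≠ 0 := div_ne_zero (mul_ne_zero hb hB0) hA0
  have hscc : sc c y = sc b y := by
    rw [hc, sc_div, hA h1, sc_mul, hB h2]
  have hfac : bq d v1 + b * bq d v2 = (1 + c) * bq d v1 := by rw [hc]; field_simp
  rw [← hscc, hfac, sc_mul, map_add, hA h1, sc_comm, hA h1]
  by_cases hc1 : 1 + c = 0
  · have : c = 1 := (CharTwo.add_eq_zero.1 hc1).symm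
    rw [this, sc_one, W.add_self, map_zero]
  · exact sc_one_add c hc0 hc1 y

/-- The block `[1,z]`. -/
def P1D (z : k) : Unit → k × k := fun _ => (1, z)

lemma cl_P1D (z : k) : cl (P1D z) = nn z := by simp [cl, P1D, nn]

lemma isRound_P1D (z : k) : IsRound (P1D z) := by
  intro v hv
  rw [cl_P1D]
  have : bq (P1D z) v = v () 0 ^ 2 + v () 0 * v () 1 + z * v () 1 ^ 2 := by simp [bq, P1D]
  rw [this]
  apply sc_value
  by_contra hcon
  push Not at hcon
  apply hv
  funext i j
  fin_cases j
  · exact hcon.1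
  · exact hcon.2

/-- The class of the two-fold Pfister form `⟨1,a⟩ ⊗ [1,y]`. -/
noncomputable def P2 (y a : k) : W k := nn y + sc a (nn y)

/-- The class of the three-fold Pfister form `⟨1,b⟩ ⊗ ⟨1,a⟩ ⊗ [1,y]`. -/
noncomputable def P3 (y a b : k) : W k := P2 y a + sc b (P2 y a)

/-- A family for the two-fold Pfister form. -/
def P2D (y a : k) := dbl a (P1D y)

/-- A family for the three-fold Pfister form. -/
def P3D (y a b : k) := dbl b (P2D y a)

lemma cl_P2D {y a : k} (ha : a ≠ 0) : cl (P2D y a) = P2 y a := by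
  rw [P2D, cl_dbl ha, cl_P1D, P2]

lemma cl_P3D {y a b : k} (ha : a ≠ 0) (hb : b ≠ 0) : cl (P3D y a b) = P3 y a b := by
  rw [P3D, cl_dbl hb, cl_P2D ha, P3]

lemma isRound_P2D {y a : k} (ha : a ≠ 0) : IsRound (P2D y a) := (isRound_P1D y).dbl ha

lemma isRound_P3D {y a b : k} (ha : a ≠ 0) (hb : b ≠ 0) : IsRound (P3D y a b) :=
  (isRound_P2D ha).dbl hb

lemma IsRound.cl_eq_zero {d : ι → k × k} (h : IsRound d) {v} (hv : v ≠ 0) (h0 : bq d v = 0) :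
    cl d = 0 := by
  rw [← h v hv, h0, sc_zero]

/-- Common values of two similar round forms give a common similarity factor. -/
lemma IsRound.common_value {d : ι → k × k} {e : κ → k × k} (hd : IsRound d) (he : IsRound e)
    {l1 l2 : k} (h1 : l1 ≠ 0) (h2 : l2 ≠ 0) {v u} (hne : v ≠ 0 ∨ u ≠ 0)
    (h : l1 * bq d v = l2 * bq e u) :
    ∃ l, l ≠ 0 ∧ sc l1 (cl d) + sc l2 (cl e) = sc l (cl d + cl e) := by
  by_cases hM : l1 * bq d v = 0
  · have hv0 : bq d v = 0 := (mul_eq_zero.1 hM).resolve_left h1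
    have hu0 : bq e u = 0 := (mul_eq_zero.1 (h ▸ hM)).resolve_left h2
    rcases hne with hv | hu
    · exact ⟨l2, h2, by simp [hd.cl_eq_zero hv hv0]⟩
    · exact ⟨l1, h1, by simp [he.cl_eq_zero hu hu0]⟩
  · have hv : v ≠ 0 := by rintro rfl; simp at hM
    have hu : u ≠ 0 := by rintro rfl; simp [h] at hM
    refine ⟨l1 * bq d v, hM, ?_⟩
    rw [map_add]
    congr 1
    · rw [sc_mul, hd v hv]
    · rw [h, sc_mul, he u hu]

/-- `common_value` from a class of small length. -/
lemma IsRound.common_value_of_cl {μ : Type} [Fintype μ] {d : ι → k × k} {e : κ → k × k}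
    {f : μ → k × k}
    (hd : IsRound d) (he : IsRound e) {l1 l2 : k} (h1 : l1 ≠ 0) (h2 : l2 ≠ 0)
    (h : sc l1 (cl d) + sc l2 (cl e) = cl f)
    (hc : Fintype.card μ < Fintype.card ι + Fintype.card κ) :
    ∃ l, l ≠ 0 ∧ cl f = sc l (cl d + cl e) := by
  have h' : cl (Sum.elim (scD l1 d) (scD l2 e)) = cl f := by
    rw [cl_sum, ← sc_cl h1, ← sc_cl h2, h]
  obtain ⟨x, hx, hx0⟩ := exists_isotropic_of_cl_eq h' (by simpa using hc)
  rw [← h]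
  refine hd.common_value he h1 h2 (v := (scEquiv l1 h1).symm (sumSplit x).1)
    (u := (scEquiv l2 h2).symm (sumSplit x).2) ?_ ?_
  · by_contra hcon
    push Not at hcon
    rw [LinearEquiv.map_eq_zero_iff, LinearEquiv.map_eq_zero_iff] at hcon
    exact hx (sumSplit.injective (by rw [map_zero]; exact Prod.ext hcon.1 hcon.2))
  · rw [bq_sum] at hx0
    rw [← bq_scEquiv h1, ← bq_scEquiv h2, LinearEquiv.apply_symm_apply,
      LinearEquiv.apply_symm_apply]
    exact CharTwo.add_eq_zero.1 hx0

/-- Values of a form similar to a round form are similarity factors. -/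
lemma IsRound.of_value {d : ι → k × k} {e : κ → k × k} (hd : IsRound d) {c : k} (hc : c ≠ 0)
    (h : cl e = sc c (cl d)) (hcard : Fintype.card κ = Fintype.card ι) {v} (hv : bq e v ≠ 0) :
    cl e = sc (bq e v) (cl d) := by
  by_cases h0 : ∃ x, x ≠ 0 ∧ bq d x = 0
  · obtain ⟨x, hx, hx0⟩ := h0
    rw [h, hd.cl_eq_zero hx hx0, map_zero, map_zero]
  push Not at h0
  rw [sc_cl hc] at h
  obtain ⟨Φ, hΦ⟩ := exists_isometry_of_cl_eq h hcard (by
    intro y hy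
    by_contra hy0
    refine h0 ((scEquiv c hc).symm y) ?_ ?_
    · simpa using hy0
    · have := bq_scEquiv hc d ((scEquiv c hc).symm y)
      rw [LinearEquiv.apply_symm_apply, hy] at this
      exact (mul_eq_zero.1 this.symm).resolve_left hc)
  set u := (scEquiv c hc).symm (Φ v) with hu
  have h1 : bq e v = c * bq d u := by
    rw [← bq_scEquiv hc, hu, LinearEquiv.apply_symm_apply, hΦ]
  have hu0 : u ≠ 0 := by
    intro hu0
    rw [hu0, bq_zero, mul_zero] at h1
    exact hv h1
  rw [h1, sc_mul, hd u hu0, h, sc_cl hc]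

end Roundness

section Albert

variable {k : Type} [Field k] [CharP k 2]

/-- The value of `[1,z]` at `x`. -/
def nval (z : k) (x : Fin 2 → k) : k := x 0 ^ 2 + x 0 * x 1 + z * x 1 ^ 2

@[simp] lemma nval_zero (z : k) : nval z 0 = 0 := by simp [nval]

lemma sc_nval (z : k) {x : Fin 2 → k} (hx : x ≠ 0) : sc (nval z x) (nn z) = nn z := by
  apply sc_value
  by_contra hcon
  push Not at hcon
  apply hx
  funext j
  fin_cases j
  · exact hcon.1
  · exact hcon.2

lemma sc_nval' {z : k} {x : Fin 2 → k} (hx : nval z x ≠ 0) : sc (nval z x) (nn z) = nn z :=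
  sc_nval z (by rintro rfl; simp at hx)

lemma nn_eq_zero {z : k} {x : Fin 2 → k} (hx : x ≠ 0) (h : nval z x = 0) : nn z = 0 := by
  rw [← sc_nval z hx, h, sc_zero]

/-- A sum of two similar binary forms contains any nonzero value it represents. -/
lemma exists_diagonalize {a b p h : k} (ha : a ≠ 0) (hb : b ≠ 0) {x y : Fin 2 → k}
    (hl : a * nval p x + b * nval h y ≠ 0) :
    ∃ ν i j, ν ≠ 0 ∧ i + j = p + h ∧ sc a (nn p) + sc b (nn h) =
      sc (a * nval p x + b * nval h y) (nn i) + sc ν (nn j) := by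
  by_cases hx : nval p x = 0
  · rw [hx, mul_zero, zero_add] at hl ⊢
    have hy : nval h y ≠ 0 := (mul_ne_zero_iff.1 hl).2
    exact ⟨a, h, p, ha, add_comm _ _, by rw [sc_mul, sc_nval' hy, add_comm]⟩
  by_cases hy : nval h y = 0
  · rw [hy, mul_zero, add_zero] at hl ⊢
    exact ⟨b, p, h, hb, rfl, by rw [sc_mul, sc_nval' hx]⟩
  set a' := a * nval p x with ha'
  set b' := b * nval h y with hb'
  have ha0 : a' ≠ 0 := mul_ne_zero ha hx
  have hb0 : b' ≠ 0 := mul_ne_zero hb hy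
  have h1 : sc a (nn p) = w a' (p / a') := by rw [← sc_nn, ha', sc_mul, sc_nval' hx]
  have h2 : sc b (nn h) = w b' (h / b') := by rw [← sc_nn, hb', sc_mul, sc_nval' hy]
  refine ⟨b', (a' + b') * p / a', h + b' * p / a', hb0, ?_, ?_⟩
  · field_simp
    linear_combination b' * p * two_eq_zero' (k := k)
  · rw [h1, h2, w_chain _ _ _ _ 1, sc_nn, sc_nn]
    congr 2 <;> · field_simp

/-- The class of the Albert-type form `[1,p+h] ⊥ a[1,p] ⊥ b[1,h]`. -/
noncomputable def alb (a b p h : k) : W k := nn (p + h) + sc a (nn p) + sc b (nn h)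

/-- An isotropic Albert-type form is similar to a two-fold Pfister form. -/
lemma alb_isotropic {a b p h : k} (ha : a ≠ 0) (hb : b ≠ 0) {z x y : Fin 2 → k}
    (hne : z ≠ 0 ∨ x ≠ 0 ∨ y ≠ 0)
    (h0 : nval (p + h) z + (a * nval p x + b * nval h y) = 0) :
    ∃ κ i c, κ ≠ 0 ∧ c ≠ 0 ∧ alb a b p h = sc κ (P2 i c) := by
  have hl : nval (p + h) z = a * nval p x + b * nval h y := CharTwo.add_eq_zero.1 h0
  by_cases hn : a * nval p x + b * nval h y = 0
  · by_cases hz : z = 0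
    · have hxy : a * nval p x = b * nval h y := CharTwo.add_eq_zero.1 hn
      by_cases hx : nval p x = 0
      · have hy : nval h y = 0 := by
          rw [hx, mul_zero] at hxy
          exact (mul_eq_zero.1 hxy.symm).resolve_left hb
        rcases hne with h1 | h1 | h1
        · exact absurd hz h1
        · refine ⟨1, h, b, one_ne_zero, hb, ?_⟩
          simp [alb, P2, nn_add, nn_eq_zero h1 hx]
        · refine ⟨1, p, a, one_ne_zero, ha, ?_⟩
          simp [alb, P2, nn_add, nn_eq_zero h1 hy]
      · have hy : nval h y ≠ 0 := by
          intro hy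
          rw [hy, mul_zero] at hxy
          exact hx ((mul_eq_zero.1 hxy).resolve_left ha)
        refine ⟨1, p + h, a * nval p x, one_ne_zero, mul_ne_zero ha hx, ?_⟩
        have h1 : sc a (nn p) = sc (a * nval p x) (nn p) := by rw [sc_mul, sc_nval' hx]
        have h2 : sc b (nn h) = sc (a * nval p x) (nn h) := by rw [hxy, sc_mul, sc_nval' hy]
        rw [alb, P2, sc_one, h1, h2, nn_add, map_add, add_assoc]
    · have h1 := nn_eq_zero hz (hl.trans hn)
      have h2 : nn p = nn h := by rwa [nn_add, ← W.eq_iff_add] at h1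
      refine ⟨a, h, b / a, ha, div_ne_zero hb ha, ?_⟩
      rw [alb, h1, h2, P2, map_add, ← sc_mul, mul_div_cancel₀ _ ha, zero_add]
  · obtain ⟨ν, i, j, hν, hij, e⟩ := exists_diagonalize ha hb hn
    refine ⟨a * nval p x + b * nval h y, j, ν / (a * nval p x + b * nval h y), hn,
      div_ne_zero hν hn, ?_⟩
    rw [alb, add_assoc, e]
    set n := a * nval p x + b * nval h y
    have h1 : nn (p + h) = sc n (nn (i + j)) := by
      rw [hij, ← hl, sc_nval' (by rw [hl]; exact hn)]
    rw [h1, P2, map_add, ← sc_mul, mul_div_cancel₀ _ hn, nn_add, map_add]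
    have := W.add_self (sc n (nn i))
    grind

lemma sc_P3 (c y a b : k) : sc c (P3 y a b) =
    sc c (nn y) + sc (c * a) (nn y) + sc b (sc c (nn y) + sc (c * a) (nn y)) := by
  rw [P3, P2]
  simp only [map_add, sc_mul, sc_comm c b]

/-- If an Albert-type form is isotropic or represents `l`, then `⟨1,l⟩` times it is similar to a
three-fold Pfister form. -/
lemma alb_mul {a b p h l : k} (ha : a ≠ 0) (hb : b ≠ 0) (hl : l ≠ 0) {z x y : Fin 2 → k}
    (h0 : nval (p + h) z + (a * nval p x + b * nval h y) = l) :
    ∃ γ i c c', γ ≠ 0 ∧ c ≠ 0 ∧ c' ≠ 0 ∧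
      alb a b p h + sc l (alb a b p h) = sc γ (P3 i c c') := by
  by_cases hn : a * nval p x + b * nval h y = 0
  · rw [hn, add_zero] at h0
    have hz : sc l (nn (p + h)) = nn (p + h) := by
      rw [← h0]; exact sc_nval' (by rw [h0]; exact hl)
    refine ⟨a, p, b / a, l, ha, div_ne_zero hb ha, hl, ?_⟩
    rw [sc_P3, mul_div_cancel₀ _ ha, alb]
    simp only [map_add, hz, sc_comm l]
    rw [nn_add, map_add] at hz
    have e1 : nn h + sc l (nn h) = nn p + sc l (nn p) := by
      have := W.add_self (nn h)
      have := W.add_self (sc l (nn p))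
      grind
    have e2 := congrArg (sc b) e1
    rw [map_add, map_add] at e2
    have := W.add_self (nn (p + h))
    grind
  obtain ⟨ν, i, j, hν, hij, e⟩ := exists_diagonalize ha hb hn
  set n := a * nval p x + b * nval h y with hnd
  have halb : alb a b p h = nn (i + j) + sc n (nn i) + sc ν (nn j) := by
    rw [alb, add_assoc, e, hij, ← add_assoc]
  rw [halb]
  rw [← hij] at h0
  clear halb e
  by_cases hy : z 1 = 0
  · -- reduce to the case `l = n`
    have hlz : l = n + z 0 ^ 2 := by rw [← h0, nval, hy]; ring
    set i' := l * i / n with hi'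
    have hi2 : i' = i + z 0 ^ 2 * (i / n) := by rw [hi', hlz]; field_simp
    have h1 : nn (i + j) + sc n (nn i) = nn (i' + j) + sc l (nn i') := by
      rw [sc_nn, sc_nn, nn, nn, add_comm, w_chain _ _ _ _ (z 0), mul_one, ← hlz, add_comm]
      congr 2
      · rw [hi2]; ring
      · rw [hi']; field_simp
    refine ⟨1, j, ν, l, one_ne_zero, hν, hl, ?_⟩
    rw [h1, sc_one, P3, P2, nn_add]
    simp only [map_add, sc_sc hl]
    have := W.add_self (nn i')
    have := W.add_self (sc l (nn i'))
    grind
  · set D := (l + n) / z 1 ^ 2 with hD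
    have hlD : nn (i + j) = w 1 D := by
      rw [nn, w_shift 1 (i + j) (z 0 / z 1)]
      congr 1
      rw [hD, ← h0, nval]
      field_simp
      linear_combination (-n) * two_eq_zero' (k := k)
    set i'' := i + n / z 1 ^ 2 with hi
    have h1 : nn (i + j) + sc n (nn i) = nn (l / z 1 ^ 2) + sc n (nn i'') := by
      rw [hlD, sc_nn, sc_nn, w_swap 1 D, w_chain _ _ _ _ (z 1)⁻¹, nn, w_swap 1]
      congr 2
      · rw [hD]; field_simp; linear_combination n * two_eq_zero' (k := k)
      · rw [hi]; field_simp
    have h2 : sc l (nn (l / z 1 ^ 2)) = nn (l / z 1 ^ 2) := by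
      rw [nn, sc_w hl, mul_one, w_swap, show l / z 1 ^ 2 = (z 1)⁻¹ ^ 2 * l by field_simp,
        ← w_sq, show ((z 1)⁻¹ ^ 2 * l / l) = (z 1)⁻¹ ^ 2 * 1 by field_simp, w_swap]
    have h3 : nn (l / z 1 ^ 2) = nn i'' + nn j := by
      have e1 : l / z 1 ^ 2 = D + n / z 1 ^ 2 := by
        rw [hD]; field_simp; linear_combination (-n) * two_eq_zero' (k := k)
      rw [e1, nn_add, hi, nn_add]
      change w 1 D + _ = _
      rw [← hlD, nn_add]
      abel
    refine ⟨n, j, ν / n, l, hn, div_ne_zero hν hn, hl, ?_⟩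
    rw [sc_P3, mul_div_cancel₀ _ hn, h1]
    have h4 : nn i'' + sc l (nn i'') = nn j + sc l (nn j) := by
      have h5 := h2
      rw [h3, map_add] at h5
      have := W.add_self (nn j)
      have := W.add_self (sc l (nn i''))
      grind
    have h6 := congrArg (sc n) h4
    simp only [map_add, h2, sc_comm l] at h6 ⊢
    have := W.add_self (nn (l / z 1 ^ 2))
    grind

end Albert

section Inseparable

/-- `L` is obtained from `k` by adjoining a square root of the nonsquare `d`. -/
structure Insep {k L : Type} [Field k] [Field L] (f : k →+* L) (d : k) : Prop where
  root : ∃ s, s ^ 2 = f d ∧ ∀ z, ∃ x y, z = f x + s * f y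
  nonsq : ∀ x, x ^ 2 ≠ d

lemma exists_insep {k : Type} [Field k] [CharP k 2] {d : k} (hd : ∀ x, x ^ 2 ≠ d) :
    ∃ (L : Type) (_ : Field L) (_ : CharP L 2) (f : k →+* L), Insep f d := by
  have hirr : Irreducible (Polynomial.X ^ 2 - Polynomial.C d) :=
    X_pow_sub_C_irreducible_of_prime Nat.prime_two hd
  have : Fact (Irreducible (Polynomial.X ^ 2 - Polynomial.C d)) := ⟨hirr⟩
  let p := Polynomial.X ^ 2 - Polynomial.C d
  have hp : p.Monic := Polynomial.monic_X_pow_sub_C d two_ne_zero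
  refine ⟨AdjoinRoot p, inferInstance, charP_of_injective_algebraMap
    (algebraMap k (AdjoinRoot p)).injective 2, AdjoinRoot.of p, ⟨AdjoinRoot.root p, ?_, ?_⟩, hd⟩
  · have h0 : (AdjoinRoot.mk p) (Polynomial.X ^ 2 - Polynomial.C d) = 0 := AdjoinRoot.mk_self
    rwa [map_sub, map_pow, sub_eq_zero] at h0
  · intro z
    obtain ⟨q, rfl⟩ := AdjoinRoot.mk_surjective z
    have h1 := Polynomial.modByMonic_add_div q p
    have h2 : (q %ₘ p).degree < 2 := by
      refine (Polynomial.degree_modByMonic_lt q hp).trans_eq ?_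
      exact Polynomial.degree_X_pow_sub_C two_pos d
    have h3 := Polynomial.eq_X_add_C_of_degree_le_one
      (show (q %ₘ p).degree ≤ 1 from Order.le_of_lt_succ h2)
    refine ⟨(q %ₘ p).coeff 0, (q %ₘ p).coeff 1, ?_⟩
    conv_lhs => rw [← h1]
    rw [map_add, map_mul, AdjoinRoot.mk_self, zero_mul, add_zero]
    conv_lhs => rw [h3]
    rw [map_add, map_mul, AdjoinRoot.mk_X, AdjoinRoot.mk_C, AdjoinRoot.mk_C]
    ring

variable {k L : Type} [Field k] [CharP k 2] [Field L] [CharP L 2] {f : k →+* L} {d : k}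

lemma Insep.ne_zero (h : Insep f d) : d ≠ 0 := fun h0 => h.nonsq 0 (by simp [h0])

lemma Insep.exists_sq (h : Insep f d) (z : L) : ∃ x, z ^ 2 = f x := by
  obtain ⟨s, hs, hz⟩ := h.root
  obtain ⟨x, y, rfl⟩ := hz z
  refine ⟨x ^ 2 + d * y ^ 2, ?_⟩
  rw [CharTwo.add_sq, mul_pow, hs]
  simp

lemma Insep.sc_eq (h : Insep f d) (x : W L) : sc (f d) x = x := by
  obtain ⟨s, hs, -⟩ := h.root
  rw [← hs, sc_sq]
  rintro rfl
  exact h.ne_zero ((map_eq_zero f).1 (by rw [← hs]; simp))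

lemma W.map_nn (f : k →+* L) (y : k) : W.map f (nn y) = nn (f y) := by simp [nn]

lemma W.map_P2 (f : k →+* L) (y a : k) : W.map f (P2 y a) = P2 (f y) (f a) := by
  simp [P2, W.map_nn, W.map_sc]

lemma Insep.map_P2 (h : Insep f d) (y : k) : W.map f (P2 y d) = 0 := by
  rw [W.map_P2, P2, h.sc_eq, W.add_self]

lemma Insep.nn_descend (h : Insep f d) (y : L) : ∃ x, nn y = nn (f x) := by
  obtain ⟨x, hx⟩ := h.exists_sq y
  exact ⟨x, by rw [← hx, nn_sq]⟩

variable {ι : Type} [Fintype ι]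

/-- Isotropic vectors over an inseparable quadratic extension. -/
lemma Insep.isotropic_iff (h : Insep f d) (c : ι → k × k) :
    (∃ v, v ≠ 0 ∧ bq (mapD f c) v = 0) →
      ∃ v1 v2, (v1 ≠ 0 ∨ v2 ≠ 0) ∧ bq c v1 = d * bq c v2 ∧ bb v1 v2 = 0 := by
  rintro ⟨v, hv, h0⟩
  obtain ⟨s, hs, hz⟩ := h.root
  choose v1 v2 hv12 using fun i j => hz (v i j)
  have e : v = (fun i j => f (v1 i j)) + s • (fun i j => f (v2 i j)) := by
    funext i j; simpa using hv12 i j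
  have hne : v1 ≠ 0 ∨ v2 ≠ 0 := by
    by_contra hcon
    push Not at hcon
    apply hv
    rw [e, hcon.1, hcon.2]
    funext i j
    simp
  rw [e, bq_add, bq_smul, bb_smul_right, bq_map, bq_map, bb_map, hs, ← map_mul, ← map_add] at h0
  have h1 : bb v1 v2 = 0 := by
    by_contra hb
    have hfb : f (bb v1 v2) ≠ 0 := (map_ne_zero f).2 hb
    apply h.nonsq ((bq c v1 + d * bq c v2) / bb v1 v2)
    apply f.injective
    rw [← hs, map_pow, map_div₀, div_pow, div_eq_iff (pow_ne_zero 2 hfb)]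
    rw [CharTwo.add_eq_zero.1 h0, mul_pow]
  rw [h1, map_zero, mul_zero, add_zero, map_eq_zero] at h0
  exact ⟨v1, v2, hne, CharTwo.add_eq_zero.1 h0, h1⟩

/-- The shape of a form that becomes isotropic over an inseparable quadratic extension. -/
lemma Insep.isotropic_shape (h : Insep f d) (c : ι → k × k)
    (hv : ∃ v, v ≠ 0 ∧ bq (mapD f c) v = 0) :
    (∃ (r : ℕ) (l : Fin r → k × k), r + 1 = Fintype.card ι ∧ cl c = cl l) ∨
    ∃ (μ y z : k) (r : ℕ) (l : Fin r → k × k), μ ≠ 0 ∧ r + 2 = Fintype.card ι ∧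
      cl c = sc μ (P2 y d) + w μ z + cl l := by
  obtain ⟨v1, v2, hne, hq, hb⟩ := h.isotropic_iff c hv
  by_cases hμ : bq c v2 = 0
  · left
    rw [hμ, mul_zero] at hq
    obtain ⟨v, hv, hv0⟩ : ∃ v, v ≠ 0 ∧ bq c v = 0 := by
      rcases hne with h1 | h1
      exacts [⟨_, h1, hq⟩, ⟨_, h1, hμ⟩]
    obtain ⟨c', r, l, e, hr, -, -, -, hcl⟩ := exists_extract c hv
    exact ⟨r, l, hr, by rw [hcl, hv0, w_zero_left, zero_add]⟩
  · right
    set μ := bq c v2 with hμd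
    obtain ⟨c', r, l, e, hr, -, he1, he2, hcl⟩ := exists_extract c (v := v2) (by
      rintro rfl; simp [hμd] at hμ)
    have h1 := he2 v1
    rw [he1, bb_comm, hb, hq] at h1
    set x := (e v1).1 0
    have hw : (e v1).2 ≠ 0 := by
      intro h0
      rw [h0, bq_zero] at h1
      apply h.nonsq x
      apply mul_right_cancel₀ hμ
      rw [h1]
      ring
    obtain ⟨c'', r', l', e', hr', -, -, -, hcl'⟩ := exists_extract l hw
    refine ⟨μ, μ * d * c'', c' + x ^ 2 * c'' + d * c'', r', l', hμ, ?_, ?_⟩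
    · rw [← hr, ← Fintype.card_fin r, ← hr']
    · have h2 : bq l (e v1).2 = μ * d + x ^ 2 * μ := by
        linear_combination (-1) * h1 - μ * x ^ 2 * two_eq_zero' (k := k)
      have hd := h.ne_zero
      have h3 : w μ c' + w (μ * d + x ^ 2 * μ) c'' = w (μ * d) c'' + w μ (c' + x ^ 2 * c'') := by
        rw [w_chain (μ * d) c'' μ _ x, add_comm]
        congr 2
        linear_combination (-x ^ 2 * c'') * two_eq_zero' (k := k)
      rw [hcl, hcl', ← hμd, h2, P2, map_add, sc_nn, ← sc_mul, sc_nn, ← add_assoc, h3,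
        mul_div_cancel_left₀ _ (mul_ne_zero hμ hd),
        show μ * d * c'' / μ = d * c'' by field_simp]
      have h4 : w μ (c' + x ^ 2 * c'' + d * c'') = w μ (c' + x ^ 2 * c'') + w μ (d * c'') := by
        rw [w_add_right]
      rw [h4]
      have := W.add_self (w μ (d * c''))
      grind

/-- One summand similar to a two-fold Pfister form with slot `d` splits off. -/
lemma Insep.split (h : Insep f d) (c : ι → k × k) (hc : Fintype.card ι ≠ 0)
    (h0 : W.map f (cl c) = 0) :
    ∃ (μ y : k) (r : ℕ) (l : Fin r → k × k), μ ≠ 0 ∧ r + 1 = Fintype.card ι ∧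
      cl c = sc μ (P2 y d) + cl l ∧ W.map f (cl l) = 0 ∧
      (Fintype.card ι = 1 → cl c = 0) := by
  have hiso : ∃ v, v ≠ 0 ∧ bq (mapD f c) v = 0 := by
    rw [W.map_cl] at h0
    obtain ⟨x, -, hx⟩ := exists_isotropic_of_cl_eq_zero h0 ⊤ (by
      rw [finrank_top, finrank_block]; omega)
    exact ⟨x, hx⟩
  rcases h.isotropic_shape c hiso with ⟨r, l, hr, hl⟩ | ⟨μ, y, z, r, l, hμ, hr, hl⟩
  · refine ⟨1, 0, r, l, one_ne_zero, hr, by simp [P2, hl], by rw [← hl, h0], fun h1 => ?_⟩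
    obtain rfl : r = 0 := by omega
    rw [hl]; simp [cl]
  · refine ⟨μ, y, r + 1, Fin.cons (μ, z) l, hμ, by omega, ?_, ?_, by omega⟩
    · rw [hl, add_assoc]
      simp [cl, Fin.sum_univ_succ]
    · have h1 : cl (Fin.cons (μ, z) l : Fin (r + 1) → k × k) = cl c + sc μ (P2 y d) := by
        rw [hl]
        simp [cl, Fin.sum_univ_succ]
        have := W.add_self (sc μ (P2 y d))
        grind
      rw [h1, map_add, h0, W.map_sc, h.map_P2]
      simp

/-- A form with three planes that dies in `k(√d)` is similar to a Pfister form with slot `d`. -/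
lemma Insep.three (h : Insep f d) (c : Fin 3 → k × k) (h0 : W.map f (cl c) = 0) :
    ∃ μ y, μ ≠ 0 ∧ cl c = sc μ (P2 y d) := by
  obtain ⟨μ1, y1, r1, l1, hμ1, hr1, e1, z1, -⟩ := h.split c (by simp) h0
  obtain rfl : r1 = 2 := by simp at hr1; omega
  obtain ⟨μ2, y2, r2, l2, hμ2, hr2, e2, z2, -⟩ := h.split l1 (by simp) z1
  obtain rfl : r2 = 1 := by simp at hr2; omega
  obtain ⟨-, -, -, -, -, -, -, -, z3⟩ := h.split l2 (by simp) z2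
  rw [e2, z3 (by simp), add_zero, ← cl_P2D h.ne_zero, ← cl_P2D h.ne_zero] at e1
  obtain ⟨l, hl, e⟩ := (isRound_P2D h.ne_zero).common_value_of_cl (isRound_P2D h.ne_zero)
    hμ1 hμ2 e1.symm (by simp)
  refine ⟨l, y1 + y2, hl, ?_⟩
  rw [e, cl_P2D h.ne_zero, cl_P2D h.ne_zero, P2, P2, P2, nn_add, map_add (sc d)]
  congr 1
  abel

lemma exists_fin_three (x y z x' y' z' : k) :
    ∃ c : Fin 3 → k × k, cl c = w x x' + w y y' + w z z' :=
  ⟨![(x, x'), (y, y'), (z, z')], by simp [cl, Fin.sum_univ_succ, add_assoc]⟩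

variable {E : Type} [Field E] [CharP E 2] {g : L →+* E} {a b : k}

/-- A form with three planes that dies in `k(√a,√b)`. -/
lemma Insep.biquadratic (h : Insep f a) (h' : Insep g (f b)) (c : Fin 3 → k × k)
    (h0 : W.map g (W.map f (cl c)) = 0) :
    ∃ l p q, l ≠ 0 ∧ cl c = sc l (P2 p a + P2 q b) := by
  have ha := h.ne_zero
  have hb : b ≠ 0 := fun hb => h'.ne_zero (by simp [hb])
  obtain ⟨l1, y1, hl1, e1⟩ := h'.three (mapD f c) (by rwa [← W.map_cl])
  obtain ⟨q, hq⟩ := h.nn_descend y1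
  rw [P2, hq] at e1
  change _ = sc l1 (P2 (f q) (f b)) at e1
  rw [← W.map_cl] at e1
  -- split off a summand over `k`
  obtain ⟨μ, y, z, p, r, hμ, hs⟩ : ∃ μ y z p r : k, μ ≠ 0 ∧
      cl c = sc μ (P2 y a) + (w μ z + w p r) := by
    have hiso : ∃ v, v ≠ 0 ∧ bq (mapD f c) v = 0 := by
      refine exists_isotropic_of_cl_eq (e := scD l1 (P2D (f q) (f b))) ?_ (by simp)
      rw [← W.map_cl, e1, ← sc_cl hl1, cl_P2D h'.ne_zero]
    rcases h.isotropic_shape c hiso with ⟨s, l, hs, hl⟩ | ⟨μ, y, z, s, l, hμ, hs, hl⟩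
    · obtain rfl : s = 2 := by simp at hs; omega
      have hl2 : cl c = w (l 0).1 (l 0).2 + w (l 1).1 (l 1).2 := by
        rw [hl, cl, Fin.sum_univ_two]
      by_cases hz : (l 0).1 = 0
      · exact ⟨1, 0, 0, (l 1).1, (l 1).2, one_ne_zero, by rw [hl2, hz]; simp [P2]⟩
      · exact ⟨(l 0).1, 0, (l 0).2, (l 1).1, (l 1).2, hz, by rw [hl2]; simp [P2]⟩
    · obtain rfl : s = 1 := by simp at hs; omega
      exact ⟨μ, y, z, (l 0).1, (l 0).2, hμ, by rw [hl, add_assoc]; simp [cl]⟩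
  -- the complement, normalised to represent one
  let t : Fin 2 → k × k := ![(1, μ * z), (p / μ, μ * r)]
  have ht : cl t = w 1 (μ * z) + w (p / μ) (μ * r) := by simp [cl, t]
  have hsμ : w μ z + w p r = sc μ (cl t) := by
    rw [ht, map_add, sc_w hμ, sc_w hμ]
    congr 2 <;> field_simp
  have htv : ∀ (K : Type) [Field K] [CharP K 2] (i : k →+* K),
      ∃ v, bq (mapD i t) v = 1 := fun K _ _ i =>
    ⟨Pi.single 0 ![1, 0], by rw [bq_single]; simp [mapD, t]⟩
  have htL : W.map f (cl t) = P2 (f q) (f b) := by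
    obtain ⟨v, hv⟩ := htv L f
    have e2 : cl (mapD f t) = sc (f μ * l1) (cl (P2D (f q) (f b))) := by
      rw [cl_P2D h'.ne_zero, sc_mul, ← e1, hs, hsμ, ← W.map_cl, map_add, W.map_sc, W.map_sc,
        h.map_P2, map_zero, zero_add, sc_sc ((map_ne_zero f).2 hμ)]
    have := (isRound_P2D h'.ne_zero).of_value (mul_ne_zero ((map_ne_zero f).2 hμ) hl1) e2 (by simp)
      (v := v) (by rw [hv]; exact one_ne_zero)
    rw [hv, sc_one, cl_P2D h'.ne_zero] at this
    rw [W.map_cl, this]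
  obtain ⟨κ, u, hκ, hu⟩ : ∃ κ u, κ ≠ 0 ∧ cl t + P2 q b = sc κ (P2 u a) := by
    obtain ⟨c3, hc3⟩ := exists_fin_three 1 (p / μ) b (μ * z + q) (μ * r) (q / b)
    have e3 : cl c3 = cl t + P2 q b := by
      rw [hc3, ht, P2, sc_nn, w_add_right, nn]
      abel
    rw [← e3]
    apply h.three
    rw [e3, map_add, htL, W.map_P2, W.add_self]
  -- the complement is a Pfister form
  obtain ⟨i, cc, hcc, hP⟩ : ∃ i cc, cc ≠ 0 ∧ cl t = P2 i cc := by
    have e3 : sc 1 (cl (P2D q b)) + sc κ (cl (P2D u a)) = cl t := by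
      rw [cl_P2D ha, cl_P2D hb, sc_one, ← hu]
      have := W.add_self (P2 q b)
      grind
    obtain ⟨κ', hκ', e4⟩ := (isRound_P2D hb).common_value_of_cl (isRound_P2D ha) one_ne_zero hκ e3
      (by simp)
    have e5 : cl t = sc κ' (alb a b u q) := by
      rw [e4, cl_P2D ha, cl_P2D hb, alb, P2, P2, nn_add]
      congr 1
      abel
    obtain ⟨κ2, i, cc, hκ2, hcc, e6⟩ : ∃ κ2 i cc, κ2 ≠ 0 ∧ cc ≠ 0 ∧
        alb a b u q = sc κ2 (P2 i cc) := by
      let A : Fin 3 → k × k := ![(1, u + q), (a, u / a), (b, q / b)]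
      have hA : cl A = alb a b u q := by
        rw [alb, sc_nn, sc_nn]; simp [cl, A, Fin.sum_univ_succ, nn, add_assoc]
      obtain ⟨v, hv, hv0⟩ := exists_isotropic_of_cl_eq (d := A) (e := scD κ' t)
        (by rw [hA, ← sc_cl hκ', e5, sc_sc hκ']) (by simp)
      refine alb_isotropic ha hb (z := v 0) (x := ![v 1 0, v 1 1 / a])
        (y := ![v 2 0, v 2 1 / b]) ?_ ?_
      · by_contra hcon
        push Not at hcon
        obtain ⟨h1, h2, h3⟩ := hcon
        apply hv
        have h20 := congrFun h2 0
        have h21 := congrFun h2 1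
        have h30 := congrFun h3 0
        have h31 := congrFun h3 1
        simp [ha, hb] at h20 h21 h30 h31
        funext i' j'
        fin_cases i' <;> fin_cases j' <;> simp [*]
      · rw [← hv0]
        simp [bq, A, Fin.sum_univ_succ, nval]
        field_simp
    refine ⟨i, cc, hcc, ?_⟩
    have e7 : cl t = sc (κ' * κ2) (cl (P2D i cc)) := by rw [e5, e6, sc_mul, cl_P2D hcc]
    have hv : bq t (Pi.single 0 ![1, 0]) = 1 := by rw [bq_single]; simp [t]
    have := (isRound_P2D hcc).of_value (mul_ne_zero hκ' hκ2) e7 (by simp)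
      (by rw [hv]; exact one_ne_zero)
    rwa [hv, sc_one, cl_P2D hcc] at this
  obtain ⟨c', hc', e8⟩ : ∃ c', c' ≠ 0 ∧ cl t = P2 u a + sc c' (P2 q b) := by
    have e3 : sc 1 (cl (P2D i cc)) + sc κ (cl (P2D u a)) = cl (P2D q b) := by
      rw [cl_P2D ha, cl_P2D hb, cl_P2D hcc, sc_one, ← hu, hP]
      have := W.add_self (P2 i cc)
      grind
    obtain ⟨κ', hκ', e4⟩ := (isRound_P2D hcc).common_value_of_cl (isRound_P2D ha) one_ne_zero hκ e3
      (by simp)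
    refine ⟨κ', hκ', ?_⟩
    rw [cl_P2D ha, cl_P2D hb, cl_P2D hcc] at e4
    rw [e4, sc_sc hκ', hP]
    have := W.add_self (P2 u a)
    grind
  have e9 : sc μ (cl (P2D (y + u) a)) + sc (μ * c') (cl (P2D q b)) = cl c := by
    rw [cl_P2D ha, cl_P2D hb, sc_mul, ← map_add, hs, hsμ, e8, ← map_add]
    congr 1
    simp only [P2, nn_add, map_add]
    abel
  obtain ⟨l, hl, e⟩ := (isRound_P2D ha).common_value_of_cl (isRound_P2D hb) hμ
    (mul_ne_zero hμ hc') e9 (by simp)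
  exact ⟨l, y + u, q, hl, by rw [e, cl_P2D ha, cl_P2D hb]⟩

end Inseparable

section Completion

variable {k : Type} [Field k] [CharP k 2]

lemma exists_alb_family {a b : k} (ha : a ≠ 0) (hb : b ≠ 0) (g h : k) :
    cl (![(1, g + h), (a, g / a), (b, h / b)] : Fin 3 → k × k) = alb a b g h ∧
    ∀ v, bq (![(1, g + h), (a, g / a), (b, h / b)] : Fin 3 → k × k) v =
      nval (g + h) (v 0) + (a * nval g ![v 1 0, v 1 1 / a] + b * nval h ![v 2 0, v 2 1 / b]) := by
  refine ⟨?_, fun v => ?_⟩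
  · rw [alb, sc_nn, sc_nn]; simp [cl, Fin.sum_univ_succ, nn, add_assoc]
  · simp [bq, Fin.sum_univ_succ, nval]
    field_simp

/-- A form similar to an Albert-type form that represents one completes to a multiple of a
three-fold Pfister form. -/
lemma add_alb_eq {a b g h l : k} (ha : a ≠ 0) (hb : b ≠ 0) (hl : l ≠ 0) (c : Fin 3 → k × k)
    (hc : cl c = sc l (alb a b g h)) {v} (hv : bq c v = 1) :
    ∃ γ i s s', γ ≠ 0 ∧ s ≠ 0 ∧ s' ≠ 0 ∧ cl c + alb a b g h = sc γ (P3 i s s') := by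
  obtain ⟨hA, hB⟩ := exists_alb_family ha hb g h
  rw [hc, add_comm]
  by_cases hani : ∀ y, bq (![(1, g + h), (a, g / a), (b, h / b)] : Fin 3 → k × k) y = 0 → y = 0
  · obtain ⟨Φ, hΦ⟩ := exists_isometry_of_cl_eq (d := scD l c)
      (e := (![(1, g + h), (a, g / a), (b, h / b)] : Fin 3 → k × k))
      (by rw [hA, ← sc_cl hl, hc, sc_sc hl]) rfl hani
    refine alb_mul ha hb hl (z := Φ (scEquiv l hl v) 0) ((hB _).symm.trans ?_)
    rw [hΦ, bq_scEquiv, hv, mul_one]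
  · push Not at hani
    obtain ⟨y, hy, hy0⟩ := hani
    rw [hB] at hy
    obtain ⟨κ, i, s, hκ, hs, e⟩ := alb_isotropic ha hb (by
      by_contra hcon
      push Not at hcon
      obtain ⟨h1, h2, h3⟩ := hcon
      apply hy0
      have h20 := congrFun h2 0
      have h21 := congrFun h2 1
      have h30 := congrFun h3 0
      have h31 := congrFun h3 1
      simp [ha, hb] at h20 h21 h30 h31
      funext i' j'
      fin_cases i' <;> fin_cases j' <;> simp [*]) hy
    exact ⟨κ, i, s, l, hκ, hs, hl, by rw [e, P3, map_add, sc_comm]⟩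

variable {L E : Type} [Field L] [CharP L 2] [Field E] [CharP E 2] {f : k →+* L} {g : L →+* E}
  {a b : k}

/-- If `[p,q] ⊥ [r,t] ⊥ [1,δ]` dies in `k(√a,√b)` then some completion is a multiple of a
three-fold Pfister form. -/
lemma Insep.exists_completion (h : Insep f a) (h' : Insep g (f b)) (p q r t δ : k)
    (h0 : W.map g (W.map f (w p q + w r t + w 1 δ)) = 0) :
    ∃ γ i s s' d1 d2 d3, γ ≠ 0 ∧ s ≠ 0 ∧ s' ≠ 0 ∧
      w p q + w r t + w 1 d1 + w a d2 + w b d3 = sc γ (P3 i s s') := by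
  have hc : cl (![(p, q), (r, t), (1, δ)] : Fin 3 → k × k) = w p q + w r t + w 1 δ := by
    simp [cl, Fin.sum_univ_succ, add_assoc]
  have hb : b ≠ 0 := fun hb => h'.ne_zero (by simp [hb])
  rw [← hc] at h0
  obtain ⟨l, x, y, hl, e⟩ := h.biquadratic h' _ h0
  have e1 : P2 x a + P2 y b = alb a b x y := by rw [alb, P2, P2, nn_add]; abel
  rw [e1] at e
  have hv : bq (![(p, q), (r, t), (1, δ)] : Fin 3 → k × k) (Pi.single 2 ![1, 0]) = 1 := by
    rw [bq_single]; simp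
  obtain ⟨γ, i, s, s', hγ, hs, hs', e2⟩ := add_alb_eq h.ne_zero hb hl _ e hv
  refine ⟨γ, i, s, s', δ + (x + y), x / a, y / b, hγ, hs, hs', ?_⟩
  rw [← e2, hc, alb, w_add_right, sc_nn, sc_nn, nn]
  abel

/-- The value of `[p,q] ⊥ ⟨1,a,b⟩`. -/
def mval (p q a b : k) (z : (Fin 2 → k) × (Fin 3 → k)) : k :=
  p * z.1 0 ^ 2 + z.1 0 * z.1 1 + q * z.1 1 ^ 2 + (z.2 0 ^ 2 + a * z.2 1 ^ 2 + b * z.2 2 ^ 2)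

/-- The inclusion of `[p,q] ⊥ ⟨1,a,b⟩` into a nonsingular completion. -/
def mincl (k : Type) [Field k] :
    ((Fin 2 → k) × (Fin 3 → k)) →ₗ[k] (Fin 4 → Fin 2 → k) where
  toFun z := ![z.1, ![z.2 0, 0], ![z.2 1, 0], ![z.2 2, 0]]
  map_add' x y := by
    funext i j; fin_cases i <;> fin_cases j <;> simp
  map_smul' c x := by
    funext i j; fin_cases i <;> fin_cases j <;> simp

lemma mincl_injective : Function.Injective (mincl k) := by
  rw [injective_iff_map_eq_zero]
  intro z hz
  have h0 := congrFun hz 0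
  have h1 := congrFun (congrFun hz 1) 0
  have h2 := congrFun (congrFun hz 2) 0
  have h3 := congrFun (congrFun hz 3) 0
  simp [mincl] at h0 h1 h2 h3
  refine Prod.ext h0 ?_
  funext j
  fin_cases j <;> simp [h1, h2, h3]

lemma bq_mincl (p q a b d1 d2 d3 : k) (z) :
    bq ![(p, q), (1, d1), (a, d2), (b, d3)] (mincl k z) = mval p q a b z := by
  simp [bq, mincl, Fin.sum_univ_succ, mval]
  ring

/-- If a nonsingular completion is a multiple of a Pfister form then `[p,q] ⊥ ⟨1,a,b⟩` is a
Pfister neighbour. -/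
lemma exists_map_of_completion {p q a b γ i s s' d1 d2 d3 : k} (hγ : γ ≠ 0) (hs : s ≠ 0)
    (hs' : s' ≠ 0) (hani : ∀ z, mval p q a b z = 0 → z = 0)
    (h : w p q + w 1 d1 + w a d2 + w b d3 = sc γ (P3 i s s')) :
    ∃ Φ : ((Fin 2 → k) × (Fin 3 → k)) →ₗ[k] ((Unit ⊕ Unit) ⊕ (Unit ⊕ Unit) → Fin 2 → k),
      ∀ z, bq (scD γ (P3D i s s')) (Φ z) = mval p q a b z := by
  set d : Fin 4 → k × k := ![(p, q), (1, d1), (a, d2), (b, d3)] with hd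
  have hcl : cl d = cl (scD γ (P3D i s s')) := by
    rw [← sc_cl hγ, cl_P3D hs hs', ← h]
    simp [cl, d, Fin.sum_univ_succ, add_assoc]
  by_cases he : ∀ y, bq (scD γ (P3D i s s')) y = 0 → y = 0
  · obtain ⟨Φ, hΦ⟩ := exists_isometry_of_cl_eq hcl (by simp) he
    exact ⟨Φ ∘ₗ mincl k, fun z => by rw [LinearMap.comp_apply, hΦ, bq_mincl]⟩
  · exfalso
    push Not at he
    obtain ⟨y, hy, hy0⟩ := he
    have h1 : cl (P3D i s s') = 0 := by
      obtain ⟨y', rfl⟩ := (scEquiv γ hγ).surjective y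
      rw [bq_scEquiv] at hy
      exact (isRound_P3D hs hs').cl_eq_zero (v := y') (by rintro rfl; simp at hy0)
        ((mul_eq_zero.1 hy).resolve_left hγ)
    rw [← sc_cl hγ, h1, map_zero] at hcl
    obtain ⟨x, hx, hx0, hx1⟩ := exists_isotropic_of_cl_eq_zero hcl (LinearMap.range (mincl k)) (by
      rw [LinearMap.finrank_range_of_inj mincl_injective]
      simp)
    obtain ⟨z, rfl⟩ := hx
    rw [bq_mincl] at hx1
    exact hx0 (by rw [hani z hx1, map_zero])

end Completion

section PolynomialValues

variable {R : Type} [CommRing R] {ι J : Type} [Fintype ι]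

/-- The block form is anisotropic. -/
def BAniso (d : ι → R × R) : Prop := ∀ v, bq d v = 0 → v = 0

lemma BAniso.of_injective {S : Type} [CommRing S] {f : R →+* S} (hf : Function.Injective f)
    {d : ι → R × R} (h : BAniso (mapD f d)) : BAniso d := by
  intro v hv
  have h1 := h (fun i j => f (v i j)) (by rw [bq_map, hv, map_zero])
  funext i j
  exact hf (by simpa using congrFun (congrFun h1 i) j)

lemma mapD_mapD {S T : Type} [CommRing S] [CommRing T] (f : R →+* S) (g : S →+* T)
    (d : ι → R × R) : mapD g (mapD f d) = mapD (g.comp f) d := rfl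

open Polynomial in
lemma coeff_bq (d : ι → R × R) (p : ι → Fin 2 → R[X]) {n : ℕ}
    (hp : ∀ i j, (p i j).natDegree ≤ n) :
    (bq (mapD Polynomial.C d) p).coeff (2 * n) = bq d (fun i j => (p i j).coeff n) := by
  simp only [bq, mapD, finsetSum_coeff, Polynomial.coeff_add, Polynomial.coeff_C_mul]
  refine Finset.sum_congr rfl fun i _ => ?_
  rw [show 2 * n = n + n from two_mul n, pow_two (p i 0), pow_two (p i 1),
    Polynomial.coeff_mul_add_eq_of_natDegree_le (hp i 0) (hp i 0),
    Polynomial.coeff_mul_add_eq_of_natDegree_le (hp i 1) (hp i 1),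
    Polynomial.coeff_mul_add_eq_of_natDegree_le (hp i 0) (hp i 1),
    ← pow_two, ← pow_two]

open Polynomial in
lemma natDegree_bq_le (d : ι → R × R) (p : ι → Fin 2 → R[X]) {n : ℕ}
    (hp : ∀ i j, (p i j).natDegree ≤ n) : (bq (mapD Polynomial.C d) p).natDegree ≤ 2 * n := by
  refine natDegree_sum_le_of_forall_le _ _ fun i _ => ?_
  refine natDegree_add_le_of_degree_le (natDegree_add_le_of_degree_le ?_ ?_) ?_
  · exact (natDegree_C_mul_le _ _).trans (natDegree_pow_le_of_le 2 (hp i 0))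
  · exact (natDegree_mul_le_of_le (hp i 0) (hp i 1)).trans (by omega)
  · exact (natDegree_C_mul_le _ _).trans (natDegree_pow_le_of_le 2 (hp i 1))

open Polynomial in
lemma coeff_bb (e : ι → Fin 2 → R) (p : ι → Fin 2 → R[X]) (n : ℕ) :
    (bb (fun i j => Polynomial.C (e i j)) p).coeff n = bb e (fun i j => (p i j).coeff n) := by
  simp [bb]

open Polynomial in
lemma natDegree_bb_le (e : ι → Fin 2 → R) (p : ι → Fin 2 → R[X]) {n : ℕ}
    (hp : ∀ i j, (p i j).natDegree ≤ n) :
    (bb (fun i j => Polynomial.C (e i j)) p).natDegree ≤ n := by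
  refine natDegree_sum_le_of_forall_le _ _ fun i _ => ?_
  exact natDegree_add_le_of_degree_le ((natDegree_C_mul_le _ _).trans (hp i 1))
    ((natDegree_C_mul_le _ _).trans (hp i 0))

open Polynomial in
lemma BAniso.natDegree_le {d : ι → R × R} (h : BAniso d) (p : ι → Fin 2 → R[X]) {n : ℕ}
    (hp : (bq (mapD Polynomial.C d) p).natDegree ≤ 2 * n) : ∀ i j, (p i j).natDegree ≤ n := by
  have key : ∀ N, n ≤ N → (∀ i j, (p i j).natDegree ≤ N) → ∀ i j, (p i j).natDegree ≤ n := by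
    intro N hN
    induction N, hN using Nat.le_induction with
    | base => exact id
    | succ N hN ih =>
      intro h1
      apply ih
      intro i j
      have h2 := h _ ((coeff_bq d p h1).symm.trans
        (coeff_eq_zero_of_natDegree_lt (by omega)))
      have h3 : (p i j).coeff (N + 1) = 0 := congrFun (congrFun h2 i) j
      have h4 := h1 i j
      by_contra hcon
      have h5 : (p i j).natDegree = N + 1 := by omega
      rw [← h5, coeff_natDegree, leadingCoeff_eq_zero] at h3
      rw [h3] at h5
      simp at h5
  refine key (max n (Finset.univ.sup fun i => Finset.univ.sup fun j => (p i j).natDegree))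
    (le_max_left _ _) fun i j => le_max_of_le_right ?_
  exact (Finset.le_sup (f := fun j => (p i j).natDegree) (Finset.mem_univ j)).trans
    (Finset.le_sup (f := fun i => Finset.univ.sup fun j => (p i j).natDegree) (Finset.mem_univ i))

open Polynomial in
lemma BAniso.polynomial {d : ι → R × R} (h : BAniso d) :
    BAniso (mapD (Polynomial.C : R →+* R[X]) d) := by
  intro p hp
  have h1 := h.natDegree_le p (n := 0) (by rw [hp]; simp)
  have h2 := h _ ((coeff_bq d p h1).symm.trans (by rw [hp, Polynomial.coeff_zero]))
  funext i j
  rw [eq_C_of_natDegree_le_zero (h1 i j)]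
  have h3 : (p i j).coeff 0 = 0 := congrFun (congrFun h2 i) j
  rw [h3]; simp

lemma BAniso.mvPolynomial {d : ι → R × R} (h : BAniso d) (n : ℕ) :
    BAniso (mapD (MvPolynomial.C : R →+* MvPolynomial (Fin n) R) d) := by
  induction n with
  | zero =>
    let e := MvPolynomial.isEmptyRingEquiv R (Fin 0)
    refine BAniso.of_injective (f := (e : _ →+* R)) e.injective ?_
    rw [mapD_mapD]
    convert h using 1
    funext i
    exact Prod.ext (e.apply_symm_apply _) (e.apply_symm_apply _)
  | succ n ih =>
    let e := MvPolynomial.finSuccEquiv R n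
    refine BAniso.of_injective (f := e.toRingEquiv.toRingHom)
      (show Function.Injective e from e.injective) ?_
    rw [mapD_mapD]
    convert ih.polynomial using 1
    funext i
    simp [mapD, e, MvPolynomial.finSuccEquiv_apply]

lemma exists_common_denominator (R K : Type) [CommRing R] [IsDomain R] [Field K] [Algebra R K]
    [IsFractionRing R K] (v : ι → Fin 2 → K) :
    ∃ (g : R) (p : ι → Fin 2 → R), g ≠ 0 ∧
      (fun i j => algebraMap R K (p i j)) = algebraMap R K g • v := by
  obtain ⟨g, hg⟩ := IsLocalization.exist_integer_multiples_of_finite (nonZeroDivisors R)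
    (fun x : ι × Fin 2 => v x.1 x.2)
  choose p hp using hg
  refine ⟨g, fun i j => p (i, j), nonZeroDivisors.coe_ne_zero g, ?_⟩
  funext i j
  rw [hp (i, j)]
  simp [Algebra.smul_def]

lemma BAniso.fraction {K : Type} [IsDomain R] [Field K] [Algebra R K] [IsFractionRing R K]
    {d : ι → R × R} (h : BAniso d) : BAniso (mapD (algebraMap R K) d) := by
  intro v hv
  obtain ⟨g, p, hg, hp⟩ := exists_common_denominator R K v
  have hg' : algebraMap R K g ≠ 0 := by simpa using hg
  have h1 : p = 0 := h p (by
    apply IsFractionRing.injective R K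
    rw [← bq_map, hp, bq_smul, hv]; simp)
  have h2 : algebraMap R K g • v = 0 := by rw [← hp, h1]; funext i j; simp
  exact (smul_eq_zero.1 h2).resolve_left hg'

end PolynomialValues

section CasselsPfister

open Polynomial

variable {K : Type} [Field K] [CharP K 2] {ι J : Type} [Fintype ι]

/-- Cassels–Pfister reduction with linear side conditions. -/
lemma BAniso.cassels_pfister {d : ι → K × K} (h : BAniso d) (e : J → ι → Fin 2 → K)
    (f : K[X]) (hf : f.natDegree ≤ 2) (l : J → K[X]) :
    ∀ (n : ℕ) (g : K[X]) (p : ι → Fin 2 → K[X]), g ≠ 0 → g.natDegree = n →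
      bq (mapD Polynomial.C d) p = f * g ^ 2 →
      (∀ j, bb (fun i t => Polynomial.C (e j i t)) p = g * l j) →
      ∃ y, bq (mapD Polynomial.C d) y = f ∧
        (∀ j, bb (fun i t => Polynomial.C (e j i t)) y = l j) ∧ ∀ i t, (y i t).natDegree ≤ 1 := by
  have fin : ∀ (g : K[X]) (y : ι → Fin 2 → K[X]), g ≠ 0 →
      bq (mapD Polynomial.C d) (g • y) = f * g ^ 2 →
      (∀ j, bb (fun i t => Polynomial.C (e j i t)) (g • y) = g * l j) →
      ∃ y, bq (mapD Polynomial.C d) y = f ∧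
        (∀ j, bb (fun i t => Polynomial.C (e j i t)) y = l j) ∧
          ∀ i t, (y i t).natDegree ≤ 1 := by
    intro g y hg h1 h2
    have h3 : bq (mapD Polynomial.C d) y = f := by
      rw [bq_smul, mul_comm] at h1
      exact mul_right_cancel₀ (pow_ne_zero 2 hg) h1
    refine ⟨y, h3, fun j => ?_, h.natDegree_le y (by rw [h3]; exact hf)⟩
    have := h2 j
    rw [bb_smul_right] at this
    exact mul_left_cancel₀ hg this
  intro n
  induction n using Nat.strong_induction_on with
  | _ n ih =>
    intro g p hg hn h1 h2
    by_cases hn0 : n = 0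
    · have hu : IsUnit g := isUnit_iff_degree_eq_zero.2 (by
        rw [degree_eq_natDegree hg, hn, hn0]; rfl)
      obtain ⟨u, rfl⟩ := hu
      refine fin u ((↑u⁻¹ : K[X]) • p) hg ?_ ?_
      · rwa [smul_smul, Units.mul_inv, one_smul]
      · rwa [smul_smul, Units.mul_inv, one_smul]
    set y : ι → Fin 2 → K[X] := fun i t => p i t / g with hy
    set r : ι → Fin 2 → K[X] := fun i t => p i t % g with hr
    have hp : p = g • y + r := by
      funext i t
      exact (EuclideanDomain.div_add_mod (p i t) g).symm
    have hrd : ∀ i t, (r i t).natDegree ≤ n - 1 := fun i t => by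
      have := natDegree_mod_lt (p i t) (q := g) (by omega)
      simp only [hr]
      omega
    by_cases hr0 : r = 0
    · rw [hr0, add_zero] at hp
      rw [hp] at h1 h2
      exact fin g y hg h1 h2
    set s := f + bq (mapD Polynomial.C d) y with hs
    set hh := g * s + bb p y with hhd
    have hry : bb r y = bb p y := by
      rw [hp, bb_add_left, bb_smul_left, bb_self, mul_zero, zero_add]
    have hbr : bq (mapD Polynomial.C d) r = g * hh := by
      have h3 : r = p + g • y := by
        funext i t
        have h4 := congrFun (congrFun hp i) t
        simp only [Pi.add_apply, Pi.smul_apply] at h4 ⊢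
        rw [h4, add_comm _ (r i t), add_assoc, CharTwo.add_self_eq_zero, add_zero]
      rw [h3, bq_add, bq_smul, h1, bb_smul_right, hhd, hs]
      ring
    have hh0 : hh ≠ 0 := by
      intro h0
      rw [h0, mul_zero] at hbr
      exact hr0 (h.polynomial r hbr)
    have hdeg : hh.natDegree < n := by
      have h3 := natDegree_bq_le d r hrd
      rw [hbr, natDegree_mul hg hh0] at h3
      omega
    refine ih _ hdeg hh (hh • y + s • r) hh0 rfl ?_ fun j => ?_
    · rw [bq_add, bq_smul, bq_smul, hbr, bb_smul_left, bb_smul_right, bb_comm y r, hry]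
      have h3 : bb p y = hh + g * s := by
        rw [hhd, add_comm (g * s), add_assoc, CharTwo.add_self_eq_zero, add_zero]
      have h4 : bq (mapD Polynomial.C d) y = f + s := by
        rw [hs, ← add_assoc, CharTwo.add_self_eq_zero, zero_add]
      rw [h3, h4]
      linear_combination (hh ^ 2 * s + s ^ 2 * g * hh) * (CharTwo.two_eq_zero : (2 : K[X]) = 0)
    · have h3 : bb (fun i t => Polynomial.C (e j i t)) r =
          g * (l j + bb (fun i t => Polynomial.C (e j i t)) y) := by
        have h4 := h2 j
        rw [hp, bb_add_right, bb_smul_right] at h4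
        linear_combination h4 -
          g * bb (fun i t => Polynomial.C (e j i t)) y * (CharTwo.two_eq_zero : (2 : K[X]) = 0)
      have h4 : bb (fun i t => Polynomial.C (e j i t)) r = 0 := by
        refine eq_zero_of_dvd_of_natDegree_lt ⟨_, h3⟩ ?_
        have := natDegree_bb_le (e j) r hrd
        omega
      rw [h4] at h3
      have h5 := (mul_eq_zero.1 h3.symm).resolve_left hg
      rw [bb_add_right, bb_smul_right, bb_smul_right, h4, ← CharTwo.add_eq_zero.1 h5]
      ring

end CasselsPfister

section Represent

variable {F : Type} [Field F] [CharP F 2] {ι : Type} [Fintype ι]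

lemma mapD_finSuccEquiv (d : ι → F × F) (m : ℕ) :
    mapD (MvPolynomial.finSuccEquiv F m).toRingEquiv.toRingHom
      (mapD (MvPolynomial.C : F →+* MvPolynomial (Fin (m + 1)) F) d) =
    mapD Polynomial.C (mapD (MvPolynomial.C : F →+* MvPolynomial (Fin m) F) d) := by
  funext i
  simp [mapD, MvPolynomial.finSuccEquiv_apply]

lemma BAniso.specialize {d : ι → F × F} (h : BAniso d) {J : Type} (e : J → ι → Fin 2 → F)
    (c : F) (l : J → F) (m : ℕ) :
    ∀ (p : ι → Fin 2 → MvPolynomial (Fin m) F) (g : MvPolynomial (Fin m) F), g ≠ 0 →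
      bq (mapD MvPolynomial.C d) p = MvPolynomial.C c * g ^ 2 →
      (∀ j, bb (fun i t => MvPolynomial.C (e j i t)) p = MvPolynomial.C (l j) * g) →
      ∃ y, bq d y = c ∧ ∀ j, bb (e j) y = l j := by
  induction m with
  | zero =>
    intro p g hg h1 h2
    let σ : MvPolynomial (Fin 0) F ≃+* F := MvPolynomial.isEmptyRingEquiv F (Fin 0)
    have hσ : ∀ x, σ (MvPolynomial.C x) = x := fun x => σ.apply_symm_apply x
    have hg' : σ g ≠ 0 := by simpa using hg
    have hd : mapD σ.toRingHom (mapD (MvPolynomial.C : F →+* MvPolynomial (Fin 0) F) d) = d := by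
      funext i
      exact Prod.ext (hσ _) (hσ _)
    have h3 : bq d (fun i j => σ (p i j)) = c * σ g ^ 2 := by
      have := bq_map σ.toRingHom (mapD MvPolynomial.C d) p
      rw [hd, h1] at this
      exact this.trans (by
        rw [RingEquiv.toRingHom_eq_coe, RingHom.coe_coe, map_mul, map_pow, hσ])
    refine ⟨(σ g)⁻¹ • fun i j => σ (p i j), ?_, fun j => ?_⟩
    · rw [bq_smul, h3]
      field_simp
    · have h4 : bb (e j) (fun i t => σ (p i t)) = l j * σ g := by
        have := bb_map σ.toRingHom (fun i t => MvPolynomial.C (e j i t)) p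
        rw [h2] at this
        simp only [RingEquiv.toRingHom_eq_coe, RingHom.coe_coe, map_mul, hσ] at this
        exact this
      rw [bb_smul_right, h4]
      field_simp
  | succ m ih =>
    intro p g hg h1 h2
    let σ := (MvPolynomial.finSuccEquiv F m).toRingEquiv
    have hσ : ∀ x, σ (MvPolynomial.C x) = Polynomial.C (MvPolynomial.C x) := fun x => by
      simp [σ, MvPolynomial.finSuccEquiv_apply]
    have hg' : σ g ≠ 0 := by simpa using hg
    have h3 : bq (mapD Polynomial.C (mapD MvPolynomial.C d)) (fun i j => σ (p i j)) =
        Polynomial.C (MvPolynomial.C c) * σ g ^ 2 := by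
      have := bq_map σ.toRingHom (mapD MvPolynomial.C d) p
      rw [mapD_finSuccEquiv, h1] at this
      exact this.trans (by
        rw [RingEquiv.toRingHom_eq_coe, RingHom.coe_coe, map_mul, map_pow, hσ])
    have hdeg : ∀ i j, (σ (p i j)).natDegree ≤ (σ g).natDegree := by
      apply (h.mvPolynomial m).natDegree_le
      rw [h3]
      exact (Polynomial.natDegree_C_mul_le _ _).trans Polynomial.natDegree_pow_le
    have h4 : (σ g).leadingCoeff ≠ 0 := by simpa using hg'
    refine ih (fun i j => (σ (p i j)).coeff (σ g).natDegree) _ h4 ?_ fun j => ?_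
    · rw [← coeff_bq _ _ hdeg, h3, Polynomial.coeff_C_mul, two_mul, pow_two (σ g),
        Polynomial.coeff_mul_add_eq_of_natDegree_le le_rfl le_rfl, ← pow_two]
      rfl
    · rw [← coeff_bb]
      have := bb_map σ.toRingHom (fun i t => MvPolynomial.C (e j i t)) p
      rw [h2] at this
      simp only [RingEquiv.toRingHom_eq_coe, RingHom.coe_coe, map_mul, hσ] at this
      rw [this, Polynomial.coeff_C_mul]
      rfl

/-- A reflection moves `q₁` to `E` while preserving all the relevant values. -/
lemma BAniso.reflect {K : Type} [Field K] [CharP K 2] {d : ι → K × K} (h : BAniso d)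
    {J : Type} (e : J → ι → Fin 2 → K) (q₀ q₁ E : ι → Fin 2 → K) (h1 : bq d q₁ = bq d E)
    (h2 : ∀ j, bb (e j) q₁ = bb (e j) E) :
    ∃ q, bq d q = bq d q₀ ∧ bb E q = bb q₀ q₁ ∧ ∀ j, bb (e j) q = bb (e j) q₀ := by
  by_cases hu : q₁ + E = 0
  · refine ⟨q₀, rfl, ?_, fun _ => rfl⟩
    have h3 : q₁ = E := by
      funext i t
      exact CharTwo.add_eq_zero.1 (congrFun (congrFun hu i) t)
    rw [h3, bb_comm]
  · have hu' : bq d (q₁ + E) ≠ 0 := fun h0 => hu (h _ h0)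
    have h3 : bq d (q₁ + E) = bb q₁ E := by
      rw [bq_add, h1, CharTwo.add_self_eq_zero, zero_add]
    refine ⟨q₀ + (bb q₀ (q₁ + E) / bq d (q₁ + E)) • (q₁ + E), ?_, ?_, fun j => ?_⟩
    · rw [bq_add, bq_smul, bb_smul_right]
      field_simp
      linear_combination bb q₀ (q₁ + E) ^ 2 * (CharTwo.two_eq_zero : (2 : K) = 0)
    · rw [bb_add_right, bb_smul_right, bb_comm E (q₁ + E), bb_add_left, bb_self, add_zero, ← h3,
        div_mul_cancel₀ _ hu', bb_add_right, bb_comm E q₀]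
      linear_combination bb q₀ E * (CharTwo.two_eq_zero : (2 : K) = 0)
    · rw [bb_add_right, bb_smul_right, bb_add_right (e j), h2, CharTwo.add_self_eq_zero, mul_zero,
        add_zero]

lemma eval_bq {R : Type} [CommRing R] (d : ι → R × R) (y : ι → Fin 2 → Polynomial R) (x : R) :
    (bq (mapD Polynomial.C d) y).eval x = bq d fun i t => (y i t).eval x := by
  have h := bq_map (Polynomial.evalRingHom x) (mapD Polynomial.C d) y
  rw [Polynomial.coe_evalRingHom] at h
  rw [← h]
  congr 1
  funext i
  simp [mapD]

lemma BAniso.represent {d : ι → F × F} (h : BAniso d) (m : ℕ) :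
    ∀ (J : Type) (e : J → ι → Fin 2 → F) (c : Fin m → Fin m → F) (l : J → Fin m → F)
      (S : ι → Fin 2 → MvPolynomial (Fin m) F) (G : MvPolynomial (Fin m) F), G ≠ 0 →
      bq (mapD MvPolynomial.C d) S =
        (∑ i, ∑ j, MvPolynomial.C (c i j) * (X i * X j)) * G ^ 2 →
      (∀ j, bb (fun i t => MvPolynomial.C (e j i t)) S =
        G * ∑ i, MvPolynomial.C (l j i) * X i) →
      ∃ v : Fin m → ι → Fin 2 → F, (∀ i, bq d (v i) = c i i) ∧
        (∀ i j, i ≠ j → bb (v i) (v j) = c i j + c j i) ∧ ∀ j i, bb (e j) (v i) = l j i := by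
  induction m with
  | zero => exact fun J e c l S G _ _ _ => ⟨Fin.elim0, fun i => i.elim0, fun i => i.elim0,
      fun _ i => i.elim0⟩
  | succ m ih =>
    intro J e c l S G hG h1 h2
    let R := MvPolynomial (Fin m) F
    obtain ⟨K, _, _, _⟩ : ∃ (K : Type) (_ : Field K) (_ : Algebra R K), IsFractionRing R K :=
      ⟨FractionRing R, inferInstance, inferInstance, inferInstance⟩
    let α : R →+* K := algebraMap R K
    have hα : Function.Injective α := IsFractionRing.injective R K
    have : CharP K 2 := charP_of_injective_ringHom
      (f := α.comp MvPolynomial.C) (hα.comp (MvPolynomial.C_injective _ _)) 2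
    let τ : MvPolynomial (Fin (m + 1)) F →+* Polynomial K :=
      (Polynomial.mapRingHom α).comp (MvPolynomial.finSuccEquiv F m).toRingEquiv.toRingHom
    have hτ : Function.Injective τ :=
      (Polynomial.map_injective α hα).comp (MvPolynomial.finSuccEquiv F m).injective
    have hτC : ∀ x, τ (MvPolynomial.C x) = Polynomial.C (α (MvPolynomial.C x)) := fun x => by
      simp [τ, MvPolynomial.finSuccEquiv_apply]
    have hτ0 : τ (X 0) = Polynomial.X := by simp [τ, MvPolynomial.finSuccEquiv_apply]
    have hτs : ∀ i : Fin m, τ (X i.succ) = Polynomial.C (α (X i)) := fun i => by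
      simp [τ, MvPolynomial.finSuccEquiv_apply]
    have hK : BAniso (mapD (α.comp MvPolynomial.C) d) := (h.mvPolynomial m).fraction
    set L : R := ∑ i : Fin m, MvPolynomial.C (c 0 i.succ + c i.succ 0) * X i with hL
    set f' : R := ∑ i : Fin m, ∑ j : Fin m, MvPolynomial.C (c i.succ j.succ) * (X i * X j)
      with hf'
    set Λ : J → R := fun j => ∑ i : Fin m, MvPolynomial.C (l j i.succ) * X i with hΛ
    set P : Polynomial K := Polynomial.C (α (MvPolynomial.C (c 0 0))) * Polynomial.X ^ 2 +
      Polynomial.C (α L) * Polynomial.X + Polynomial.C (α f') with hP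
    have hτP : τ (∑ i, ∑ j, MvPolynomial.C (c i j) * (X i * X j)) = P := by
      simp only [Fin.sum_univ_succ, map_add, map_sum, map_mul, hτC, hτ0, hτs, hP, hL, hf',
        Finset.sum_add_distrib, add_mul, Finset.sum_mul]
      ring_nf
    set l' : J → Polynomial K := fun j => Polynomial.C (α (MvPolynomial.C (l j 0))) * Polynomial.X +
      Polynomial.C (α (Λ j)) with hl'
    have hτl : ∀ j, τ (∑ i, MvPolynomial.C (l j i) * X i) = l' j := fun j => by
      simp only [Fin.sum_univ_succ, map_add, map_sum, map_mul, hτC, hτ0, hτs, hl', hΛ]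
    obtain ⟨y, hy1, hy2, hy3⟩ := hK.cassels_pfister
      (fun j i t => α (MvPolynomial.C (e j i t))) P
      (by
        rw [hP]
        exact Polynomial.natDegree_quadratic_le)
      l' _ (τ G) (fun i t => τ (S i t)) (by simpa [map_eq_zero_iff τ hτ] using hG) rfl
      (by
        have h3 := bq_map τ (mapD MvPolynomial.C d) S
        rw [h1, map_mul, map_pow, hτP] at h3
        rw [← h3]
        congr 1
        funext i
        exact Prod.ext (hτC _).symm (hτC _).symm)
      (fun j => by
        have h3 := bb_map τ (fun i t => MvPolynomial.C (e j i t)) S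
        rw [h2, map_mul, hτl] at h3
        simpa only [hτC] using h3)
    set q₁ : ι → Fin 2 → K := fun i t => (y i t).coeff 1 with hq₁
    set q₀ : ι → Fin 2 → K := fun i t => (y i t).coeff 0 with hq₀
    have hev : ∀ x : K, bq (mapD (α.comp MvPolynomial.C) d) (q₀ + x • q₁) = P.eval x := by
      intro x
      rw [← hy1, eval_bq]
      congr 1
      funext i t
      rw [Polynomial.eq_X_add_C_of_natDegree_le_one (hy3 i t)]
      simp [q₀, q₁]
      ring
    have hb1 : bq (mapD (α.comp MvPolynomial.C) d) q₁ = α (MvPolynomial.C (c 0 0)) := by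
      rw [hq₁, ← coeff_bq _ _ hy3, hy1, hP]
      simp
    have hb0 : bq (mapD (α.comp MvPolynomial.C) d) q₀ = α f' := by
      have := hev 0
      simpa [hP] using this
    have hb01 : bb q₀ q₁ = α L := by
      have h3 := hev 1
      rw [one_smul, bq_add, hb0, hb1] at h3
      simp [hP] at h3
      linear_combination h3
    have hc : ∀ j n, bb (fun i t => α (MvPolynomial.C (e j i t))) (fun i t => (y i t).coeff n) =
        (l' j).coeff n := fun j n => by
      rw [← hy2 j, coeff_bb]
    obtain ⟨g, p, hg, hp⟩ := exists_common_denominator R K q₁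
    obtain ⟨E, hE1, hE2⟩ := h.specialize e (c 0 0) (fun j => l j 0) m p g hg
      (by
        apply hα
        rw [← bq_map, hp, mapD_mapD, bq_smul, hb1, map_mul, map_pow, mul_comm])
      (fun j => by
        apply hα
        rw [← bb_map, hp, bb_smul_right, hc, map_mul, mul_comm]
        congr 1
        simp [hl'])
    obtain ⟨q, hq1, hq2, hq3⟩ := hK.reflect (fun j i t => α (MvPolynomial.C (e j i t))) q₀ q₁
      (fun i t => α (MvPolynomial.C (E i t)))
      (by
        rw [hb1, ← hE1]
        exact (bq_map (α.comp MvPolynomial.C) d E).symm)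
      (fun j => by
        have h3 := bb_map (α.comp MvPolynomial.C) (e j) E
        rw [hE2] at h3
        rw [hc]
        refine Eq.trans ?_ h3.symm
        simp [hl'])
    obtain ⟨g', S', hg', hS'⟩ := exists_common_denominator R K q
    obtain ⟨v, hv1, hv2, hv3⟩ := ih (Option J) (fun o => o.elim E e)
      (fun i j => c i.succ j.succ)
      (fun o i => o.elim (c 0 i.succ + c i.succ 0) fun j => l j i.succ) S' g' hg'
      (by
        apply hα
        rw [← bq_map, hS', mapD_mapD, bq_smul, hq1, hb0, map_mul, map_pow, mul_comm])
      (fun o => by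
        apply hα
        rw [← bb_map, hS', bb_smul_right, map_mul]
        congr 1
        cases o with
        | none => exact hq2.trans hb01
        | some j =>
          refine (hq3 j).trans ((hc j 0).trans ?_)
          simp [hl', hΛ])
    refine ⟨Fin.cons E v, fun i => ?_, fun i j hij => ?_, fun j i => ?_⟩
    · refine Fin.cases ?_ (fun i => ?_) i
      · exact hE1
      · exact hv1 i
    · induction i using Fin.cases with
      | zero =>
        induction j using Fin.cases with
        | zero => exact absurd rfl hij
        | succ j => exact hv3 none j
      | succ i =>
        induction j using Fin.cases with
        | zero =>
          exact (bb_comm _ _).trans ((hv3 none i).trans (add_comm _ _))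
        | succ j => exact hv2 i j (fun h0 => hij (by rw [h0]))
    · refine Fin.cases ?_ (fun i => ?_) i
      · exact hE2 j
      · exact hv3 (some j) i

end Represent

section Subform

variable {F : Type} [Field F] [CharP F 2] {ι : Type} [Fintype ι]

/-- The quadratic polynomial with coefficient matrix `c`. -/
noncomputable def quadPoly {n : ℕ} (c : Fin n → Fin n → F) : MvPolynomial (Fin n) F :=
  ∑ i, ∑ j, MvPolynomial.C (c i j) * (X i * X j)

/-- The part of `quadPoly c` linear in the zeroth variable. -/
noncomputable def quadLin {n : ℕ} (c : Fin (n + 1) → Fin (n + 1) → F) : MvPolynomial (Fin n) F :=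
  ∑ i : Fin n, MvPolynomial.C (c 0 i.succ + c i.succ 0) * X i

/-- The part of `quadPoly c` free of the zeroth variable. -/
noncomputable def quadConst {n : ℕ} (c : Fin (n + 1) → Fin (n + 1) → F) :
    MvPolynomial (Fin n) F :=
  ∑ i : Fin n, ∑ j : Fin n, MvPolynomial.C (c i.succ j.succ) * (X i * X j)

/-- `quadPoly c` as a polynomial in the zeroth variable. -/
noncomputable def quadSucc {n : ℕ} (c : Fin (n + 1) → Fin (n + 1) → F) :
    Polynomial (MvPolynomial (Fin n) F) :=
  Polynomial.C (MvPolynomial.C (c 0 0)) * Polynomial.X ^ 2 +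
    Polynomial.C (quadLin c) * Polynomial.X + Polynomial.C (quadConst c)

lemma finSuccEquiv_quadPoly {n : ℕ} (c : Fin (n + 1) → Fin (n + 1) → F) :
    MvPolynomial.finSuccEquiv F n (quadPoly c) = quadSucc c := by
  simp only [quadPoly, quadSucc, quadLin, quadConst, Fin.sum_univ_succ, map_add, map_sum, map_mul,
   
    Finset.sum_add_distrib, add_mul, Finset.sum_mul, MvPolynomial.finSuccEquiv_apply]
  simp
  ring_nf

lemma quadSucc_ne_zero {n : ℕ} {c : Fin (n + 1) → Fin (n + 1) → F} (h : c 0 0 ≠ 0) :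
    quadSucc c ≠ 0 := by
  intro h0
  have := congrArg (fun p => p.coeff 2) h0
  simp [quadSucc] at this
  exact h this

lemma natDegree_quadSucc {n : ℕ} {c : Fin (n + 1) → Fin (n + 1) → F} (h : c 0 0 ≠ 0) :
    (quadSucc c).natDegree = 2 :=
  Polynomial.natDegree_quadratic (by simpa using h)

/-- A value of degree at most two divisible by the quadratic polynomial. -/
lemma BAniso.eq_of_dvd {d : ι → F × F} (h : BAniso d) {n : ℕ}
    {c : Fin (n + 1) → Fin (n + 1) → F} (hc : c 0 0 ≠ 0)
    {P : ι → Fin 2 → Polynomial (MvPolynomial (Fin n) F)} (hP : P ≠ 0)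
    (hdeg : ∀ i t, (P i t).natDegree ≤ 1)
    (hdvd : quadSucc c ∣ bq (mapD Polynomial.C (mapD MvPolynomial.C d)) P) :
    ∃ r : ι → Fin 2 → MvPolynomial (Fin n) F, r ≠ 0 ∧
      Polynomial.C (MvPolynomial.C (c 0 0)) *
        bq (mapD Polynomial.C (mapD MvPolynomial.C d)) P =
        quadSucc c * Polynomial.C (bq (mapD MvPolynomial.C d) r) := by
  obtain ⟨g, hg⟩ := hdvd
  have h0 : bq (mapD Polynomial.C (mapD MvPolynomial.C d)) P ≠ 0 := fun h0 =>
    hP ((h.mvPolynomial n).polynomial P h0)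
  have hg0 : g ≠ 0 := fun h1 => h0 (by rw [hg, h1, mul_zero])
  have hgd : g.natDegree ≤ 0 := by
    have h1 := natDegree_bq_le (mapD MvPolynomial.C d) P hdeg
    rw [hg, Polynomial.natDegree_mul (quadSucc_ne_zero hc) hg0, natDegree_quadSucc hc] at h1
    omega
  obtain ⟨g0, rfl⟩ : ∃ g0, g = Polynomial.C g0 := ⟨_, Polynomial.eq_C_of_natDegree_le_zero hgd⟩
  have h2 := coeff_bq (mapD MvPolynomial.C d) P hdeg
  rw [hg, Polynomial.coeff_mul_C] at h2
  have h3 : (quadSucc c).coeff (2 * 1) = MvPolynomial.C (c 0 0) := by simp [quadSucc]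
  rw [h3] at h2
  refine ⟨fun i t => (P i t).coeff 1, ?_, ?_⟩
  · intro h4
    rw [h4, bq_zero] at h2
    have h5 : (MvPolynomial.C (c 0 0) : MvPolynomial (Fin n) F) ≠ 0 := by simpa using hc
    exact hg0 (by rw [(mul_eq_zero.1 h2).resolve_left h5, map_zero])
  · rw [hg, ← h2, map_mul]
    ring

/-- The subform theorem for forms staying round over every extension. -/
lemma BAniso.subform {d : ι → F × F} (h : BAniso d)
    (hr : ∀ (L : Type) [Field L] [CharP L 2] (f : F →+* L), IsRound (mapD f d)) {n : ℕ}
    {c : Fin (n + 1) → Fin (n + 1) → F} (hc : c 0 0 ≠ 0)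
    {P : ι → Fin 2 → Polynomial (MvPolynomial (Fin n) F)} (hP : P ≠ 0)
    (hdeg : ∀ i t, (P i t).natDegree ≤ 1)
    (hdvd : quadSucc c ∣ bq (mapD Polynomial.C (mapD MvPolynomial.C d)) P) :
    ∃ v : Fin (n + 1) → ι → Fin 2 → F, (∀ i, c 0 0 * bq d (v i) = c i i) ∧
      ∀ i j, i ≠ j → c 0 0 * bb (v i) (v j) = c i j + c j i := by
  obtain ⟨r, hr0, hr1⟩ := h.eq_of_dvd hc hP hdeg hdvd
  let M := MvPolynomial (Fin (n + 1)) F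
  let L := FractionRing M
  let α : M →+* L := algebraMap M L
  have hα : Function.Injective α := IsFractionRing.injective M L
  let f : F →+* L := α.comp MvPolynomial.C
  have : CharP L 2 := charP_of_injective_ringHom (f := f) f.injective 2
  let σ := (MvPolynomial.finSuccEquiv F n).toRingEquiv
  let τ : Polynomial (MvPolynomial (Fin n) F) →+* L := α.comp σ.symm.toRingHom
  have hτ : Function.Injective τ := hα.comp σ.symm.injective
  have hσC : ∀ x, σ (MvPolynomial.C x) = Polynomial.C (MvPolynomial.C x) := fun x => by
    simp [σ, MvPolynomial.finSuccEquiv_apply]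
  have hτC : ∀ x, τ (Polynomial.C (MvPolynomial.C x)) = f x := fun x => by
    simp only [τ, f, RingHom.comp_apply, ← hσC]
    exact congrArg α (σ.symm_apply_apply _)
  have hτq : τ (quadSucc c) = α (quadPoly c) :=
    congrArg α ((congrArg σ.symm (finSuccEquiv_quadPoly c).symm).trans (σ.symm_apply_apply _))
  have hL : BAniso (mapD f d) := (h.mvPolynomial (n + 1)).fraction
  have hD : mapD τ (mapD Polynomial.C (mapD MvPolynomial.C d)) = mapD f d :=
    funext fun i => Prod.ext (hτC _) (hτC _)
  set P' : ι → Fin 2 → L := fun i t => τ (P i t) with hP'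
  set r' : ι → Fin 2 → L := fun i t => τ (Polynomial.C (r i t)) with hr'
  have hbP : bq (mapD f d) P' = τ (bq (mapD Polynomial.C (mapD MvPolynomial.C d)) P) := by
    rw [← bq_map, hD]
  have hbr : bq (mapD f d) r' = τ (Polynomial.C (bq (mapD MvPolynomial.C d) r)) := by
    rw [← bq_map Polynomial.C, ← bq_map τ, hD]
  have key : f (c 0 0) * bq (mapD f d) P' = α (quadPoly c) * bq (mapD f d) r' := by
    rw [hbP, hbr, ← hτC, ← hτq, ← map_mul, hr1, map_mul]
  have hr'0 : r' ≠ 0 := by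
    intro h1
    apply hr0
    funext i t
    apply Polynomial.C_injective
    apply hτ
    have := congrFun (congrFun h1 i) t
    simpa [hr'] using this
  have hbr0 : bq (mapD f d) r' ≠ 0 := fun h1 => hr'0 (hL _ h1)
  have hround := hr L f r' hr'0
  rw [sc_cl hbr0] at hround
  obtain ⟨Φ, hΦ⟩ := exists_isometry_of_cl_eq hround rfl hL
  have hfc : f (c 0 0) ≠ 0 := by simpa using hc
  have hx : bq (mapD f d) (Φ (scEquiv _ hbr0 ((bq (mapD f d) r')⁻¹ • P'))) =
      (f (c 0 0))⁻¹ * α (quadPoly c) := by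
    have h1 : bq (mapD f d) P' = (f (c 0 0))⁻¹ * (α (quadPoly c) * bq (mapD f d) r') := by
      rw [← key, inv_mul_cancel_left₀ hfc]
    rw [hΦ, bq_scEquiv, bq_smul, h1]
    calc _ = (f (c 0 0))⁻¹ * α (quadPoly c) *
          (bq (mapD f d) r' * (bq (mapD f d) r')⁻¹) ^ 2 := by ring
      _ = _ := by rw [mul_inv_cancel₀ hbr0, one_pow, mul_one]
  obtain ⟨G, S, hG, hS⟩ := exists_common_denominator M L
    (Φ (scEquiv _ hbr0 ((bq (mapD f d) r')⁻¹ • P')))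
  obtain ⟨v, hv1, hv2, -⟩ := h.represent (n + 1) Empty Empty.elim (fun i j => (c 0 0)⁻¹ * c i j)
    Empty.elim S G hG
    (by
      apply hα
      rw [← bq_map, hS, mapD_mapD, bq_smul, hx, map_mul, map_pow, mul_comm]
      congr 1
      simp only [map_mul, mul_assoc, ← Finset.mul_sum]
      rw [← map_inv₀ f]
      rfl) (fun j => j.elim)
  refine ⟨v, fun i => ?_, fun i j hij => ?_⟩
  · rw [hv1]; field_simp
  · rw [hv2 i j hij]; field_simp

end Subform

section Quadric

variable {F : Type} [Field F] [CharP F 2]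

/-- The value of the quadratic form with coefficient matrix `c`. -/
def quadVal {R : Type} [CommRing R] {n : ℕ} (c : Fin n → Fin n → R) (x : Fin n → R) : R :=
  ∑ i, ∑ j, c i j * (x i * x j)

/-- Restriction of a polynomial to the line spanned by `x`. -/
noncomputable def onLine {m : ℕ} (x : Fin m → F) :
    MvPolynomial (Fin m) F →ₐ[F] Polynomial F :=
  MvPolynomial.aeval fun i => Polynomial.C (x i) * Polynomial.X

lemma onLine_quadPoly {m : ℕ} (c : Fin m → Fin m → F) (x : Fin m → F) :
    onLine x (quadPoly c) = Polynomial.C (quadVal c x) * Polynomial.X ^ 2 := by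
  simp only [onLine, quadPoly, quadVal, map_sum, map_mul, MvPolynomial.aeval_X,
    MvPolynomial.aeval_C, Finset.sum_mul]
  refine Finset.sum_congr rfl fun i _ => Finset.sum_congr rfl fun j _ => ?_
  rw [Polynomial.algebraMap_eq]
  ring

lemma onLine_linear {m : ℕ} (a x : Fin m → F) :
    onLine x (∑ i, MvPolynomial.C (a i) * X i) =
      Polynomial.C (∑ i, a i * x i) * Polynomial.X := by
  simp only [onLine, map_sum, map_mul, MvPolynomial.aeval_X,
    MvPolynomial.aeval_C, Finset.sum_mul]
  refine Finset.sum_congr rfl fun i _ => ?_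
  rw [Polynomial.algebraMap_eq]
  ring

lemma onLine_coeff_zero {m : ℕ} (x : Fin m → F) (p : MvPolynomial (Fin m) F) :
    (onLine x p).coeff 0 = MvPolynomial.constantCoeff p := by
  induction p using MvPolynomial.induction_on with
  | C a => simp [onLine]
  | add p q hp hq => rw [map_add, Polynomial.coeff_add, hp, hq, map_add]
  | mul_X p i hp => simp [onLine]

lemma onLine_coeff_one {m : ℕ} (p : MvPolynomial (Fin m) F) :
    ∃ l : (Fin m → F) →ₗ[F] F, ∀ x, (onLine x p).coeff 1 = l x := by
  induction p using MvPolynomial.induction_on with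
  | C a => exact ⟨0, fun x => by simp [onLine]⟩
  | add p q hp hq =>
    obtain ⟨l1, h1⟩ := hp
    obtain ⟨l2, h2⟩ := hq
    exact ⟨l1 + l2, fun x => by rw [map_add, Polynomial.coeff_add, h1, h2]; rfl⟩
  | mul_X p i hp =>
    refine ⟨MvPolynomial.constantCoeff p • LinearMap.proj i, fun x => ?_⟩
    rw [map_mul, ← onLine_coeff_zero x p, onLine, MvPolynomial.aeval_X, ← mul_assoc,
      Polynomial.coeff_mul_X, Polynomial.coeff_mul_C]
    rfl

lemma quadPoly_ne_zero {m : ℕ} {c : Fin m → Fin m → F} {x : Fin m → F} (h : quadVal c x ≠ 0) :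
    quadPoly c ≠ 0 := by
  intro h0
  have h1 := onLine_quadPoly c x
  rw [h0, map_zero] at h1
  have := congrArg (fun p => p.coeff 2) h1
  simp at this
  exact h this.symm

lemma totalDegree_quadPoly_le {m : ℕ} (c : Fin m → Fin m → F) :
    (quadPoly c).totalDegree ≤ 2 := by
  refine MvPolynomial.totalDegree_finsetSum_le fun i _ =>
    MvPolynomial.totalDegree_finsetSum_le fun j _ => ?_
  refine (MvPolynomial.totalDegree_mul _ _).trans ?_
  rw [MvPolynomial.totalDegree_C, zero_add]
  refine (MvPolynomial.totalDegree_mul _ _).trans ?_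
  simp [MvPolynomial.totalDegree_X]

lemma not_dvd_linear {m : ℕ} {c : Fin m → Fin m → F}
    (a : Fin m → F) (ha : a ≠ 0) :
    ¬ quadPoly c ∣ ∑ i, MvPolynomial.C (a i) * X i := by
  rintro ⟨q, hq⟩
  obtain ⟨i, hi⟩ := Function.ne_iff.1 ha
  have h1 := congrArg (onLine (Pi.single i 1)) hq
  rw [map_mul, onLine_linear, onLine_quadPoly] at h1
  have h2 := congrArg (fun p => p.coeff 1) h1
  simp [Pi.single_apply, mul_assoc, Polynomial.coeff_X_pow_mul'] at h2
  exact hi h2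

/-- An anisotropic quadratic polynomial in at least two variables is irreducible. -/
lemma irreducible_quadPoly {m : ℕ} (hm : 2 ≤ m) {c : Fin m → Fin m → F}
    (hc : ∀ x, quadVal c x = 0 → x = 0) : Irreducible (quadPoly c) := by
  have key : ∀ A B : MvPolynomial (Fin m) F, quadPoly c = A * B → A.totalDegree = 1 →
      B.totalDegree = 1 → False := by
    intro A B hAB hA hB
    obtain ⟨l, hl⟩ := onLine_coeff_one A
    obtain ⟨x, hx, hx0⟩ : ∃ x ∈ LinearMap.ker l, x ≠ 0 := by
      apply Submodule.exists_mem_ne_zero_of_ne_bot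
      apply LinearMap.ker_ne_bot_of_finrank_lt
      simp
      omega
    have h1 : ∀ Q : MvPolynomial (Fin m) F, Q.totalDegree = 1 → (onLine x Q).natDegree ≤ 1 := by
      intro Q hQ
      refine (MvPolynomial.aeval_natDegree_le Q hQ.le _ (n := 1) fun i => ?_).trans (by simp)
      exact (Polynomial.natDegree_C_mul_le _ _).trans Polynomial.natDegree_X_le
    have h2 : onLine x A = Polynomial.C ((onLine x A).coeff 0) := by
      conv_lhs => rw [Polynomial.eq_X_add_C_of_natDegree_le_one (h1 A hA)]
      rw [hl, LinearMap.mem_ker.1 hx]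
      simp
    have h3 := onLine_quadPoly c x
    rw [hAB, map_mul, h2] at h3
    have h4 := congrArg (fun p => p.coeff 2) h3
    simp only [Polynomial.coeff_C_mul, Polynomial.coeff_X_pow, if_true, mul_one,
      Polynomial.coeff_eq_zero_of_natDegree_lt ((h1 B hB).trans_lt one_lt_two), mul_zero] at h4
    exact hx0 (hc x h4.symm)
  have hne : quadPoly c ≠ 0 :=
    quadPoly_ne_zero (x := Pi.single ⟨0, by omega⟩ 1) fun h0 => by
      simpa using congrFun (hc _ h0) ⟨0, by omega⟩
  have hconst : ∀ A : MvPolynomial (Fin m) F, A ≠ 0 → A.totalDegree = 0 → IsUnit A := by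
    intro A hA h0
    rw [MvPolynomial.totalDegree_eq_zero_iff_eq_C] at h0
    rw [h0] at hA ⊢
    exact (isUnit_iff_ne_zero.2 (by simpa using hA)).map MvPolynomial.C
  refine ⟨fun hu => ?_, fun A B hAB => ?_⟩
  · obtain ⟨B, hB⟩ := hu.exists_right_inv
    have h1 := congrArg (fun p => (onLine 0 p).coeff 0) hB
    simp [onLine_quadPoly] at h1
  · have hA : A ≠ 0 := by rintro rfl; exact hne (by rw [hAB, zero_mul])
    have hB : B ≠ 0 := by rintro rfl; exact hne (by rw [hAB, mul_zero])
    have hdeg := totalDegree_quadPoly_le c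
    rw [hAB, MvPolynomial.totalDegree_mul_of_isDomain hA hB] at hdeg
    by_cases hA0 : A.totalDegree = 0
    · exact Or.inl (hconst A hA hA0)
    by_cases hB0 : B.totalDegree = 0
    · exact Or.inr (hconst B hB hB0)
    exact (key A B hAB (by omega) (by omega)).elim

/-- `g` exhibits `K` as the function field of the affine quadric of `c`. -/
structure QuadricField {n : ℕ} (c : Fin n → Fin n → F) {K : Type} [Field K]
    (g : MvPolynomial (Fin n) F →+* K) : Prop where
  ker : ∀ p, g p = 0 ↔ quadPoly c ∣ p
  frac : ∀ (κ : Type) [Finite κ] (x : κ → K),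
    ∃ (s : MvPolynomial (Fin n) F) (p : κ → MvPolynomial (Fin n) F), g s ≠ 0 ∧
      ∀ i, g (p i) = g s * x i

lemma quadricField {n : ℕ} (c : Fin n → Fin n → F)
    [IsDomain (MvPolynomial (Fin n) F ⧸ Ideal.span {quadPoly c})] :
    QuadricField c ((algebraMap (MvPolynomial (Fin n) F ⧸ Ideal.span {quadPoly c})
      (FractionRing (MvPolynomial (Fin n) F ⧸ Ideal.span {quadPoly c}))).comp
      (Ideal.Quotient.mk (Ideal.span {quadPoly c}))) where
  ker p := by
    rw [RingHom.comp_apply, map_eq_zero_iff _ (IsFractionRing.injective _ _),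
      Ideal.Quotient.eq_zero_iff_mem, Ideal.mem_span_singleton]
  frac κ _ x := by
    obtain ⟨s, hs⟩ := IsLocalization.exist_integer_multiples_of_finite
      (nonZeroDivisors (MvPolynomial (Fin n) F ⧸ Ideal.span {quadPoly c})) x
    choose p hp using hs
    obtain ⟨s', hs'⟩ := Ideal.Quotient.mk_surjective s.1
    choose p' hp' using fun i => Ideal.Quotient.mk_surjective (p i)
    refine ⟨s', p', ?_, fun i => ?_⟩
    · rw [RingHom.comp_apply, hs', Ne, map_eq_zero_iff _ (IsFractionRing.injective _ _)]
      exact nonZeroDivisors.coe_ne_zero s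
    · rw [RingHom.comp_apply, hp', hp, RingHom.comp_apply, hs', Algebra.smul_def]

section Generic

variable {n : ℕ} {c : Fin n → Fin n → F} {K : Type} [Field K] {g : MvPolynomial (Fin n) F →+* K}

lemma QuadricField.quadVal_eq_zero (h : QuadricField c g) :
    quadVal (fun i j => g (MvPolynomial.C (c i j))) (fun i => g (X i)) = 0 := by
  have := (h.ker (quadPoly c)).2 dvd_rfl
  simpa only [quadVal, quadPoly, map_sum, map_mul] using this

lemma QuadricField.linear_ne_zero (h : QuadricField c g) (a : Fin n → F) (ha : a ≠ 0) :
    ∑ i, g (MvPolynomial.C (a i)) * g (X i) ≠ 0 := by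
  intro h0
  refine not_dvd_linear a ha ((h.ker _).1 ?_)
  simpa only [map_sum, map_mul] using h0

end Generic

/-- Lifting of a nonzero vector to polynomials of degree at most one in the zeroth variable. -/
lemma QuadricField.lift {n : ℕ} {c : Fin (n + 1) → Fin (n + 1) → F} {K : Type} [Field K]
    {g : MvPolynomial (Fin (n + 1)) F →+* K} (h : QuadricField c g) (hc : c 0 0 ≠ 0) :
    ∃ g' : Polynomial (MvPolynomial (Fin n) F) →+* K, (∀ p, g' p = 0 ↔ quadSucc c ∣ p) ∧
      (∀ x, g' (Polynomial.C (MvPolynomial.C x)) = g (MvPolynomial.C x)) ∧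
      ∀ (κ : Type) [Finite κ] (x : κ → K), x ≠ 0 →
        ∃ (l : K) (P : κ → Polynomial (MvPolynomial (Fin n) F)), l ≠ 0 ∧ P ≠ 0 ∧
          (∀ i, (P i).natDegree ≤ 1) ∧ ∀ i, g' (P i) = l * x i := by
  let σ := (MvPolynomial.finSuccEquiv F n).toRingEquiv
  have hσC : ∀ x, σ (MvPolynomial.C x) = Polynomial.C (MvPolynomial.C x) := fun x => by
    simp [σ, MvPolynomial.finSuccEquiv_apply]
  have hker : ∀ p, (g.comp σ.symm.toRingHom) p = 0 ↔ quadSucc c ∣ p := fun p => by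
    rw [← finSuccEquiv_quadPoly, RingHom.comp_apply]
    refine (h.ker _).trans ?_
    rw [← map_dvd_iff σ]
    exact iff_of_eq (congrArg _ (σ.apply_symm_apply p))
  refine ⟨g.comp σ.symm.toRingHom, hker, fun x => ?_, fun κ _ x hx => ?_⟩
  · rw [← hσC]
    exact congrArg g (σ.symm_apply_apply _)
  · obtain ⟨s, p, hs, hp⟩ := h.frac κ x
    set q : Polynomial (MvPolynomial (Fin n) F) :=
      quadSucc c * Polynomial.C (MvPolynomial.C (c 0 0)⁻¹) with hq
    have hqm : q.Monic := by
      have h1 : q.natDegree ≤ 2 := by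
        refine (Polynomial.natDegree_mul_C_le _ _).trans (natDegree_quadSucc hc).le
      apply Polynomial.monic_of_natDegree_le_of_coeff_eq_one 2 h1
      rw [hq, Polynomial.coeff_mul_C]
      simp [quadSucc, ← map_mul, hc]
    have hq2 : q.natDegree = 2 := by
      rw [hq, Polynomial.natDegree_mul_C (by simpa using hc), natDegree_quadSucc hc]
    have hgP : ∀ i, (g.comp σ.symm.toRingHom) (σ (p i) %ₘ q) = g s * x i := fun i => by
      have h1 := Polynomial.modByMonic_add_div (σ (p i)) q
      have h2 := congrArg (g.comp σ.symm.toRingHom) h1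
      rw [map_add, (hker (q * _)).2 (by rw [hq, mul_assoc]; exact dvd_mul_right _ _),
        add_zero] at h2
      rw [h2, ← hp]
      exact congrArg g (σ.symm_apply_apply _)
    refine ⟨g s, fun i => σ (p i) %ₘ q, hs, ?_, fun i => ?_, hgP⟩
    · intro h0
      obtain ⟨i, hi⟩ := Function.ne_iff.1 hx
      have h1 := hgP i
      have h2 : σ (p i) %ₘ q = 0 := congrFun h0 i
      rw [h2, map_zero] at h1
      exact mul_ne_zero hs hi h1.symm
    · have := Polynomial.natDegree_modByMonic_lt (σ (p i)) hqm (by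
        intro h1
        rw [h1] at hq2
        simp at hq2)
      rw [hq2] at this
      exact Nat.lt_succ_iff.1 this

end Quadric

section BaseChange

variable {F K : Type} [Field F] [Field K]

lemma quadVal_sub {R : Type} [CommRing R] {n : ℕ} (A B : Fin n → Fin n → R) (x : Fin n → R) :
    quadVal (fun i j => A i j - B i j) x = quadVal A x - quadVal B x := by
  simp only [quadVal, sub_mul, Finset.sum_sub_distrib]

lemma quadVal_smul_left {R : Type} [CommRing R] {n : ℕ} (a : R) (A : Fin n → Fin n → R)
    (x : Fin n → R) : quadVal (fun i j => a * A i j) x = a * quadVal A x := by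
  simp only [quadVal, Finset.mul_sum, mul_assoc]

lemma quadVal_alternating {R : Type} [CommRing R] {n : ℕ} {D : Fin n → Fin n → R}
    (h0 : ∀ i, D i i = 0) (h1 : ∀ i j, i ≠ j → D i j + D j i = 0) (x : Fin n → R) :
    quadVal D x = 0 := by
  rw [quadVal, ← Finset.sum_product']
  refine Finset.sum_involution (fun a _ => (a.2, a.1)) ?_ ?_ (fun _ _ => by simp)
    (fun _ _ => rfl)
  · rintro ⟨i, j⟩ -
    by_cases hij : i = j
    · subst hij; simp [h0]
    · have := h1 i j hij
      linear_combination x i * x j * this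
  · rintro ⟨i, j⟩ - h h'
    have hij : j = i := congrArg Prod.fst h'
    subst hij
    simp [h0] at h

lemma quadVal_single {R : Type} [CommRing R] {n : ℕ} (A : Fin n → Fin n → R) (i : Fin n) :
    quadVal A (Pi.single i 1) = A i i := by
  simp [quadVal, Pi.single_apply]

lemma quadVal_single_add {R : Type} [CommRing R] {n : ℕ} (A : Fin n → Fin n → R) (i j : Fin n) :
    quadVal A (Pi.single i 1 + Pi.single j 1) = A i i + A j j + (A i j + A j i) := by
  simp [quadVal, Pi.single_apply, mul_add, Finset.sum_add_distrib]
  ring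

/-- Equality of quadratic forms persists under scalar extension. -/
lemma quadVal_ext (f : F →+* K) {n : ℕ} {A B : Fin n → Fin n → F}
    (h : ∀ x, quadVal A x = quadVal B x) (ξ : Fin n → K) :
    quadVal (fun i j => f (A i j)) ξ = quadVal (fun i j => f (B i j)) ξ := by
  rw [← sub_eq_zero, ← quadVal_sub]
  have h0 : ∀ i, A i i = B i i := fun i => by
    simpa only [quadVal_single] using h (Pi.single i 1)
  refine quadVal_alternating (fun i => by rw [h0, sub_self]) (fun i j _ => ?_) ξ
  have h1 := h (Pi.single i 1 + Pi.single j 1)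
  rw [quadVal_single_add, quadVal_single_add, h0 i, h0 j] at h1
  have h2 := congrArg f (add_left_cancel h1)
  rw [map_add, map_add] at h2
  linear_combination h2

/-- Scalar extension of a linear map between coordinate spaces. -/
def extLin (f : F →+* K) {n N : ℕ} (T : (Fin n → F) →ₗ[F] (Fin N → F)) (ξ : Fin n → K) :
    Fin N → K := fun i => ∑ l, f (T (Pi.single l 1) i) * ξ l

lemma linear_eq_sum {n : ℕ} {V : Type} [AddCommGroup V] [Module F V]
    (T : (Fin n → F) →ₗ[F] V) (x : Fin n → F) :
    T x = ∑ l, x l • T (Pi.single l 1) := by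
  conv_lhs => rw [← (Pi.basisFun F (Fin n)).sum_repr x]
  simp [map_sum]

lemma quadVal_comp {R : Type} [CommRing R] {n N : ℕ} (c : Fin N → Fin N → R)
    (M : Fin N → Fin n → R) (ξ : Fin n → R) :
    quadVal c (fun i => ∑ l, M i l * ξ l) =
      quadVal (fun l l' => ∑ i, ∑ j, c i j * (M i l * M j l')) ξ := by
  simp only [quadVal, Finset.mul_sum, Finset.sum_mul]
  have h1 : ∀ g : Fin N → Fin N → Fin n → Fin n → R,
      ∑ i, ∑ j, ∑ l, ∑ l', g i j l l' = ∑ l, ∑ l', ∑ i, ∑ j, g i j l l' := by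
    intro g
    rw [Finset.sum_congr rfl fun i _ => Finset.sum_comm, Finset.sum_comm]
    refine Finset.sum_congr rfl fun l _ => ?_
    rw [Finset.sum_congr rfl fun i _ => Finset.sum_comm, Finset.sum_comm]
  rw [h1, Finset.sum_comm]
  refine Finset.sum_congr rfl fun l _ => Finset.sum_congr rfl fun l' _ =>
    Finset.sum_congr rfl fun i _ => Finset.sum_congr rfl fun j _ => ?_
  ring

lemma quadVal_extLin (f : F →+* K) {n N : ℕ} {T : (Fin n → F) →ₗ[F] (Fin N → F)} {α : F}
    {c : Fin n → Fin n → F} {c' : Fin N → Fin N → F}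
    (h : ∀ x, α * quadVal c x = quadVal c' (T x)) (ξ : Fin n → K) :
    f α * quadVal (fun i j => f (c i j)) ξ = quadVal (fun i j => f (c' i j)) (extLin f T ξ) := by
  have hT : ∀ x, T x = fun i => ∑ l, T (Pi.single l 1) i * x l := fun x => by
    rw [linear_eq_sum T x]
    funext i
    simp [Finset.sum_apply, mul_comm]
  have h1 : ∀ x, quadVal (fun i j => α * c i j) x =
      quadVal (fun l l' => ∑ i, ∑ j, c' i j * (T (Pi.single l 1) i * T (Pi.single l' 1) j)) x := by
    intro x
    rw [quadVal_smul_left, h, hT x]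
    exact quadVal_comp c' (fun i l => T (Pi.single l 1) i) x
  have h2 := quadVal_ext f h1 ξ
  simp only [map_mul, map_sum] at h2
  rw [quadVal_smul_left] at h2
  rw [h2]
  exact (quadVal_comp (fun i j => f (c' i j)) (fun i l => f (T (Pi.single l 1) i)) ξ).symm

lemma extLin_ne_zero (f : F →+* K) {n N : ℕ} {T : (Fin n → F) →ₗ[F] (Fin N → F)}
    (hT : Function.Injective T) {ξ : Fin n → K} (hξ : ξ ≠ 0) : extLin f T ξ ≠ 0 := by
  obtain ⟨S, hS⟩ := T.exists_leftInverse_of_injective (LinearMap.ker_eq_bot.2 hT)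
  intro h0
  apply hξ
  funext l
  have h1 : ∀ l', ∑ i, f (S (Pi.single i 1) l) * f (T (Pi.single l' 1) i) =
      if l = l' then 1 else 0 := by
    intro l'
    have h2 := LinearMap.congr_fun hS (Pi.single l' 1)
    rw [LinearMap.comp_apply, linear_eq_sum S] at h2
    have h3 := congrFun h2 l
    simp only [Finset.sum_apply, Pi.smul_apply, smul_eq_mul, LinearMap.id_apply,
      Pi.single_apply] at h3
    have h4 := congrArg f h3
    rw [map_sum] at h4
    simp only [map_mul] at h4
    rw [Finset.sum_congr rfl fun i _ => mul_comm _ _, h4]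
    split_ifs <;> simp
  have h2 : ∑ i, f (S (Pi.single i 1) l) * extLin f T ξ i = ξ l := by
    simp only [extLin, Finset.mul_sum, ← mul_assoc]
    rw [Finset.sum_comm]
    simp only [← Finset.sum_mul, h1]
    simp
  rw [← h2, h0]
  simp

lemma isotropic_extLin (f : F →+* K) {n N : ℕ} {T : (Fin n → F) →ₗ[F] (Fin N → F)} {α : F}
    {c : Fin n → Fin n → F} {c' : Fin N → Fin N → F} (hT : Function.Injective T)
    (h : ∀ x, α * quadVal c x = quadVal c' (T x))
    (hi : ∃ ξ : Fin n → K, ξ ≠ 0 ∧ quadVal (fun i j => f (c i j)) ξ = 0) :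
    ∃ ξ : Fin N → K, ξ ≠ 0 ∧ quadVal (fun i j => f (c' i j)) ξ = 0 := by
  obtain ⟨ξ, h1, h2⟩ := hi
  exact ⟨_, extLin_ne_zero f hT h1, by rw [← quadVal_extLin f h, h2, mul_zero]⟩

lemma bq_sum_smul [CharP K 2] {ι : Type} [Fintype ι] (d : ι → K × K) :
    ∀ {n : ℕ} (v : Fin n → ι → Fin 2 → K) (c : Fin n → Fin n → K),
      (∀ i, bq d (v i) = c i i) → (∀ i j, i ≠ j → bb (v i) (v j) = c i j + c j i) →
      ∀ x : Fin n → K, bq d (∑ i, x i • v i) = quadVal c x := by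
  intro n
  induction n with
  | zero => intro v c _ _ x; simp [quadVal]
  | succ n ih =>
    intro v c h1 h2 x
    rw [Fin.sum_univ_succ, bq_add, bq_smul, h1, ih (fun i => v i.succ)
      (fun i j => c i.succ j.succ) (fun i => h1 i.succ)
      (fun i j hij => h2 _ _ fun h => hij (Fin.succ_injective _ h)) fun i => x i.succ]
    have h3 : bb (x 0 • v 0) (∑ i : Fin n, x i.succ • v i.succ) =
        ∑ i : Fin n, x 0 * x i.succ * (c 0 i.succ + c i.succ 0) := by
      rw [← bbL_apply, map_sum]
      refine Finset.sum_congr rfl fun i _ => ?_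
      rw [bbL_apply, bb_smul_left, bb_smul_right, h2 0 i.succ (Fin.succ_ne_zero i).symm]
      ring
    rw [h3]
    simp only [quadVal, Fin.sum_univ_succ, Finset.sum_add_distrib, mul_add]
    simp only [← Finset.sum_add_distrib]
    have h4 : ∑ i : Fin n, (x 0 * x i.succ * c 0 i.succ + x 0 * x i.succ * c i.succ 0) =
      ∑ i : Fin n, (c 0 i.succ * (x 0 * x i.succ) + c i.succ 0 * (x i.succ * x 0)) :=
      Finset.sum_congr rfl fun i _ => by ring
    rw [h4]
    simp only [Finset.sum_add_distrib]
    ring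

end BaseChange

section Transfer

variable {F K E : Type} [Field F] [Field K] [Field E]

/-- The coefficient matrix of `[p,q] ⊥ ⟨1,a,b⟩`. -/
def phiC {R : Type} [CommRing R] (p q a b : R) : Fin 5 → Fin 5 → R :=
  ![![p, 1, 0, 0, 0], ![0, q, 0, 0, 0], ![0, 0, 1, 0, 0], ![0, 0, 0, a, 0], ![0, 0, 0, 0, b]]

/-- The coefficient matrix of `[r,t] ⊥ ⟨1,a⟩`. -/
def psiC {R : Type} [CommRing R] (r t a : R) : Fin 4 → Fin 4 → R :=
  ![![r, 1, 0, 0], ![0, t, 0, 0], ![0, 0, 1, 0], ![0, 0, 0, a]]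

lemma quadVal_phiC {R : Type} [CommRing R] (p q a b : R) (x : Fin 5 → R) :
    quadVal (phiC p q a b) x = p * x 0 ^ 2 + x 0 * x 1 + q * x 1 ^ 2 +
      (x 2 ^ 2 + a * x 3 ^ 2 + b * x 4 ^ 2) := by
  simp [quadVal, phiC, Fin.sum_univ_succ]
  ring!

lemma quadVal_psiC {R : Type} [CommRing R] (r t a : R) (x : Fin 4 → R) :
    quadVal (psiC r t a) x = r * x 0 ^ 2 + x 0 * x 1 + t * x 1 ^ 2 +
      (x 2 ^ 2 + a * x 3 ^ 2) := by
  simp [quadVal, psiC, Fin.sum_univ_succ]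
  ring!

lemma map_phiC {R S : Type} [CommRing R] [CommRing S] (f : R →+* S) (p q a b : R) :
    (fun i j => f (phiC p q a b i j)) = phiC (f p) (f q) (f a) (f b) := by
  funext i j
  fin_cases i <;> fin_cases j <;> simp [phiC]

lemma map_psiC {R S : Type} [CommRing R] [CommRing S] (f : R →+* S) (r t a : R) :
    (fun i j => f (psiC r t a i j)) = psiC (f r) (f t) (f a) := by
  funext i j
  fin_cases i <;> fin_cases j <;> simp [psiC]

lemma map_quadVal {R S : Type} [CommRing R] [CommRing S] (f : R →+* S) {n : ℕ}
    (c : Fin n → Fin n → R) (x : Fin n → R) :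
    f (quadVal c x) = quadVal (fun i j => f (c i j)) (fun i => f (x i)) := by
  simp [quadVal]

lemma quadVal_smul {R : Type} [CommRing R] {n : ℕ} (c : Fin n → Fin n → R) (l : R)
    (x : Fin n → R) : quadVal c (fun i => l * x i) = l ^ 2 * quadVal c x := by
  simp only [quadVal, Finset.mul_sum]
  refine Finset.sum_congr rfl fun i _ => Finset.sum_congr rfl fun j _ => ?_
  ring

lemma quadSucc_map (h : F →+* E) {n : ℕ} (c : Fin (n + 1) → Fin (n + 1) → F) :
    (quadSucc c).map (MvPolynomial.map h) = quadSucc (fun i j => h (c i j)) := by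
  simp [quadSucc, quadLin, quadConst, Polynomial.map_sum]

lemma isRound_map_P2D {y a : E} (ha : a ≠ 0) (L : Type) [Field L] [CharP L 2]
    (f : E →+* L) : IsRound (mapD f (P2D y a)) := by
  have : mapD f (P2D y a) = P2D (f y) (f a) := by
    funext i
    rcases i with i | i <;> simp [mapD, P2D, P1D, dbl, scD]
  rw [this]
  exact isRound_P2D ((map_ne_zero f).2 ha)

lemma mapD_P3D {R L : Type} [Field R] [Field L] (f : R →+* L) (y a b : R) :
    mapD f (P3D y a b) = P3D (f y) (f a) (f b) := by
  funext i
  rcases i with (i | i) | (i | i) <;> simp [mapD, P3D, P2D, P1D, dbl, scD]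

lemma isRound_map_P3D {y a b : E} (ha : a ≠ 0) (hb : b ≠ 0) (L : Type) [Field L]
    [CharP L 2] (f : E →+* L) : IsRound (mapD f (P3D y a b)) := by
  rw [mapD_P3D]
  exact isRound_P3D ((map_ne_zero f).2 ha) ((map_ne_zero f).2 hb)

variable [CharP F 2] [CharP E 2]

/-- Turn the vectors produced by the subform theorem into an additive map. -/
lemma exists_additive {ι : Type} [Fintype ι] {d : ι → E × E} {n : ℕ} (h : F →+* E)
    {c : Fin (n + 1) → Fin (n + 1) → F} (hc : c 0 0 ≠ 0) (v : Fin (n + 1) → ι → Fin 2 → E)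
    (h1 : ∀ i, h (c 0 0) * bq d (v i) = h (c i i))
    (h2 : ∀ i j, i ≠ j → h (c 0 0) * bb (v i) (v j) = h (c i j) + h (c j i)) :
    ∃ G : (Fin (n + 1) → F) → ι → Fin 2 → E, (∀ x y, G (x + y) = G x + G y) ∧
      ∀ x, h (c 0 0) * bq d (G x) = h (quadVal c x) := by
  have hc' : h (c 0 0) ≠ 0 := (map_ne_zero h).2 hc
  refine ⟨fun x => ∑ i, h (x i) • v i, fun x y => ?_, fun x => ?_⟩
  · simp only [Pi.add_apply, map_add, add_smul, Finset.sum_add_distrib]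
  · rw [bq_sum_smul d v (fun i j => (h (c 0 0))⁻¹ * h (c i j)), quadVal_smul_left, ← mul_assoc,
      mul_inv_cancel₀ hc', one_mul, map_quadVal]
    · intro i
      rw [← h1 i, ← mul_assoc, inv_mul_cancel₀ hc', one_mul]
    · intro i j hij
      rw [← mul_add, ← h2 i j hij, ← mul_assoc, inv_mul_cancel₀ hc', one_mul]

/-- If `[p,q] ⊥ ⟨1,a,b⟩` becomes isotropic over the function field of `c`, and `E` contains square
roots of `a` and `b`, then `c` is similar over `E` to a subform of `⟨1,p⟩ ⊗ [1,pq]`,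
provided the latter is anisotropic. -/
lemma QuadricField.exists_transfer {n : ℕ} {c : Fin (n + 1) → Fin (n + 1) → F}
    {g : MvPolynomial (Fin (n + 1)) F →+* K} (hg : QuadricField c g) (hc : c 0 0 ≠ 0)
    {p q a b : F} (hp : p ≠ 0)
    (hani : ∀ u v w : F, u ^ 2 + a * v ^ 2 + b * w ^ 2 = 0 → u = 0 ∧ v = 0 ∧ w = 0)
    {x : Fin 5 → K} (hx : x ≠ 0)
    (hx0 : quadVal (fun i j => g (C (phiC p q a b i j))) x = 0)
    (h : F →+* E) {sa sb : E} (hsa : sa ^ 2 = h a) (hsb : sb ^ 2 = h b)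
    (hd : BAniso (P2D (h p * h q) (h p))) :
    ∃ G : (Fin (n + 1) → F) → Unit ⊕ Unit → Fin 2 → E, (∀ x y, G (x + y) = G x + G y) ∧
      ∀ x, h (c 0 0) * bq (P2D (h p * h q) (h p)) (G x) = h (quadVal c x) := by
  obtain ⟨g', hg1, hg2, hg3⟩ := hg.lift hc
  obtain ⟨l, P, hl, hP, hdeg, hgP⟩ := hg3 (Fin 5) x hx
  have hhp : h p ≠ 0 := (map_ne_zero h).2 hp
  have hdvd : quadSucc c ∣
      quadVal (fun i j => Polynomial.C (MvPolynomial.C (phiC p q a b i j))) P := by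
    rw [← hg1, map_quadVal]
    simp only [hg2, hgP]
    rw [quadVal_smul, hx0, mul_zero]
  let H : Polynomial (MvPolynomial (Fin n) F) →+* Polynomial (MvPolynomial (Fin n) E) :=
    Polynomial.mapRingHom (MvPolynomial.map h)
  have hHinj : Function.Injective H :=
    Polynomial.map_injective _ (MvPolynomial.map_injective _ h.injective)
  have hHC : ∀ u, H (Polynomial.C (MvPolynomial.C u)) = Polynomial.C (MvPolynomial.C (h u)) :=
    fun u => by simp [H]
  let s1 : Polynomial (MvPolynomial (Fin n) E) := Polynomial.C (MvPolynomial.C sa)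
  let s2 : Polynomial (MvPolynomial (Fin n) E) := Polynomial.C (MvPolynomial.C sb)
  have hs1 : s1 ^ 2 = Polynomial.C (MvPolynomial.C (h a)) := by
    rw [← hsa]; simp [s1]
  have hs2 : s2 ^ 2 = Polynomial.C (MvPolynomial.C (h b)) := by
    rw [← hsb]; simp [s2]
  let V : Unit ⊕ Unit → Fin 2 → Polynomial (MvPolynomial (Fin n) E) :=
    Sum.elim (fun _ => ![H (P 2) + s1 * H (P 3) + s2 * H (P 4), 0])
      (fun _ => ![H (P 0), H (P 1)])
  have hdH : ∀ i, (H (P i)).natDegree ≤ 1 := fun i => Polynomial.natDegree_map_le.trans (hdeg i)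
  have hV : V ≠ 0 := by
    intro hV
    apply hP
    have e0 : P 0 = 0 := (map_eq_zero_iff H hHinj).1 (congrFun (congrFun hV (Sum.inr ())) 0)
    have e1 : P 1 = 0 := (map_eq_zero_iff H hHinj).1 (congrFun (congrFun hV (Sum.inr ())) 1)
    have e2 : H (P 2) + s1 * H (P 3) + s2 * H (P 4) = 0 :=
      congrFun (congrFun hV (Sum.inl ())) 0
    have e3 : ∀ i m, ((P 2).coeff i).coeff m = 0 ∧ ((P 3).coeff i).coeff m = 0 ∧
        ((P 4).coeff i).coeff m = 0 := by
      intro i m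
      have e4 : h (((P 2).coeff i).coeff m) + sa * h (((P 3).coeff i).coeff m) +
          sb * h (((P 4).coeff i).coeff m) = 0 := by
        have := congrArg (fun z => (z.coeff i).coeff m) e2
        simpa [H, s1, s2, Polynomial.coeff_map, MvPolynomial.coeff_map] using this
      apply hani
      apply h.injective
      have e5 := congrArg (fun z => z ^ 2) e4
      simp only [CharTwo.add_sq, mul_pow, hsa, hsb] at e5
      simpa using e5
    have e6 : ∀ i, P i = 0 := by
      intro i
      fin_cases i
      · exact e0
      · exact e1
      · ext i m; simpa using (e3 i m).1
      · ext i m; simpa using (e3 i m).2.1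
      · ext i m; simpa using (e3 i m).2.2
    exact funext e6
  have hVdeg : ∀ i t, (V i t).natDegree ≤ 1 := by
    have hs : ∀ (u : E) i, (Polynomial.C (MvPolynomial.C u) * H (P i)).natDegree ≤ 1 :=
      fun u i => (Polynomial.natDegree_C_mul_le _ _).trans (hdH i)
    intro i t
    rcases i with i | i <;> fin_cases t
    · exact (Polynomial.natDegree_add_le_of_degree_le
        (Polynomial.natDegree_add_le_of_degree_le (hdH 2) (hs sa 3)) (hs sb 4))
    · simp [V]
    · exact hdH 0
    · exact hdH 1
  have hdvd' : quadSucc (fun i j => h (c i j)) ∣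
      bq (mapD Polynomial.C (mapD MvPolynomial.C (P2D (h p * h q) (h p)))) V := by
    have h1 := map_dvd H hdvd
    have h2 : H (quadSucc c) = quadSucc fun i j => h (c i j) := quadSucc_map h c
    rw [h2] at h1
    convert h1 using 1
    have h3 : (fun i j => H (Polynomial.C (MvPolynomial.C (phiC p q a b i j)))) =
        phiC (Polynomial.C (MvPolynomial.C (h p))) (Polynomial.C (MvPolynomial.C (h q)))
          (s1 ^ 2) (s2 ^ 2) := by
      rw [hs1, hs2, ← hHC, ← hHC, ← hHC, ← hHC]
      exact map_phiC (H.comp (Polynomial.C.comp MvPolynomial.C)) p q a b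
    rw [map_quadVal, h3, quadVal_phiC]
    have h4 : h p * h q / h p = h q := by field_simp
    simp [bq, mapD, P2D, P1D, dbl, scD, V, h4]
    linear_combination (s1 * H (P 2) * H (P 3) + s2 * H (P 2) * H (P 4) +
      s1 * s2 * H (P 3) * H (P 4)) *
      (CharTwo.two_eq_zero : (2 : Polynomial (MvPolynomial (Fin n) E)) = 0)
  obtain ⟨v, h1, h2⟩ := hd.subform (fun L _ _ f => isRound_map_P2D hhp L f)
    (c := fun i j => h (c i j)) ((map_ne_zero h).2 hc) hV hVdeg hdvd'
  exact exists_additive h hc v h1 h2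

end Transfer

section Core

variable {F K E : Type} [Field F] [Field K] [Field E] [CharP E 2]

/-- A vector orthogonal to a hyperbolic pair and to a vector of norm `1` in a form with two blocks
determines the class up to one parameter. -/
lemma cl_eq_of_frame {κ : Type} [Fintype κ] (hκ : Fintype.card κ = 2) {d : κ → E × E}
    {e f w0 : κ → Fin 2 → E} {r t : E} (he : bq d e = r) (hf : bq d f = t) (hef : bb e f = 1)
    (hw : bq d w0 = 1) (hew : bb e w0 = 0) (hfw : bb f w0 = 0) :
    ∃ z, cl d = w r t + w 1 z ∧
      ∀ w1, bb e w1 = 0 → bb f w1 = 0 → bb w0 w1 = 0 → ∃ l : E, w1 = l • w0 := by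
  obtain ⟨u0, hu0⟩ : ∃ u, bb w0 u = 1 := by
    by_contra! hcon
    have hz : w0 = 0 := eq_zero_of_bb _ fun y => by
      by_contra hy
      apply hcon ((bb w0 y)⁻¹ • y)
      rw [bb_smul_right, inv_mul_cancel₀ hy]
    rw [hz, bq_zero] at hw
    exact zero_ne_one hw
  have hfe : bb f e = 1 := by rw [bb_comm, hef]
  have h2 : ∀ z : E, z + z = 0 := CharTwo.add_self_eq_zero
  obtain ⟨u, hu1, hu2, hu3⟩ : ∃ u, bb e u = 0 ∧ bb f u = 0 ∧ bb w0 u = 1 :=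
    ⟨u0 + bb f u0 • e + bb e u0 • f, by simp [bb_add_right, bb_smul_right, hef, h2],
      by simp [bb_add_right, bb_smul_right, hfe, h2],
      by simp [bb_add_right, bb_smul_right, bb_comm w0 e, bb_comm w0 f, hew, hfw, hu0]⟩
  let T : (Fin 2 → Fin 2 → E) →ₗ[E] (κ → Fin 2 → E) :=
    { toFun := fun x => x 0 0 • e + x 0 1 • f + (x 1 0 • w0 + x 1 1 • u)
      map_add' := fun x y => by simp only [Pi.add_apply, add_smul]; abel
      map_smul' := fun c x => by
        simp only [Pi.smul_apply, smul_eq_mul, mul_smul, smul_add, RingHom.id_apply] }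
  have hTa : ∀ x, T x = x 0 0 • e + x 0 1 • f + (x 1 0 • w0 + x 1 1 • u) := fun _ => rfl
  have hT : ∀ x, bq d (T x) = bq (![(r, t), (1, bq d u)] : Fin 2 → E × E) x := by
    intro x
    rw [hTa]
    simp only [bq_add, bq_smul, bb_add_left, bb_add_right, bb_smul_left, bb_smul_right, he, hf, hef,
      hw, hew, hfw, hu1, hu2, hu3]
    simp [bq]
    ring
  have hcl : cl (![(r, t), (1, bq d u)] : Fin 2 → E × E) = w r t + w 1 (bq d u) := by
    simp [cl, Fin.sum_univ_succ]
  refine ⟨bq d u, ?_, ?_⟩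
  · rw [← hcl]
    exact (cl_eq_of_isometry (by simp [hκ]) T hT).symm
  · intro w1 h1 h2 h3
    have hinj : Function.Injective T := by
      rw [← LinearMap.ker_eq_bot, LinearMap.ker_eq_bot']
      intro x hx
      rw [hTa] at hx
      have a1 := congrArg (bb e) hx
      have a2 := congrArg (bb f) hx
      have a3 := congrArg (bb w0) hx
      have a4 := congrArg (bb u) hx
      simp only [bb_add_right, bb_smul_right, bb_self, hef, hfe, hew, hfw, bb_comm w0 e,
        bb_comm w0 f, bb_comm u e, bb_comm u f, bb_comm u w0, hu1, hu2, hu3, mul_zero, mul_one,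
        add_zero, zero_add, bb_comm _ (0 : κ → Fin 2 → E), bb_zero_left] at a1 a2 a3 a4
      funext i j
      fin_cases i <;> fin_cases j <;> assumption
    have hsurj : Function.Surjective T :=
      (LinearMap.injective_iff_surjective_of_finrank_eq_finrank (by
        rw [finrank_block, finrank_block, hκ, Fintype.card_fin])).1 hinj
    obtain ⟨x, rfl⟩ := hsurj w1
    rw [hTa] at h1 h2 h3
    simp only [bb_add_right, bb_smul_right, bb_self, hef, hfe, hew, hfw, bb_comm w0 e,
      bb_comm w0 f, hu1, hu2, hu3, mul_zero, mul_one, add_zero, zero_add] at h1 h2 h3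
    exact ⟨x 1 0, by rw [hTa, h1, h2, h3]; simp⟩

variable [CharP F 2]

/-- The class of the two-fold Pfister form provided by `QuadricField.exists_transfer` when the
quadratic form `c` has type `(1,1)` or `(1,2)`. -/
lemma QuadricField.exists_class {n : ℕ} {c : Fin (n + 1) → Fin (n + 1) → F}
    {g : MvPolynomial (Fin (n + 1)) F →+* K} (hg : QuadricField c g) (hc : c 0 0 ≠ 0)
    {p q a b : F} (hp : p ≠ 0)
    (hani : ∀ u v w : F, u ^ 2 + a * v ^ 2 + b * w ^ 2 = 0 → u = 0 ∧ v = 0 ∧ w = 0)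
    {x : Fin 5 → K} (hx : x ≠ 0)
    (hx0 : quadVal (fun i j => g (C (phiC p q a b i j))) x = 0)
    {r t a' β : F} (hβ : β ≠ 0) {T : (Fin (n + 1) → F) →ₗ[F] (Fin 4 → F)}
    (hT : ∀ x, β * quadVal c x = quadVal (psiC r t a') (T x)) {y0 y1 y2 : Fin (n + 1) → F}
    (h0 : T y0 = ![1, 0, 0, 0]) (h1 : T y1 = ![0, 1, 0, 0]) (h2 : T y2 = ![0, 0, 1, 0])
    (h : F →+* E) {sa sb : E} (hsa : sa ^ 2 = h a) (hsb : sb ^ 2 = h b)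
    (hd : BAniso (P2D (h p * h q) (h p))) :
    ∃ z, w 1 (h p * h q) + w (h p) (h q) = w (h r) (h t) + w 1 z ∧
      ((∃ y3, T y3 = ![0, 0, 0, 1]) → ∃ l : E, h a' = l ^ 2) := by
  obtain ⟨G, hG1, hG2⟩ := hg.exists_transfer hc hp hani hx hx0 h hsa hsb hd
  have hhp : h p ≠ 0 := (map_ne_zero h).2 hp
  set d := P2D (h p * h q) (h p) with hdd
  have hs : h β * h (c 0 0) ≠ 0 := mul_ne_zero ((map_ne_zero h).2 hβ) ((map_ne_zero h).2 hc)
  set s := h β * h (c 0 0) with hss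
  let G' := fun x => scEquiv s hs (G x)
  have hG1' : ∀ x y, G' (x + y) = G' x + G' y := fun x y => by simp only [G', hG1, map_add]
  have hG2' : ∀ x, bq (scD s d) (G' x) = h (quadVal (psiC r t a') (T x)) := fun x => by
    rw [bq_scEquiv, hss, mul_assoc, hG2, ← map_mul, hT]
  have hbb : ∀ x y, bb (G' x) (G' y) = h (quadVal (psiC r t a') (T x + T y)) +
      h (quadVal (psiC r t a') (T x)) + h (quadVal (psiC r t a') (T y)) := fun x y => by
    have e := bq_add (scD s d) (G' x) (G' y)
    rw [← hG1', hG2', hG2', hG2', map_add] at e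
    rw [e]
    linear_combination -(h (quadVal (psiC r t a') (T x)) + h (quadVal (psiC r t a') (T y))) *
      (CharTwo.two_eq_zero : (2 : E) = 0)
  have hcl : cl (scD s d) = cl d := by
    have e := hG2' y2
    rw [h2, quadVal_psiC, bq_scEquiv] at e
    simp at e
    have hne : G y2 ≠ 0 := by
      intro h0
      rw [h0, bq_zero, mul_zero] at e
      exact zero_ne_one e
    have e2 := isRound_P2D (y := h p * h q) hhp _ hne
    rw [← hdd] at e2
    rw [← sc_cl hs]
    conv_lhs => rw [← e2, ← sc_mul, e, sc_one]
  obtain ⟨z, hz1, hz2⟩ := cl_eq_of_frame (κ := Unit ⊕ Unit) (by simp) (d := scD s d) (e := G' y0)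
    (f := G' y1) (w0 := G' y2) (r := h r) (t := h t)
    (by rw [hG2', h0, quadVal_psiC]; simp) (by rw [hG2', h1, quadVal_psiC]; simp)
    (by rw [hbb, h0, h1]; simp only [quadVal_psiC]; simp; grind)
    (by rw [hG2', h2, quadVal_psiC]; simp)
    (by rw [hbb, h0, h2]; simp only [quadVal_psiC]; simp; grind)
    (by rw [hbb, h1, h2]; simp only [quadVal_psiC]; simp; grind)
  refine ⟨z, ?_, ?_⟩
  · rw [← hz1, hcl, hdd, cl_P2D hhp, P2, sc_nn, mul_div_cancel_left₀ _ hhp, nn]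
  · rintro ⟨y3, h3⟩
    obtain ⟨l, hl⟩ := hz2 (G' y3)
      (by rw [hbb, h0, h3]; simp only [quadVal_psiC]; simp; grind)
      (by rw [hbb, h1, h3]; simp only [quadVal_psiC]; simp; grind)
      (by rw [hbb, h2, h3]; simp only [quadVal_psiC]; simp; grind)
    refine ⟨l, ?_⟩
    have e1 := hG2' y3
    rw [hl, bq_smul, hG2', h2, h3] at e1
    simp only [quadVal_psiC] at e1
    simp at e1
    exact e1.symm

end Core

section CoreClass

variable {F K : Type} [Field F] [Field K] [CharP F 2]

lemma Insep.exists_sq_add {L : Type} [Field L] [CharP L 2] {f : F →+* L} {d : F} (h : Insep f d)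
    (z : L) : ∃ x y, z ^ 2 = f (x ^ 2 + d * y ^ 2) := by
  obtain ⟨s, hs, hz⟩ := h.root
  obtain ⟨x, y, rfl⟩ := hz z
  exact ⟨x, y, by rw [CharTwo.add_sq, mul_pow, hs]; simp⟩

lemma diag_of_aniso {p q a b : F}
    (hani : ∀ x, quadVal (phiC p q a b) x = 0 → x = 0) (u v w : F)
    (h : u ^ 2 + a * v ^ 2 + b * w ^ 2 = 0) : u = 0 ∧ v = 0 ∧ w = 0 := by
  have h1 := hani ![0, 0, u, v, w] (by rw [quadVal_phiC]; simpa using h)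
  exact ⟨congrFun h1 2, congrFun h1 3, congrFun h1 4⟩

lemma QuadricField.exists_completion {n : ℕ} {c : Fin (n + 1) → Fin (n + 1) → F}
    {g : MvPolynomial (Fin (n + 1)) F →+* K} (hg : QuadricField c g) (hc : c 0 0 ≠ 0)
    {p q a b : F} (hani : ∀ x, quadVal (phiC p q a b) x = 0 → x = 0)
    (hpn : ∀ γ i s s' d1 d2 d3, γ ≠ 0 → s ≠ 0 → s' ≠ 0 →
      w p q + w 1 d1 + w a d2 + w b d3 ≠ sc γ (P3 i s s'))
    (hi : ∃ x : Fin 5 → K, x ≠ 0 ∧ quadVal (fun i j => g (C (phiC p q a b i j))) x = 0)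
    {r t a' β : F} (hβ : β ≠ 0) {T : (Fin (n + 1) → F) →ₗ[F] (Fin 4 → F)}
    (hT : ∀ x, β * quadVal c x = quadVal (psiC r t a') (T x)) {y0 y1 y2 : Fin (n + 1) → F}
    (h0 : T y0 = ![1, 0, 0, 0]) (h1 : T y1 = ![0, 1, 0, 0]) (h2 : T y2 = ![0, 0, 1, 0]) :
    (∃ γ i s s' d1 d2 d3, γ ≠ 0 ∧ s ≠ 0 ∧ s' ≠ 0 ∧
      w p q + w r t + w 1 d1 + w a d2 + w b d3 = sc γ (P3 i s s')) ∧
    ((∃ y3, T y3 = ![0, 0, 0, 1]) →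
      ∃ x y z w : F, a' = x ^ 2 + a * y ^ 2 + b * z ^ 2 + a * b * w ^ 2) := by
  obtain ⟨x, hx, hx0⟩ := hi
  have hdiag := diag_of_aniso hani
  have h2' : ∀ z : F, z + z = 0 := CharTwo.add_self_eq_zero
  have hp : p ≠ 0 := by
    rintro rfl
    have h1 := hani ![1, 0, 0, 0, 0] (by rw [quadVal_phiC]; simp)
    exact one_ne_zero (congrFun h1 0)
  obtain ⟨L, _, _, f, hf⟩ := exists_insep (d := a) (fun x hx => by
    have := (hdiag x 1 0 (by rw [hx]; simp [h2'])).2.1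
    exact one_ne_zero this)
  obtain ⟨E, _, _, g2, hg2⟩ := exists_insep (d := f b) (fun z hz => by
    obtain ⟨x, y, hxy⟩ := hf.exists_sq_add z
    have hb : b = x ^ 2 + a * y ^ 2 := f.injective (by rw [← hz, hxy])
    have := (hdiag x y 1 (by rw [← hb]; simp [h2'])).2.2
    exact one_ne_zero this)
  obtain ⟨sa, hsa, -⟩ := hf.root
  obtain ⟨sb, hsb, -⟩ := hg2.root
  let h := g2.comp f
  have hsa' : (g2 sa) ^ 2 = h a := by rw [← map_pow, hsa]; rfl
  have hd : BAniso (P2D (h p * h q) (h p)) := by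
    intro v hv
    by_contra hne
    have hhp : h p ≠ 0 := (map_ne_zero h).2 hp
    have h3 := (isRound_P2D (y := h p * h q) hhp).cl_eq_zero hne hv
    rw [cl_P2D hhp, P2, sc_nn, mul_div_cancel_left₀ _ hhp, nn] at h3
    obtain ⟨γ, i, s, s', d1, d2, d3, hγ, hs, hs', e⟩ :=
      hf.exists_completion hg2 p q 0 0 (p * q) (by
        rw [w_zero_left, add_zero, map_add, map_add, W.map_w, W.map_w, W.map_w, W.map_w, map_one,
          map_one, add_comm, map_mul, map_mul]
        exact h3)
    rw [w_zero_left, add_zero] at e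
    exact hpn γ i s s' d1 d2 d3 hγ hs hs' e
  obtain ⟨z, hz, hz'⟩ := hg.exists_class hc hp hdiag hx hx0 hβ hT h0 h1 h2 h hsa' hsb hd
  refine ⟨?_, fun h3 => ?_⟩
  · obtain ⟨z1, hz1⟩ := hg2.nn_descend z
    obtain ⟨z2, hz2⟩ := hf.nn_descend z1
    have hz3 : w 1 z = w 1 (h z2) := by
      rw [← nn, hz1, ← W.map_nn, hz2, W.map_nn, nn]; rfl
    refine hf.exists_completion hg2 p q r t (p * q + z2) ?_
    simp only [map_add, W.map_w, map_one, map_mul, w_add_right]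
    rw [hz3] at hz
    simp only [h, RingHom.comp_apply] at hz
    rw [W.eq_iff_add] at hz
    rw [← hz]
    abel
  · obtain ⟨l, hl⟩ := hz' h3
    obtain ⟨u, v, huv⟩ := hg2.exists_sq_add l
    obtain ⟨x, y, hxy⟩ := hf.exists_sq_add u
    obtain ⟨z, w, hzw⟩ := hf.exists_sq_add v
    refine ⟨x, y, z, w, h.injective ?_⟩
    rw [hl, huv, hxy, hzw, ← map_mul, ← map_add]
    simp only [h, RingHom.comp_apply]
    congr 2
    ring

end CoreClass

section BasisChange

variable {F : Type} [Field F] [CharP F 2]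

lemma exists_basis_change {a b a' x y z w : F}
    (hani : ∀ u v w : F, u ^ 2 + a * v ^ 2 + b * w ^ 2 = 0 → u = 0 ∧ v = 0 ∧ w = 0)
    (ha' : ∀ u, u ^ 2 ≠ a') (h : a' = x ^ 2 + a * y ^ 2 + b * z ^ 2 + a * b * w ^ 2) (p q : F) :
    ∃ (t p' q' b' : F) (S : (Fin 5 → F) →ₗ[F] (Fin 5 → F)), t ≠ 0 ∧ Function.Injective S ∧
      ∀ x, t * quadVal (phiC p q a b) x = quadVal (phiC p' q' a' b') (S x) := by
  have h2 : (2 : F) = 0 := CharTwo.two_eq_zero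
  obtain ⟨s0, s1, s2, hs, hsr⟩ : ∃ s0 s1 s2 : F, (s0 ≠ 0 ∨ s1 ≠ 0 ∨ s2 ≠ 0) ∧
      w * s0 + z * s1 + y * s2 = 0 := by
    by_cases hz : z = 0
    · by_cases hw : w = 0
      · exact ⟨1, 0, 0, by simp, by rw [hw]; ring⟩
      · exact ⟨z, w, 0, by simp [hw], by linear_combination z * w * h2⟩
    · exact ⟨z, w, 0, by simp [hz], by linear_combination z * w * h2⟩
  let Q : (Fin 3 → F) → F := fun u => u 0 ^ 2 + a * u 1 ^ 2 + b * u 2 ^ 2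
  have hQ0 : ∀ u, Q u = 0 → u = 0 := fun u hu => by
    obtain ⟨e0, e1, e2⟩ := hani _ _ _ hu
    ext i; fin_cases i <;> assumption
  have hQadd : ∀ u v, Q (u + v) = Q u + Q v := fun u v => by
    simp only [Q, Pi.add_apply]
    linear_combination (u 0 * v 0 + a * u 1 * v 1 + b * u 2 * v 2) * h2
  have hQsmul : ∀ (c : F) u, Q (c • u) = c ^ 2 * Q u := fun c u => by
    simp only [Q, Pi.smul_apply, smul_eq_mul]; ring
  let s : Fin 3 → F := ![s0, s1, s2]
  let s' : Fin 3 → F := ![x * s0 + a * y * s1 + b * z * s2, x * s1 + y * s0 + b * w * s2,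
    x * s2 + z * s0 + a * w * s1]
  have hs0 : s ≠ 0 := by
    intro h0
    have e0 : s0 = 0 := congrFun h0 0
    have e1 : s1 = 0 := congrFun h0 1
    have e2 : s2 = 0 := congrFun h0 2
    simp [e0, e1, e2] at hs
  have hQs : Q s ≠ 0 := fun h0 => hs0 (hQ0 s h0)
  have hQs' : Q s' = a' * Q s := by
    have e1 : Q s' = (x * s0 + a * y * s1 + b * z * s2) ^ 2 +
      a * (x * s1 + y * s0 + b * w * s2) ^ 2 + b * (x * s2 + z * s0 + a * w * s1) ^ 2 := rfl
    have e2 : Q s = s0 ^ 2 + a * s1 ^ 2 + b * s2 ^ 2 := rfl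
    rw [e1, e2, h]
    simp only [CharTwo.add_sq, mul_pow]
    have e3 : a * b * (w ^ 2 * s0 ^ 2 + z ^ 2 * s1 ^ 2 + y ^ 2 * s2 ^ 2) = 0 := by
      have := congrArg (fun z => z ^ 2) hsr
      simp only [CharTwo.add_sq, mul_pow] at this
      rw [this]; simp
    linear_combination - e3
  have hind : LinearIndependent F ![s, s'] := by
    rw [LinearIndependent.pair_iff' hs0]
    intro c hc
    apply ha' c
    have e1 := hQsmul c s
    rw [hc, hQs'] at e1
    exact (mul_right_cancel₀ hQs e1).symm
  obtain ⟨s'', hind'⟩ := exists_linearIndependent_cons_of_lt_finrank hind (by simp)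
  let B : Module.Basis (Fin 3) F (Fin 3 → F) :=
    basisOfLinearIndependentOfCardEqFinrank hind' (by simp)
  have hBc : ∀ i, B i = (Fin.cons s'' ![s, s'] : Fin 3 → Fin 3 → F) i :=
    congrFun (coe_basisOfLinearIndependentOfCardEqFinrank hind' (by simp))
  have hB : ∀ u : Fin 3 → F, u = B.repr u 0 • s'' + B.repr u 1 • s + B.repr u 2 • s' := fun u => by
    conv_lhs => rw [← B.sum_repr u]
    rw [Fin.sum_univ_three, hBc, hBc, hBc]
    rfl
  let tail : (Fin 5 → F) →ₗ[F] (Fin 3 → F) :=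
    LinearMap.pi fun i => LinearMap.proj (i.natAdd 2)
  let co : Fin 3 → (Fin 5 → F) →ₗ[F] F := fun i =>
    (LinearMap.proj i).comp (B.equivFun.toLinearMap.comp tail)
  let S : (Fin 5 → F) →ₗ[F] (Fin 5 → F) :=
    LinearMap.pi ![LinearMap.proj 0, (Q s)⁻¹ • LinearMap.proj 1, co 1, co 2, co 0]
  have hS : ∀ v, S v = ![v 0, (Q s)⁻¹ * v 1, co 1 v, co 2 v, co 0 v] := fun v => by
    ext i; fin_cases i <;> rfl
  have htail : ∀ v, tail v = co 0 v • s'' + co 1 v • s + co 2 v • s' := fun v => hB (tail v)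
  refine ⟨(Q s)⁻¹, p * (Q s)⁻¹, q * Q s, (Q s)⁻¹ * Q s'', S, inv_ne_zero hQs, ?_, ?_⟩
  · rw [← LinearMap.ker_eq_bot, LinearMap.ker_eq_bot']
    intro v hv
    rw [hS] at hv
    have e0 : v 0 = 0 := congrFun hv 0
    have e1 : (Q s)⁻¹ * v 1 = 0 := congrFun hv 1
    have e2 : co 1 v = 0 := congrFun hv 2
    have e3 : co 2 v = 0 := congrFun hv 3
    have e4 : co 0 v = 0 := congrFun hv 4
    have e5 := htail v
    rw [e2, e3, e4] at e5
    simp only [zero_smul, add_zero] at e5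
    ext i
    fin_cases i
    · exact e0
    · exact (mul_eq_zero.1 e1).resolve_left (inv_ne_zero hQs)
    · exact congrFun e5 0
    · exact congrFun e5 1
    · exact congrFun e5 2
  · intro v
    rw [hS, quadVal_phiC, quadVal_phiC]
    have e1 : v 2 ^ 2 + a * v 3 ^ 2 + b * v 4 ^ 2 = Q (tail v) := rfl
    rw [e1, htail, hQadd, hQadd, hQsmul, hQsmul, hQsmul, hQs']
    simp
    field_simp
    ring

end BasisChange

section Extract

variable {k : Type} [Field k] [CharP k 2] {ι : Type} [Fintype ι]

lemma exists_extract_isotropic (d : ι → k × k) {u : ι → Fin 2 → k} (hu : u ≠ 0)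
    (hu0 : bq d u = 0) :
    ∃ (r : ℕ) (d' : Fin r → k × k) (L : (ι → Fin 2 → k) →ₗ[k] (Fin r → Fin 2 → k)),
      r + 1 = Fintype.card ι ∧ cl d = cl d' ∧
      ∀ x, bb u x = 0 → bq d x = bq d' (L x) ∧ (L x = 0 → ∃ l : k, x = l • u) := by
  obtain ⟨c, r, d', e, hr, heu, he1, heq, hcl⟩ := exists_extract d hu
  refine ⟨r, d', (LinearMap.snd k _ _).comp e.toLinearMap, hr, ?_, fun x hx => ⟨?_, fun h0 => ?_⟩⟩
  · rw [hcl, hu0, w_zero_left, zero_add]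
  · rw [heq x, hu0, he1, hx]
    simp
  · refine ⟨(e x).1 0, e.injective ?_⟩
    rw [map_smul, heu]
    ext i j
    · fin_cases i
      · simp
      · simpa [hx] using he1 x
    · have : (e x).2 = 0 := h0
      simp [this]

lemma exists_extract_two (d : ι → k × k) {u v : ι → Fin 2 → k} (hu : u ≠ 0)
    (hu0 : bq d u = 0) (hv0 : bq d v = 0) (huv : bb u v = 0) (hind : ∀ l : k, v ≠ l • u) :
    ∃ (r : ℕ) (d' : Fin r → k × k), r + 2 = Fintype.card ι ∧ cl d = cl d' := by
  obtain ⟨r, d', L, hr, hcl, hL⟩ := exists_extract_isotropic d hu hu0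
  obtain ⟨h1, h2⟩ := hL v huv
  have hLv : L v ≠ 0 := fun h0 => by
    obtain ⟨l, hl⟩ := h2 h0
    exact hind l hl
  obtain ⟨r', d'', -, hr', hcl', -⟩ := exists_extract_isotropic d' hLv (by rw [← h1, hv0])
  refine ⟨r', d'', ?_, by rw [hcl, hcl']⟩
  simp at hr'
  omega

lemma exists_hyperbolic_embedding : ∀ (m : ℕ) {ι : Type} [Fintype ι] (d : ι → k × k),
    cl d = 0 → m ≤ Fintype.card ι →
    ∃ Φ : ((Fin m → k) × (Fin m → k)) →ₗ[k] (ι → Fin 2 → k),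
      ∀ x, bq d (Φ x) = ∑ i, x.1 i * x.2 i := by
  intro m
  induction m with
  | zero => intro ι _ d _ _; exact ⟨0, fun x => by simp [bq_zero]⟩
  | succ m ih =>
    intro ι _ d h0 hm
    obtain ⟨u, -, hu, hu0⟩ := exists_isotropic_of_cl_eq_zero h0 ⊤ (by
      rw [finrank_top, finrank_block]; omega)
    obtain ⟨c, r, d', e, hr, heu, he1, heq, hcl⟩ := exists_extract d hu
    rw [hu0, w_zero_left, zero_add] at hcl
    obtain ⟨Φ, hΦ⟩ := ih d' (hcl ▸ h0) (by simp; omega)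
    let init : (Fin (m + 1) → k) →ₗ[k] (Fin m → k) :=
      LinearMap.pi fun i => LinearMap.proj i.succ
    let A : ((Fin (m + 1) → k) × (Fin (m + 1) → k)) →ₗ[k] (Fin 2 → k) :=
      LinearMap.pi ![(LinearMap.proj 0).comp (LinearMap.fst k _ _) +
        c • (LinearMap.proj 0).comp (LinearMap.snd k _ _),
        (LinearMap.proj 0).comp (LinearMap.snd k _ _)]
    refine ⟨e.symm.toLinearMap.comp (A.prod (Φ.comp (init.prodMap init))), fun x => ?_⟩
    have h1 : A x = ![x.1 0 + c * x.2 0, x.2 0] := by ext i; fin_cases i <;> rfl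
    have h3 : e ((e.symm.toLinearMap.comp (A.prod (Φ.comp (init.prodMap init)))) x) =
        (A x, Φ (init.prodMap init x)) := e.apply_symm_apply _
    rw [heq, h3, hu0, h1]
    simp only [hΦ, Matrix.cons_val_zero, Matrix.cons_val_one]
    rw [Fin.sum_univ_succ]
    have h2 : ∑ i, (init.prodMap init x).1 i * (init.prodMap init x).2 i =
      ∑ i : Fin m, x.1 i.succ * x.2 i.succ := rfl
    rw [h2]
    linear_combination c * x.2 0 ^ 2 * (CharTwo.two_eq_zero : (2 : k) = 0)

/-- The family of a nonsingular completion of `[p,q] ⊥ [r,t] ⊥ ⟨1,a,b⟩`. -/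
def fiveD (p q r t a b d1 d2 d3 : k) : Fin 5 → k × k :=
  ![(p, q), (r, t), (1, d1), (a, d2), (b, d3)]

lemma cl_fiveD (p q r t a b d1 d2 d3 : k) :
    cl (fiveD p q r t a b d1 d2 d3) = w p q + w r t + w 1 d1 + w a d2 + w b d3 := by
  simp [cl, fiveD, Fin.sum_univ_succ, add_assoc]

/-- The inclusion of `[p,q] ⊥ ⟨1,a,b⟩` into `fiveD`. -/
def phiIncl (k : Type) [Field k] : (Fin 5 → k) →ₗ[k] (Fin 5 → Fin 2 → k) where
  toFun x := ![![x 0, x 1], 0, ![x 2, 0], ![x 3, 0], ![x 4, 0]]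
  map_add' x y := by ext i j; fin_cases i <;> fin_cases j <;> simp
  map_smul' c x := by ext i j; fin_cases i <;> fin_cases j <;> simp

/-- The inclusion of `[r,t] ⊥ ⟨1,a⟩` into `fiveD`. -/
def psiIncl (y : Fin 4 → k) : Fin 5 → Fin 2 → k :=
  ![0, ![y 0, y 1], ![y 2, 0], ![y 3, 0], 0]

lemma bq_phiIncl (p q r t a b d1 d2 d3 : k) (x : Fin 5 → k) :
    bq (fiveD p q r t a b d1 d2 d3) (phiIncl k x) = quadVal (phiC p q a b) x := by
  rw [quadVal_phiC]
  simp [bq, fiveD, phiIncl, Fin.sum_univ_succ]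
  ring!

lemma bq_psiIncl (p q r t a b d1 d2 d3 : k) (y : Fin 4 → k) :
    bq (fiveD p q r t a b d1 d2 d3) (psiIncl y) = quadVal (psiC r t a) y := by
  rw [quadVal_psiC]
  simp [bq, fiveD, psiIncl, Fin.sum_univ_succ]

lemma bb_psiIncl_phiIncl (y : Fin 4 → k) (x : Fin 5 → k) : bb (psiIncl y) (phiIncl k x) = 0 := by
  simp [bb, psiIncl, phiIncl, Fin.sum_univ_succ]

lemma phiIncl_injective : Function.Injective (phiIncl k) := by
  rw [← LinearMap.ker_eq_bot, LinearMap.ker_eq_bot']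
  intro x hx
  ext i
  fin_cases i
  · exact congrFun (congrFun hx 0) 0
  · exact congrFun (congrFun hx 0) 1
  · exact congrFun (congrFun hx 2) 0
  · exact congrFun (congrFun hx 3) 0
  · exact congrFun (congrFun hx 4) 0

lemma phiIncl_ne_smul {y : Fin 4 → k} (hy : y 0 ≠ 0) {x : Fin 5 → k} (hx : x ≠ 0) (l : k) :
    phiIncl k x ≠ l • psiIncl y := by
  intro h
  have h1 : 0 = l * y 0 := congrFun (congrFun h 1) 0
  have hl : l = 0 := (mul_eq_zero.1 h1.symm).resolve_right hy
  rw [hl, zero_smul] at h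
  exact hx ((map_eq_zero_iff _ phiIncl_injective).1 h)

lemma psiIncl_ne_zero {y : Fin 4 → k} (hy : y 0 ≠ 0) : psiIncl y ≠ 0 := fun h =>
  hy (congrFun (congrFun h 1) 0)

/-- If the completion is similar to a Pfister form and both subforms are isotropic, then the Pfister
form is isotropic. -/
lemma pfister_isotropic_of_both {p q r t a b d1 d2 d3 γ i s s' : k} (hγ : γ ≠ 0) (hs : s ≠ 0)
    (hs' : s' ≠ 0)
    (h : w p q + w r t + w 1 d1 + w a d2 + w b d3 = sc γ (P3 i s s')) {y : Fin 4 → k}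
    (hy : y 0 ≠ 0) (hy0 : quadVal (psiC r t a) y = 0) {x : Fin 5 → k} (hx : x ≠ 0)
    (hx0 : quadVal (phiC p q a b) x = 0) : ∃ v, v ≠ 0 ∧ bq (P3D i s s') v = 0 := by
  rw [← cl_fiveD, ← cl_P3D hs hs', sc_cl hγ] at h
  obtain ⟨n, d', hn, hcl⟩ := exists_extract_two (fiveD p q r t a b d1 d2 d3)
    (psiIncl_ne_zero hy) (by rw [bq_psiIncl, hy0]) (v := phiIncl k x) (by rw [bq_phiIncl, hx0])
    (bb_psiIncl_phiIncl y x) (phiIncl_ne_smul hy hx)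
  rw [h] at hcl
  simp at hn
  obtain ⟨v, hv, hv0⟩ := exists_isotropic_of_cl_eq hcl (by simp; omega)
  refine ⟨(scEquiv γ hγ).symm v, by simpa using hv, ?_⟩
  have := bq_scEquiv hγ (P3D i s s') ((scEquiv γ hγ).symm v)
  rw [LinearEquiv.apply_symm_apply, hv0] at this
  exact (mul_eq_zero.1 this.symm).resolve_left hγ

lemma phi_isotropic_of_pfister {p q r t a b d1 d2 d3 γ i s s' : k} (hs : s ≠ 0)
    (hs' : s' ≠ 0)
    (h : w p q + w r t + w 1 d1 + w a d2 + w b d3 = sc γ (P3 i s s')) {y : Fin 4 → k}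
    (hy : y 0 ≠ 0) (hy0 : quadVal (psiC r t a) y = 0)
    (hi : ∃ v, v ≠ 0 ∧ bq (P3D i s s') v = 0) :
    ∃ x, x ≠ 0 ∧ quadVal (phiC p q a b) x = 0 := by
  obtain ⟨v, hv, hv0⟩ := hi
  rw [← cl_fiveD, ← cl_P3D hs hs', (isRound_P3D hs hs').cl_eq_zero hv hv0, map_zero] at h
  obtain ⟨n, d', L, hn, hcl, hL⟩ := exists_extract_isotropic (fiveD p q r t a b d1 d2 d3)
    (psiIncl_ne_zero hy) (by rw [bq_psiIncl, hy0])
  have hinj : Function.Injective (L.comp (phiIncl k)) := by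
    rw [← LinearMap.ker_eq_bot, LinearMap.ker_eq_bot']
    intro x hx
    by_contra hne
    obtain ⟨l, hl⟩ := (hL _ (bb_psiIncl_phiIncl y x)).2 hx
    exact phiIncl_ne_smul hy hne l hl
  obtain ⟨z, ⟨x, rfl⟩, hz, hz0⟩ := exists_isotropic_of_cl_eq_zero (hcl ▸ h)
    (LinearMap.range (L.comp (phiIncl k))) (by
      rw [LinearMap.finrank_range_of_inj hinj]
      simp at hn ⊢
      omega)
  refine ⟨x, fun h0 => hz (by rw [h0, map_zero]), ?_⟩
  rw [← bq_phiIncl p q r t a b d1 d2 d3, (hL _ (bb_psiIncl_phiIncl y x)).1]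
  exact hz0

end Extract

section Domination

variable {F K : Type} [Field F] [Field K] [CharP F 2] [CharP K 2]

lemma QuadricField.exists_generic {n N : ℕ} {c : Fin n → Fin n → F}
    {g : MvPolynomial (Fin n) F →+* K} (hg : QuadricField c g) {c' : Fin N → Fin N → F} {β : F}
    {T : (Fin n → F) →ₗ[F] (Fin N → F)} (hT : ∀ x, β * quadVal c x = quadVal c' (T x))
    {y0 : Fin n → F} {j : Fin N} (h0 : T y0 j ≠ 0) :
    ∃ y : Fin N → K, y j ≠ 0 ∧ quadVal (fun i j => g (C (c' i j))) y = 0 := by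
  refine ⟨extLin (g.comp C) T fun i => g (X i), ?_, ?_⟩
  · refine hg.linear_ne_zero (fun l => T (Pi.single l 1) j) fun h => h0 ?_
    rw [linear_eq_sum T y0, Finset.sum_apply]
    refine Finset.sum_eq_zero fun l _ => ?_
    have := congrFun h l
    simp only [Pi.zero_apply] at this
    simp [this]
  · refine (quadVal_extLin (g.comp C) hT _).symm.trans ?_
    have := hg.quadVal_eq_zero
    simp only [RingHom.comp_apply]
    rw [this, mul_zero]

/-- A form isotropic over the function field of `c` because it contains `c`. -/
lemma QuadricField.isotropic_of_embedding {n : ℕ} {c : Fin (n + 1) → Fin (n + 1) → F}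
    {g : MvPolynomial (Fin (n + 1)) F →+* K} (hg : QuadricField c g) {ι : Type} [Fintype ι]
    {d : ι → F × F} {δ : F} {Φ : (Fin (n + 1) → F) →ₗ[F] (ι → Fin 2 → F)}
    (hinj : Function.Injective Φ) (hΦ : ∀ x, δ * quadVal c x = bq d (Φ x)) :
    ∃ v, v ≠ 0 ∧ bq (mapD (g.comp C) d) v = 0 := by
  let f := g.comp C
  let u : Fin (n + 1) → ι → Fin 2 → F := fun i => Φ (Pi.single i 1)
  have h1 : ∀ i, bq d (u i) = δ * c i i := fun i => by
    rw [← hΦ, quadVal_single]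
  have h2 : ∀ i j, i ≠ j → bb (u i) (u j) = δ * c i j + δ * c j i := fun i j _ => by
    have e := bq_add d (u i) (u j)
    rw [h1, h1, ← map_add, ← hΦ, quadVal_single_add] at e
    linear_combination - e
  have h3 := bq_sum_smul (mapD f d) (fun i a b => f (u i a b)) (fun i j => f (δ * c i j))
    (fun i => by rw [bq_map, h1]) (fun i j hij => by rw [bb_map, h2 i j hij, map_add])
    (fun i => g (X i))
  refine ⟨_, ?_, h3.trans ?_⟩
  · intro h0
    have hu : u 0 ≠ 0 := fun h => by
      have := hinj (h.trans (map_zero Φ).symm)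
      have h5 := congrFun this 0
      simp at h5
    apply hu
    funext a b
    by_contra hab
    refine hg.linear_ne_zero (fun l => u l a b) (fun h => hab (congrFun h 0)) ?_
    have := congrFun (congrFun h0 a) b
    simp only [Finset.sum_apply, Pi.smul_apply, smul_eq_mul, Pi.zero_apply] at this
    rw [← this]
    exact Finset.sum_congr rfl fun i _ => mul_comm _ _
  · simp only [map_mul]
    rw [quadVal_smul_left]
    have := hg.quadVal_eq_zero
    simp only [f, RingHom.comp_apply]
    rw [this, mul_zero]

lemma QuadricField.exists_embedding {n : ℕ} {c : Fin (n + 1) → Fin (n + 1) → F}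
    {g : MvPolynomial (Fin (n + 1)) F →+* K} (hg : QuadricField c g) (hc : c 0 0 ≠ 0)
    {i s s' : F} (hs : s ≠ 0) (hs' : s' ≠ 0) (hn : n + 1 ≤ 4)
    (hi : ∃ v, v ≠ 0 ∧ bq (P3D (g (C i)) (g (C s)) (g (C s'))) v = 0) :
    ∃ (δ : F) (Φ : (Fin (n + 1) → F) →ₗ[F] ((Unit ⊕ Unit) ⊕ (Unit ⊕ Unit) → Fin 2 → F)), δ ≠ 0 ∧
      ∀ x, δ * quadVal c x = bq (P3D i s s') (Φ x) := by
  by_cases hani : BAniso (P3D i s s')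
  · obtain ⟨v, hv, hv0⟩ := hi
    obtain ⟨g', hg1, hg2, hg3⟩ := hg.lift hc
    obtain ⟨l, P, hl, hP, hdeg, hgP⟩ := hg3 (((Unit ⊕ Unit) ⊕ (Unit ⊕ Unit)) × Fin 2)
      (fun z => v z.1 z.2) (fun h => hv (by
        funext a b; exact congrFun h (a, b)))
    let f : F →+* Polynomial (MvPolynomial (Fin n) F) := Polynomial.C.comp MvPolynomial.C
    have hdvd : quadSucc c ∣ bq (mapD f (P3D i s s')) fun a b => P (a, b) := by
      rw [← hg1, ← bq_map, mapD_mapD]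
      have h1 : (fun a b => g' (P (a, b))) = l • v := by
        funext a b; exact hgP (a, b)
      have h2 : g'.comp f = g.comp C := by
        ext x; exact hg2 x
      rw [h1, bq_smul, h2, mapD_P3D]
      exact mul_eq_zero_of_right _ hv0
    obtain ⟨u, h1, h2⟩ := hani.subform (fun L _ _ f => isRound_map_P3D hs hs' L f) hc
      (P := fun a b => P (a, b)) (fun h => hP (by
        funext z; exact congrFun (congrFun h z.1) z.2)) (fun a b => hdeg _) hdvd
    refine ⟨(c 0 0)⁻¹, ∑ i, (LinearMap.proj i).smulRight (u i), inv_ne_zero hc, fun x => ?_⟩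
    have h3 := bq_sum_smul (P3D i s s') u (fun i j => (c 0 0)⁻¹ * c i j)
      (fun i => by rw [← h1 i, inv_mul_cancel_left₀ hc])
      (fun i j hij => by rw [← mul_add, ← h2 i j hij, inv_mul_cancel_left₀ hc]) x
    rw [quadVal_smul_left] at h3
    rw [← h3]
    congr 1
    simp [LinearMap.sum_apply]
  · simp only [BAniso, not_forall] at hani
    obtain ⟨v, hv0, hv⟩ := hani
    obtain ⟨Φ, hΦ⟩ := exists_hyperbolic_embedding (n + 1) (P3D i s s')
      ((isRound_P3D hs hs').cl_eq_zero hv hv0) (by simpa using hn)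
    let A : (Fin (n + 1) → F) →ₗ[F] (Fin (n + 1) → F) :=
      LinearMap.pi fun i => ∑ j, c i j • LinearMap.proj j
    refine ⟨1, Φ.comp (LinearMap.id.prod A), one_ne_zero, fun x => ?_⟩
    rw [LinearMap.comp_apply, hΦ, one_mul, quadVal]
    refine Finset.sum_congr rfl fun i _ => ?_
    have : ((LinearMap.id.prod A) x).2 i = ∑ j, c i j * x j := by
      simp [A, LinearMap.sum_apply]
    rw [this, Finset.mul_sum]
    refine Finset.sum_congr rfl fun j _ => ?_
    change _ = x i * (c i j * x j)
    ring

end Domination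

section Core

variable {F K : Type} [Field F] [Field K] [CharP F 2] [CharP K 2]

lemma W.map_P3 (f : F →+* K) (y a b : F) : W.map f (P3 y a b) = P3 (f y) (f a) (f b) := by
  rw [P3, P3, map_add, W.map_sc, W.map_P2]

lemma W.map_class_eq (f : F →+* K) {p q r t a b d1 d2 d3 γ i s s' : F}
    (h : w p q + w r t + w 1 d1 + w a d2 + w b d3 = sc γ (P3 i s s')) :
    w (f p) (f q) + w (f r) (f t) + w 1 (f d1) + w (f a) (f d2) + w (f b) (f d3) =
      sc (f γ) (P3 (f i) (f s) (f s')) := by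
  have := congrArg (W.map f) h
  simpa only [map_add, W.map_w, map_one, W.map_sc, W.map_P3] using this

lemma anisotropic_of_injective {N : ℕ} {c c' : Fin N → Fin N → F} {α : F} (hα : α ≠ 0)
    {S : (Fin N → F) →ₗ[F] (Fin N → F)} (hS : Function.Injective S)
    (h : ∀ x, α * quadVal c x = quadVal c' (S x)) (hc : ∀ x, quadVal c x = 0 → x = 0) :
    ∀ x, quadVal c' x = 0 → x = 0 := by
  intro x hx
  obtain ⟨y, rfl⟩ := LinearMap.injective_iff_surjective.1 hS x
  rw [← h] at hx
  rw [hc y ((mul_eq_zero.1 hx).resolve_left hα), map_zero]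

/-- `c` is similar to `[p,q] ⊥ ⟨1,a,b⟩`. -/
def SimilarPhi (c : Fin 5 → Fin 5 → F) (p q a b : F) : Prop :=
  ∃ (α : F) (S : (Fin 5 → F) →ₗ[F] (Fin 5 → F)), α ≠ 0 ∧ Function.Injective S ∧
    ∀ x, α * quadVal c x = quadVal (phiC p q a b) (S x)

lemma QuadricField.exists_class_and_embedding {n : ℕ} {c : Fin (n + 1) → Fin (n + 1) → F}
    {g : MvPolynomial (Fin (n + 1)) F →+* K} (hg : QuadricField c g) (hc : c 0 0 ≠ 0)
    (hn : n + 1 ≤ 4) {cF : Fin 5 → Fin 5 → F} (hani : ∀ x, quadVal cF x = 0 → x = 0)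
    (hpn : ∀ p q a b, SimilarPhi cF p q a b → ∀ γ i s s' d1 d2 d3, γ ≠ 0 → s ≠ 0 → s' ≠ 0 →
      w p q + w 1 d1 + w a d2 + w b d3 ≠ sc γ (P3 i s s'))
    (hi : ∃ x : Fin 5 → K, x ≠ 0 ∧ quadVal (fun i j => g (C (cF i j))) x = 0)
    {p q a b : F} (hS : SimilarPhi cF p q a b)
    {r t a' β : F} (hβ : β ≠ 0) {T : (Fin (n + 1) → F) →ₗ[F] (Fin 4 → F)}
    (hT : ∀ x, β * quadVal c x = quadVal (psiC r t a') (T x)) {y0 y1 y2 : Fin (n + 1) → F}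
    (h0 : T y0 = ![1, 0, 0, 0]) (h1 : T y1 = ![0, 1, 0, 0]) (h2 : T y2 = ![0, 0, 1, 0]) :
    (∃ γ i s s' d1 d2 d3, γ ≠ 0 ∧ s ≠ 0 ∧ s' ≠ 0 ∧
      w p q + w r t + w 1 d1 + w a d2 + w b d3 = sc γ (P3 i s s') ∧
      ((∀ x, β * quadVal c x = quadVal (psiC r t a) (T x)) → ∃ (δ : F)
        (Φ : (Fin (n + 1) → F) →ₗ[F] ((Unit ⊕ Unit) ⊕ (Unit ⊕ Unit) → Fin 2 → F)), δ ≠ 0 ∧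
        ∀ x, δ * quadVal c x = bq (P3D i s s') (Φ x))) ∧
    ((∃ y3, T y3 = ![0, 0, 0, 1]) →
      ∃ x y z w : F, a' = x ^ 2 + a * y ^ 2 + b * z ^ 2 + a * b * w ^ 2) := by
  have hpn' := hpn p q a b hS
  obtain ⟨α, S, hα, hSi, hSe⟩ := hS
  have hani' := anisotropic_of_injective hα hSi hSe hani
  have hi' := isotropic_extLin (g.comp C) hSi hSe (by simpa using hi)
  obtain ⟨⟨γ, i, s, s', d1, d2, d3, hγ, hs, hs', e⟩, hx⟩ :=
    hg.exists_completion hc hani' hpn' (by simpa using hi') hβ hT h0 h1 h2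
  refine ⟨⟨γ, i, s, s', d1, d2, d3, hγ, hs, hs', e, fun hT' => ?_⟩, hx⟩
  obtain ⟨y, hy, hy0⟩ := hg.exists_generic hT' (y0 := y0) (j := 0) (by simp [h0])
  obtain ⟨x, hx, hx0⟩ := hi'
  have e1 := W.map_class_eq (g.comp C) e
  refine hg.exists_embedding hc hs hs' hn ?_
  rw [map_phiC] at hx0
  have e2 := map_psiC (g.comp C) r t a
  simp only [RingHom.comp_apply] at e2 hx0 e1
  rw [e2] at hy0
  have hne : ∀ z : F, z ≠ 0 → g (C z) ≠ 0 := fun z hz => (map_ne_zero (g.comp C)).2 hz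
  exact pfister_isotropic_of_both (hne _ hγ) (hne _ hs) (hne _ hs') e1 hy hy0 hx hx0

/-- If a form of type `(1,3)` that is not a Pfister neighbour becomes isotropic over the function
field of `c`, then some nonsingular completion of a decomposition is similar to a Pfister form
that contains a multiple of `c`. -/
lemma QuadricField.exists_data {n : ℕ} {c : Fin (n + 1) → Fin (n + 1) → F}
    {g : MvPolynomial (Fin (n + 1)) F →+* K} (hg : QuadricField c g)
    (hcani : ∀ x, quadVal c x = 0 → x = 0) (hc : c 0 0 ≠ 0)
    (hn : n + 1 ≤ 4) {cF : Fin 5 → Fin 5 → F} (hani : ∀ x, quadVal cF x = 0 → x = 0)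
    (hpn : ∀ p q a b, SimilarPhi cF p q a b → ∀ γ i s s' d1 d2 d3, γ ≠ 0 → s ≠ 0 → s' ≠ 0 →
      w p q + w 1 d1 + w a d2 + w b d3 ≠ sc γ (P3 i s s'))
    (hi : ∃ x : Fin 5 → K, x ≠ 0 ∧ quadVal (fun i j => g (C (cF i j))) x = 0)
    {p q a b : F} (hS : SimilarPhi cF p q a b)
    {r t a' β : F} (hβ : β ≠ 0) {T : (Fin (n + 1) → F) →ₗ[F] (Fin 4 → F)}
    (hT : ∀ x, β * quadVal c x = quadVal (psiC r t a') (T x)) {y0 y1 y2 : Fin (n + 1) → F}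
    (h0 : T y0 = ![1, 0, 0, 0]) (h1 : T y1 = ![0, 1, 0, 0]) (h2 : T y2 = ![0, 0, 1, 0])
    (h3 : (∀ x, T x 3 = 0) ∨ ∃ y3, T y3 = ![0, 0, 0, 1]) :
    ∃ (p q a b γ i s s' d1 d2 d3 δ : F)
      (Φ : (Fin (n + 1) → F) →ₗ[F] ((Unit ⊕ Unit) ⊕ (Unit ⊕ Unit) → Fin 2 → F)),
      SimilarPhi cF p q a b ∧ (∀ x, β * quadVal c x = quadVal (psiC r t a) (T x)) ∧
      γ ≠ 0 ∧ s ≠ 0 ∧ s' ≠ 0 ∧ δ ≠ 0 ∧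
      w p q + w r t + w 1 d1 + w a d2 + w b d3 = sc γ (P3 i s s') ∧
      ∀ x, δ * quadVal c x = bq (P3D i s s') (Φ x) := by
  obtain h3 | ⟨y3, hy3⟩ := h3
  · have hT' : ∀ x, β * quadVal c x = quadVal (psiC r t a) (T x) := fun x => by
      rw [hT, quadVal_psiC, quadVal_psiC, h3]; ring
    obtain ⟨⟨γ, i, s, s', d1, d2, d3, hγ, hs, hs', e, h⟩, -⟩ :=
      hg.exists_class_and_embedding hc hn hani hpn hi hS hβ hT' h0 h1 h2
    obtain ⟨δ, Φ, hδ, hΦ⟩ := h hT'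
    exact ⟨p, q, a, b, γ, i, s, s', d1, d2, d3, δ, Φ, hS, hT', hγ, hs, hs', hδ, e, hΦ⟩
  · obtain ⟨-, h⟩ := hg.exists_class_and_embedding hc hn hani hpn hi hS hβ hT h0 h1 h2
    obtain ⟨x, y, z, v, h⟩ := h ⟨y3, hy3⟩
    have ha' : ∀ u, u ^ 2 ≠ a' := fun u hu => by
      have h5 : T (u • y2 + y3) = ![0, 0, u, 1] := by
        rw [map_add, map_smul, h2, hy3]
        funext j; fin_cases j <;> simp
      have h6 := hcani (u • y2 + y3) (by
        have := hT (u • y2 + y3)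
        rw [h5, quadVal_psiC] at this
        simp only [Matrix.cons_val] at this
        refine (mul_eq_zero.1 (this.trans ?_)).resolve_left hβ
        rw [← hu]
        linear_combination u ^ 2 * (CharTwo.two_eq_zero : (2 : F) = 0))
      rw [h6, map_zero] at h5
      simpa using congrFun h5 3
    obtain ⟨α, S, hα, hSi, hSe⟩ := hS
    obtain ⟨l, p', q', b', S', hl, hSi', hSe'⟩ := exists_basis_change
      (diag_of_aniso (anisotropic_of_injective hα hSi hSe hani)) ha' h p q
    have hS' : SimilarPhi cF p' q' a' b' := ⟨l * α, S'.comp S, mul_ne_zero hl hα,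
      hSi'.comp hSi, fun x => by rw [mul_assoc, hSe, hSe', LinearMap.comp_apply]⟩
    obtain ⟨⟨γ, i, s, s', d1, d2, d3, hγ, hs, hs', e, h⟩, -⟩ :=
      hg.exists_class_and_embedding hc hn hani hpn hi hS' hβ hT h0 h1 h2
    obtain ⟨δ, Φ, hδ, hΦ⟩ := h hT
    exact ⟨p', q', a', b', γ, i, s, s', d1, d2, d3, δ, Φ, hS', hT, hγ, hs, hs', hδ, e, hΦ⟩

lemma QuadricField.isotropic_of_data {n : ℕ} {c : Fin (n + 1) → Fin (n + 1) → F}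
    {g : MvPolynomial (Fin (n + 1)) F →+* K} (hg : QuadricField c g)
    {cF : Fin 5 → Fin 5 → F} {p q a b γ i s s' d1 d2 d3 δ r t β : F}
    {Φ : (Fin (n + 1) → F) →ₗ[F] ((Unit ⊕ Unit) ⊕ (Unit ⊕ Unit) → Fin 2 → F)}
    (hS : SimilarPhi cF p q a b) {T : (Fin (n + 1) → F) →ₗ[F] (Fin 4 → F)}
    (hT : ∀ x, β * quadVal c x = quadVal (psiC r t a) (T x)) {y0 : Fin (n + 1) → F}
    (h0 : T y0 0 ≠ 0) (hs : s ≠ 0) (hs' : s' ≠ 0)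
    (e : w p q + w r t + w 1 d1 + w a d2 + w b d3 = sc γ (P3 i s s'))
    (hinj : Function.Injective Φ) (hΦ : ∀ x, δ * quadVal c x = bq (P3D i s s') (Φ x)) :
    ∃ x : Fin 5 → K, x ≠ 0 ∧ quadVal (fun i j => g (C (cF i j))) x = 0 := by
  obtain ⟨α, S, hα, hSi, hSe⟩ := hS
  have h1 := hg.isotropic_of_embedding hinj hΦ
  rw [mapD_P3D] at h1
  obtain ⟨y, hy, hy0⟩ := hg.exists_generic hT h0
  have e1 := W.map_class_eq (g.comp C) e
  have e2 := map_psiC (g.comp C) r t a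
  simp only [RingHom.comp_apply] at e2
  rw [e2] at hy0
  have hne : ∀ z : F, z ≠ 0 → g.comp C z ≠ 0 := fun z hz => (map_ne_zero (g.comp C)).2 hz
  have h2 := phi_isotropic_of_pfister (hne _ hs) (hne _ hs') e1 hy hy0 h1
  rw [← map_phiC] at h2
  let E := LinearEquiv.ofInjectiveEndo S hSi
  have hE : ∀ y, S (E.symm y) = y := fun y => E.apply_symm_apply y
  have := isotropic_extLin (g.comp C) (T := E.symm.toLinearMap) (α := α⁻¹)
    (c := phiC p q a b) (c' := cF) E.symm.injective (fun y => by
      have := hSe (E.symm y)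
      rw [hE] at this
      rw [← this, inv_mul_cancel_left₀ hα]; rfl) h2
  simpa using this

end Core

section WittForms

variable {k : Type} [Field k] [CharP k 2] {V₁ V₂ V₃ : Type}
  [AddCommGroup V₁] [Module k V₁] [AddCommGroup V₂] [Module k V₂] [AddCommGroup V₃] [Module k V₃]
  {ι κ : Type} [Fintype ι] [Fintype κ]

lemma equivalent_of_linearEquiv {Q₁ : QuadraticForm k V₁} {Q₂ : QuadraticForm k V₂}
    (e : V₁ ≃ₗ[k] V₂) (h : ∀ x, Q₂ (e x) = Q₁ x) : Q₁.Equivalent Q₂ :=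
  ⟨⟨e, h⟩⟩

lemma equivalent_of_injective [FiniteDimensional k V₁] [FiniteDimensional k V₂]
    {Q₁ : QuadraticForm k V₁} {Q₂ : QuadraticForm k V₂} (f : V₁ →ₗ[k] V₂)
    (hf : Function.Injective f) (hd : Module.finrank k V₁ = Module.finrank k V₂)
    (h : ∀ x, Q₂ (f x) = Q₁ x) : Q₁.Equivalent Q₂ :=
  equivalent_of_linearEquiv (LinearMap.linearEquivOfInjective f hf hd) h

lemma equivalent_prodAssoc (Q₁ : QuadraticForm k V₁) (Q₂ : QuadraticForm k V₂)
    (Q₃ : QuadraticForm k V₃) : ((Q₁.prod Q₂).prod Q₃).Equivalent (Q₁.prod (Q₂.prod Q₃)) :=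
  equivalent_of_linearEquiv (LinearEquiv.prodAssoc k V₁ V₂ V₃) fun x => by
    simp [QuadraticMap.prod_apply, add_assoc]

lemma equivalent_prodComm (Q₁ : QuadraticForm k V₁) (Q₂ : QuadraticForm k V₂) :
    (Q₁.prod Q₂).Equivalent (Q₂.prod Q₁) :=
  ⟨QuadraticMap.IsometryEquiv.prodComm Q₁ Q₂⟩

lemma bqForm_sum_equivalent (d : ι → k × k) (e : κ → k × k) :
    (bqForm (Sum.elim d e)).Equivalent ((bqForm d).prod (bqForm e)) :=
  equivalent_of_linearEquiv sumSplit fun x => by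
    rw [QuadraticMap.prod_apply, bqForm_apply, bqForm_apply, bqForm_apply, bq_sum]

lemma binsQF_eq {r : ℕ} (a b : Fin r → k) : binsQF a b = bqForm fun i => (a i, b i) := rfl

lemma hypQF_eq (m : ℕ) : hypQF k m = bqForm fun _ : Fin m => ((0 : k), (0 : k)) := rfl

lemma bqForm_unique_equivalent [Unique κ] (p q : k) :
    (bqForm fun _ : κ => (p, q)).Equivalent (binQF p q) :=
  equivalent_of_linearEquiv (LinearEquiv.funUnique κ k (Fin 2 → k)) fun x => by
    simp [binQF_apply, bq]

lemma bqForm_reindex (d : ι → k × k) (e : κ ≃ ι) : (bqForm d).Equivalent (bqForm (d ∘ e)) :=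
  equivalent_of_linearEquiv (LinearEquiv.funCongrLeft k (Fin 2 → k) e) fun x => by
    rw [bqForm_apply, bqForm_apply, ← bq_comp_equiv d e x]; rfl

lemma smul_bqForm_equivalent {c : k} (hc : c ≠ 0) (d : ι → k × k) :
    (c • bqForm d).Equivalent (bqForm (scD c d)) :=
  equivalent_of_linearEquiv (scEquiv c hc) fun x => by
    rw [bqForm_apply, bq_scEquiv, _root_.smul_apply, bqForm_apply, smul_eq_mul]

lemma Equivalent.smul {Q₁ : QuadraticForm k V₁} {Q₂ : QuadraticForm k V₂} (h : Q₁.Equivalent Q₂)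
    (c : k) : (c • Q₁).Equivalent (c • Q₂) :=
  h.elim fun e => equivalent_of_linearEquiv e.toLinearEquiv fun x => by
    rw [_root_.smul_apply, _root_.smul_apply]
    exact congrArg (c • ·) (e.map_app x)

lemma WittEquiv.congr {V₄ : Type} [AddCommGroup V₄] [Module k V₄]
    {Q₁ : QuadraticForm k V₁} {Q₂ : QuadraticForm k V₂} {Q₃ : QuadraticForm k V₃}
    {Q₄ : QuadraticForm k V₄} (h : WittEquiv Q₁ Q₂) (h1 : Q₁.Equivalent Q₃)
    (h2 : Q₂.Equivalent Q₄) : WittEquiv Q₃ Q₄ := by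
  obtain ⟨m, n, h⟩ := h
  exact ⟨m, n, ((h1.symm.prod (Equivalent.refl _)).trans h).trans (h2.prod (Equivalent.refl _))⟩

lemma pfisterQF_equivalent (s : Fin 2 → k) (hs : ∀ i, s i ≠ 0) (y : k) :
    (pfisterQF 2 s y).Equivalent (bqForm (P3D y (s 0) (s 1))) := by
  have hσ : Function.Bijective (Sum.elim (Sum.elim (fun _ => ∅) fun _ => {0})
      (Sum.elim (fun _ => {1}) fun _ => {0, 1}) :
      (Unit ⊕ Unit) ⊕ (Unit ⊕ Unit) → Finset (Fin 2)) := by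
    decide
  have h1 : (pfisterQF 2 s y).Equivalent
      (bqForm fun S : Finset (Fin 2) => (∏ i ∈ S, s i, y / ∏ i ∈ S, s i)) := by
    refine QuadraticMap.Equivalent.pi fun S => ?_
    have hS : ∏ i ∈ S, s i ≠ 0 := Finset.prod_ne_zero_iff.2 fun i _ => hs i
    have h2 := smul_bqForm_equivalent hS fun _ : Unit => ((1 : k), y)
    refine ((Equivalent.smul (bqForm_unique_equivalent 1 y) _).symm.trans h2).trans ?_
    have h3 : scD (∏ i ∈ S, s i) (fun _ : Unit => ((1 : k), y)) =
      fun _ => (∏ i ∈ S, s i, y / ∏ i ∈ S, s i) := by funext; simp [scD]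
    rw [h3]
    exact bqForm_unique_equivalent _ _
  refine h1.trans ((bqForm_reindex _ (Equiv.ofBijective _ hσ)).trans ?_)
  have h4 : (fun S : Finset (Fin 2) => (∏ i ∈ S, s i, y / ∏ i ∈ S, s i)) ∘
      Equiv.ofBijective _ hσ = P3D y (s 0) (s 1) := by
    funext x
    have h0 := hs 0
    have h1 := hs 1
    rcases x with (x | x) | (x | x) <;> simp [P3D, P2D, P1D, dbl, scD] <;>
      (constructor; all_goals field_simp)
  rw [h4]

lemma smul_pfisterQF_equivalent (s : Fin 2 → k) (hs : ∀ i, s i ≠ 0) (y : k) {γ : k}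
    (hγ : γ ≠ 0) :
    (γ • pfisterQF 2 s y).Equivalent (bqForm (scD γ (P3D y (s 0) (s 1)))) :=
  (Equivalent.smul (pfisterQF_equivalent s hs y) γ).trans (smul_bqForm_equivalent hγ _)

lemma bqForm_equivalent_hypQF {d : ι → k × k} (h : cl d = 0) :
    (bqForm d).Equivalent (hypQF k (Fintype.card ι)) := by
  obtain ⟨Φ, hΦ⟩ := exists_hyperbolic_embedding (Fintype.card ι) d h le_rfl
  have hinj : Function.Injective Φ := by
    rw [← LinearMap.ker_eq_bot, LinearMap.ker_eq_bot']
    intro x hx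
    have key : ∀ y : (Fin (Fintype.card ι) → k) × (Fin (Fintype.card ι) → k),
        ∑ i, (x.1 i * y.2 i + y.1 i * x.2 i) = 0 := fun y => by
      have e1 := hΦ (x + y)
      have e2 := hΦ x
      rw [hx, bq_zero] at e2
      rw [map_add, hx, zero_add, hΦ] at e1
      simp only [Prod.fst_add, Prod.snd_add, Pi.add_apply, add_mul, mul_add,
        Finset.sum_add_distrib] at e1
      rw [Finset.sum_add_distrib]
      linear_combination -e1 + e2
    refine Prod.ext (funext fun i => ?_) (funext fun i => ?_)
    · simpa [Pi.single_apply] using key (0, Pi.single i 1)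
    · simpa [Pi.single_apply] using key (Pi.single i 1, 0)
  let e : (Fin (Fintype.card ι) → Fin 2 → k) →ₗ[k]
      (Fin (Fintype.card ι) → k) × (Fin (Fintype.card ι) → k) :=
    (LinearMap.compLeft (LinearMap.proj 0) _).prod (LinearMap.compLeft (LinearMap.proj 1) _)
  refine Equivalent.symm (equivalent_of_injective (Φ.comp e) (hinj.comp fun x y hxy => ?_) ?_ ?_)
  · funext i j
    fin_cases j
    · exact congrFun (congrArg Prod.fst hxy) i
    · exact congrFun (congrArg Prod.snd hxy) i
  · rw [finrank_block, finrank_block, Fintype.card_fin]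
  · intro x
    rw [bqForm_apply, LinearMap.comp_apply, hΦ, hypQF_eq, bqForm_apply]
    simp [bq, e]

lemma WittEquiv.of_cl_eq {d : ι → k × k} {e : κ → k × k} (h : cl d = cl e) :
    WittEquiv (bqForm d) (bqForm e) := by
  refine ⟨Fintype.card (κ ⊕ κ), Fintype.card (ι ⊕ κ), ?_⟩
  have h1 : (hypQF k (Fintype.card (κ ⊕ κ))).Equivalent ((bqForm e).prod (bqForm e)) :=
    (bqForm_equivalent_hypQF (d := Sum.elim e e) (by rw [cl_sum, W.add_self])).symm.trans
      (bqForm_sum_equivalent e e)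
  have h2 : (hypQF k (Fintype.card (ι ⊕ κ))).Equivalent ((bqForm d).prod (bqForm e)) :=
    (bqForm_equivalent_hypQF (d := Sum.elim d e) (by rw [cl_sum, h, W.add_self])).symm.trans
      (bqForm_sum_equivalent d e)
  exact (((Equivalent.refl _).prod h1).trans (equivalent_prodAssoc _ _ _).symm).trans
    ((equivalent_prodComm _ _).trans ((Equivalent.refl _).prod h2.symm))

lemma cl_const_zero (m : ℕ) : cl (fun _ : Fin m => ((0 : k), (0 : k))) = 0 := by
  simp [cl]

lemma WittEquiv.cl_eq {d : ι → k × k} {e : κ → k × k} (h : WittEquiv (bqForm d) (bqForm e)) :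
    cl d = cl e := by
  obtain ⟨m, n, h⟩ := h
  rw [hypQF_eq, hypQF_eq] at h
  obtain ⟨f⟩ := ((bqForm_sum_equivalent _ _).trans h).trans (bqForm_sum_equivalent _ _).symm
  have hd := f.toLinearEquiv.finrank_eq
  rw [finrank_block, finrank_block] at hd
  have := cl_eq_of_isometry (by omega) f.toLinearEquiv.toLinearMap fun x => by
    have := f.map_app x
    rwa [bqForm_apply, bqForm_apply] at this
  rwa [cl_sum, cl_sum, cl_const_zero, cl_const_zero, add_zero, add_zero] at this

end WittForms

section Bridge

variable {F : Type} [Field F]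

lemma apply_eq_quadVal {n : ℕ} (φ : QuadraticForm F (Fin n → F)) (x : Fin n → F) :
    φ x = quadVal (coeffMat F φ) x := by
  have h1 : φ x = (φ.toBilin (Pi.basisFun F (Fin n))) x x := by
    rw [← LinearMap.BilinMap.toQuadraticMap_apply, QuadraticMap.toQuadraticMap_toBilin]
  have h2 : x = ∑ i, x i • Pi.basisFun F (Fin n) i := by
    simpa using ((Pi.basisFun F (Fin n)).sum_repr x).symm
  rw [h1]
  conv_lhs => rw [h2]
  simp_rw [LinearMap.map_sum₂, map_sum, LinearMap.map_smul₂, map_smul, QuadraticMap.toBilin_apply]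
  simp only [quadVal, coeffMat, Matrix.of_apply, Pi.basisFun_apply, smul_eq_mul]
  refine Finset.sum_congr rfl fun i _ => Finset.sum_congr rfl fun j _ => ?_
  ring

lemma extendQF_apply {K : Type} [CommRing K] (f : F →+* K) {n : ℕ}
    (φ : QuadraticForm F (Fin n → F)) (x : Fin n → K) :
    extendQF F f φ x = quadVal (fun i j => f (coeffMat F φ i j)) x := by
  simp only [extendQF, Matrix.toQuadraticMap', Matrix.toQuadraticForm',
    LinearMap.BilinMap.toQuadraticMap_apply, Matrix.toLinearMap₂'_apply, quadVal]
  refine Finset.sum_congr rfl fun i _ => Finset.sum_congr rfl fun j _ => ?_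
  simp [Matrix.map_apply]
  ring

lemma exists_quadricField [CharP F 2] {n : ℕ} (hn : 2 ≤ n) {ψ : QuadraticForm F (Fin n → F)}
    (hψ : ψ.Anisotropic) {N : ℕ} (φ : QuadraticForm F (Fin N → F)) :
    ∃ (K : Type) (_ : Field K) (_ : CharP K 2) (g : MvPolynomial (Fin n) F →+* K),
      QuadricField (coeffMat F ψ) g ∧ (¬ (extendQF F (funFieldMap F ψ) φ).Anisotropic ↔
        ∃ x : Fin N → K, x ≠ 0 ∧ quadVal (fun i j => g (C (coeffMat F φ i j))) x = 0) := by
  have hirr := irreducible_quadPoly hn (c := coeffMat F ψ) fun x hx =>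
    hψ x ((apply_eq_quadVal ψ x).trans hx)
  have hprime : (Ideal.span {quadPoly (coeffMat F ψ)}).IsPrime :=
    (Ideal.span_singleton_prime hirr.ne_zero).2 hirr.prime
  have : IsDomain (MvPolynomial (Fin n) F ⧸ Ideal.span {quadPoly (coeffMat F ψ)}) :=
    Ideal.Quotient.isDomain _
  let g := (algebraMap (MvPolynomial (Fin n) F ⧸ Ideal.span {quadPoly (coeffMat F ψ)})
      (FractionRing (MvPolynomial (Fin n) F ⧸ Ideal.span {quadPoly (coeffMat F ψ)}))).comp
      (Ideal.Quotient.mk _)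
  refine ⟨FractionRing (MvPolynomial (Fin n) F ⧸ Ideal.span {quadPoly (coeffMat F ψ)}),
    inferInstance, charP_of_injective_ringHom (g.comp C).injective 2, g, quadricField _, ?_⟩
  have key : ∀ x, extendQF F (funFieldMap F ψ) φ x =
      quadVal (fun i j => (funFieldMap F ψ) (coeffMat F φ i j)) x := extendQF_apply _ _
  simp only [QuadraticMap.Anisotropic, key, not_forall]
  constructor
  · rintro ⟨x, h1, h2⟩
    exact ⟨x, h2, h1⟩
  · rintro ⟨x, h2, h1⟩
    exact ⟨x, h1, h2⟩

variable [CharP F 2] {V : Type} [AddCommGroup V] [Module F V]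

lemma binsQF_one_equivalent (a b : Fin 1 → F) :
    (binsQF a b).Equivalent (binQF (a 0) (b 0)) :=
  Equivalent.trans (equivalent_of_linearEquiv (LinearEquiv.refl _ _) fun x => by
    rw [binsQF_eq, bqForm_apply, bqForm_apply]; simp [bq])
    (bqForm_unique_equivalent (κ := Fin 1) _ _)

lemma prod_zero_equivalent (Q : QuadraticForm F V) (Q' : QuadraticForm F (Fin 0 → F)) :
    (Q.prod Q').Equivalent Q :=
  equivalent_of_linearEquiv LinearEquiv.prodUnique fun x => by
    rw [QuadraticMap.prod_apply, Subsingleton.elim x.2 0, map_zero, add_zero]; rfl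

lemma HasTypeRS.exists_binQF {R : QuadraticForm F V} (h : HasTypeRS R 1 0) :
    ∃ p q : F, R.Equivalent (binQF p q) := by
  obtain ⟨a, b, c, h⟩ := h
  exact ⟨a 0, b 0, h.trans ((prod_zero_equivalent _ _).trans (binsQF_one_equivalent a b))⟩

lemma hasTypeRS_binQF (p q : F) : HasTypeRS (binQF p q) 1 0 :=
  ⟨fun _ => p, fun _ => q, 0,
    ((prod_zero_equivalent _ _).trans (binsQF_one_equivalent _ _)).symm⟩

lemma diagQF_apply {s : ℕ} (c : Fin s → F) (x : Fin s → F) :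
    diagQF c x = ∑ i, c i * x i ^ 2 := by
  simp [diagQF, QuadraticMap.weightedSumSquares_apply, pow_two]

lemma smul_binQF_equivalent {c : F} (hc : c ≠ 0) (p q : F) :
    (c • binQF p q).Equivalent (binQF (c * p) (q / c)) := by
  refine (Equivalent.smul (bqForm_unique_equivalent (κ := Unit) p q).symm c).trans
    ((smul_bqForm_equivalent hc _).trans ?_)
  exact bqForm_unique_equivalent (κ := Unit) (c * p) (q / c)

lemma smul_prod_diagQF {s : ℕ} (β : F) (Q : QuadraticForm F V) (c : Fin s → F) :
    β • Q.prod (diagQF c) = (β • Q).prod (diagQF fun i => β * c i) := by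
  ext x
  simp only [_root_.smul_apply, QuadraticMap.prod_apply, diagQF_apply, smul_eq_mul,
    mul_add, Finset.mul_sum, mul_assoc]

lemma HasTypeRS.exists_normal_form {φ : QuadraticForm F V} (hφ : φ.Anisotropic) {s : ℕ}
    (h : HasTypeRS φ 1 (s + 1)) :
    ∃ (β p q : F) (c : Fin (s + 1) → F), β ≠ 0 ∧ c 0 = 1 ∧
      (β • φ).Equivalent ((binQF p q).prod (diagQF c)) := by
  obtain ⟨a, b, c, ⟨e⟩⟩ := h
  have hc : c 0 ≠ 0 := fun h0 => by
    have h1 := hφ (e.symm (0, Pi.single 0 1)) (by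
      rw [e.symm.map_app, QuadraticMap.prod_apply, diagQF_apply]
      simp [Pi.single_apply, h0])
    have h2 := congrArg e h1
    rw [e.apply_symm_apply, map_zero] at h2
    simpa using congrFun (congrArg Prod.snd h2) 0
  have hβ := inv_ne_zero hc
  refine ⟨(c 0)⁻¹, (c 0)⁻¹ * a 0, b 0 / (c 0)⁻¹, fun i => (c 0)⁻¹ * c i, hβ,
    inv_mul_cancel₀ hc, ?_⟩
  have h1 := Equivalent.smul ⟨e⟩ (c 0)⁻¹
  rw [smul_prod_diagQF] at h1
  exact h1.trans (Equivalent.prod ((Equivalent.smul (binsQF_one_equivalent a b) _).trans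
    (smul_binQF_equivalent hβ _ _)) (Equivalent.refl _))

/-- Coordinates on `[p,q] ⊥ ⟨1,a,b⟩`. -/
def phiEquiv (F : Type) [Field F] : ((Fin 2 → F) × (Fin 3 → F)) ≃ₗ[F] (Fin 5 → F) where
  toFun z := ![z.1 0, z.1 1, z.2 0, z.2 1, z.2 2]
  invFun x := (![x 0, x 1], ![x 2, x 3, x 4])
  map_add' x y := by funext i; fin_cases i <;> simp
  map_smul' c x := by funext i; fin_cases i <;> simp
  left_inv z := by
    refine Prod.ext ?_ ?_ <;> funext i <;> fin_cases i <;> simp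
  right_inv x := by funext i; fin_cases i <;> simp

lemma quadVal_phiEquiv (p q a b : F) (z) : quadVal (phiC p q a b) (phiEquiv F z) =
    (binQF p q).prod (diagQF ![1, a, b]) z := by
  rw [quadVal_phiC, QuadraticMap.prod_apply, binQF_apply, diagQF_apply]
  simp [phiEquiv, Fin.sum_univ_succ]
  ring

lemma mval_eq (p q a b : F) (z) : mval p q a b z = quadVal (phiC p q a b) (phiEquiv F z) := by
  rw [quadVal_phiC]; simp [phiEquiv, mval]

lemma similarPhi_iff {φ : QuadraticForm F (Fin 5 → F)} {p q a b : F} :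
    SimilarPhi (coeffMat F φ) p q a b ↔
      ∃ α : Fˣ, ((α : F) • φ).Equivalent ((binQF p q).prod (diagQF ![1, a, b])) := by
  constructor
  · rintro ⟨α, S, hα, hS, h⟩
    refine ⟨Units.mk0 α hα, Equivalent.trans (equivalent_of_injective S hS rfl
      (Q₂ := ((binQF p q).prod (diagQF ![1, a, b])).comp (phiEquiv F).symm.toLinearMap)
      fun x => ?_) (equivalent_of_linearEquiv (phiEquiv F).symm fun x => rfl)⟩
    rw [QuadraticMap.comp_apply, LinearEquiv.coe_coe, ← quadVal_phiEquiv,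
      LinearEquiv.apply_symm_apply, ← h, ← apply_eq_quadVal]
    rfl
  · rintro ⟨α, ⟨e⟩⟩
    refine ⟨α, (e.toLinearEquiv.trans (phiEquiv F)).toLinearMap, α.ne_zero,
      (e.toLinearEquiv.trans (phiEquiv F)).injective, fun x => ?_⟩
    rw [← apply_eq_quadVal]
    refine Eq.trans ?_ (quadVal_phiEquiv p q a b (e x)).symm
    exact (e.map_app x).symm

lemma Dominated.congr {V₁ V₂ V₃ : Type} [AddCommGroup V₁] [Module F V₁] [AddCommGroup V₂]
    [Module F V₂] [AddCommGroup V₃] [Module F V₃] {Q₁ : QuadraticForm F V₁}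
    {Q₂ : QuadraticForm F V₂} {Q₃ : QuadraticForm F V₃} (h : Dominated Q₁ Q₂)
    (h' : Q₂.Equivalent Q₃) : Dominated Q₁ Q₃ := by
  obtain ⟨f, hf, h⟩ := h
  obtain ⟨e⟩ := h'
  exact ⟨e.toLinearEquiv.toLinearMap.comp f, e.toLinearEquiv.injective.comp hf, fun v =>
    (h v).trans (e.map_app (f v)).symm⟩

lemma isPfisterNeighbour_of_class {φ : QuadraticForm F (Fin 5 → F)} (hφ : φ.Anisotropic)
    {p q a b : F} (hS : SimilarPhi (coeffMat F φ) p q a b) {γ i s s' d1 d2 d3 : F} (hγ : γ ≠ 0)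
    (hs : s ≠ 0) (hs' : s' ≠ 0)
    (e : w p q + w 1 d1 + w a d2 + w b d3 = sc γ (P3 i s s')) : IsPfisterNeighbour φ := by
  obtain ⟨α, S, hα, hSi, hSe⟩ := hS
  have hani := anisotropic_of_injective hα hSi hSe fun x hx =>
    hφ x ((apply_eq_quadVal φ x).trans hx)
  have hm : ∀ z, mval p q a b z = 0 → z = 0 := fun z hz => by
    rw [mval_eq] at hz
    simpa using hani _ hz
  obtain ⟨Φ, hΦ⟩ := exists_map_of_completion hγ hs hs' hm e
  refine ⟨2, ![Units.mk0 s hs, Units.mk0 s' hs'], i, by simp, ?_⟩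
  have hss : ∀ j, ((fun j => ((![Units.mk0 s hs, Units.mk0 s' hs'] : Fin 2 → Fˣ) j : F)) j) ≠ 0 :=
    fun j => Units.ne_zero _
  refine ⟨Units.mk0 (γ⁻¹ * α) (mul_ne_zero (inv_ne_zero hγ) hα), Dominated.congr
    (Q₂ := bqForm (P3D i s s')) ?_ (pfisterQF_equivalent _ hss i).symm⟩
  let T := (scEquiv γ hγ).symm.toLinearMap.comp (Φ.comp ((phiEquiv F).symm.toLinearMap.comp S))
  have hT : ∀ x, ((γ⁻¹ * α) • φ) x = bqForm (P3D i s s') (T x) := fun x => by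
    have h1 := bq_scEquiv hγ (P3D i s s') (T x)
    simp only [T, LinearMap.comp_apply, LinearEquiv.coe_coe, LinearEquiv.apply_symm_apply] at h1
    rw [hΦ, mval_eq, LinearEquiv.apply_symm_apply, ← hSe, ← apply_eq_quadVal] at h1
    rw [bqForm_apply, _root_.smul_apply, smul_eq_mul, mul_assoc, h1,
      inv_mul_cancel_left₀ hγ]
    rfl
  refine ⟨T, ?_, hT⟩
  rw [← LinearMap.ker_eq_bot, LinearMap.ker_eq_bot']
  intro x hx
  have h1 := hT x
  rw [hx, map_zero, _root_.smul_apply, smul_eq_mul] at h1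
  exact hφ x ((mul_eq_zero.1 h1).resolve_left (mul_ne_zero (inv_ne_zero hγ) hα))

end Bridge

section Main

variable {F : Type} [Field F] [CharP F 2]

/-- Coordinates on `[r,t] ⊥ ⟨1⟩`. -/
def psiMapThree (F : Type) [Field F] : ((Fin 2 → F) × (Fin 1 → F)) →ₗ[F] (Fin 4 → F) where
  toFun z := ![z.1 0, z.1 1, z.2 0, 0]
  map_add' x y := by funext i; fin_cases i <;> simp
  map_smul' c x := by funext i; fin_cases i <;> simp

/-- Coordinates on `[r,t] ⊥ ⟨1,a⟩`. -/
def psiMapFour (F : Type) [Field F] : ((Fin 2 → F) × (Fin 2 → F)) →ₗ[F] (Fin 4 → F) where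
  toFun z := ![z.1 0, z.1 1, z.2 0, z.2 1]
  map_add' x y := by funext i; fin_cases i <;> simp
  map_smul' c x := by funext i; fin_cases i <;> simp

lemma quadVal_psiMapThree (r t a : F) (z) : quadVal (psiC r t a) (psiMapThree F z) =
    (binQF r t).prod (diagQF ![1]) z := by
  rw [quadVal_psiC, QuadraticMap.prod_apply, binQF_apply, diagQF_apply]
  simp [psiMapThree]

lemma quadVal_psiMapFour (r t a : F) (z) : quadVal (psiC r t a) (psiMapFour F z) =
    (binQF r t).prod (diagQF ![1, a]) z := by
  rw [quadVal_psiC, QuadraticMap.prod_apply, binQF_apply, diagQF_apply]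
  simp [psiMapFour, Fin.sum_univ_succ]

lemma weaklyDominated_of_bq {n : ℕ} {ψ : QuadraticForm F (Fin n → F)} (hψ : ψ.Anisotropic)
    {δ i γ : F} {s : Fin 2 → F} (hδ : δ ≠ 0) (hγ : γ ≠ 0) (hs : ∀ j, s j ≠ 0)
    {Φ : (Fin n → F) →ₗ[F] ((Unit ⊕ Unit) ⊕ (Unit ⊕ Unit) → Fin 2 → F)}
    (hΦ : ∀ x, δ * quadVal (coeffMat F ψ) x = bq (P3D i (s 0) (s 1)) (Φ x)) :
    WeaklyDominated ψ (γ • pfisterQF 2 s i) := by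
  refine ⟨Units.mk0 (γ * δ) (mul_ne_zero hγ hδ), Dominated.congr
    (Q₂ := γ • bqForm (P3D i (s 0) (s 1))) ⟨Φ, ?_, fun x => ?_⟩
    (Equivalent.smul (pfisterQF_equivalent s hs i).symm γ)⟩
  · rw [← LinearMap.ker_eq_bot, LinearMap.ker_eq_bot']
    intro x hx
    have h1 := hΦ x
    rw [hx, bq_zero, ← apply_eq_quadVal] at h1
    exact hψ x ((mul_eq_zero.1 h1).resolve_left hδ)
  · rw [_root_.smul_apply, _root_.smul_apply, bqForm_apply, ← hΦ,
      ← apply_eq_quadVal, Units.val_mk0, smul_eq_mul, smul_eq_mul, mul_assoc]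

lemma WeaklyDominated.exists_bq {n : ℕ} {ψ : QuadraticForm F (Fin n → F)}
    {i γ : F} {s : Fin 2 → F} (hγ : γ ≠ 0) (hs : ∀ j, s j ≠ 0)
    (h : WeaklyDominated ψ (γ • pfisterQF 2 s i)) :
    ∃ (δ : F) (Φ : (Fin n → F) →ₗ[F] ((Unit ⊕ Unit) ⊕ (Unit ⊕ Unit) → Fin 2 → F)),
      Function.Injective Φ ∧
      ∀ x, δ * quadVal (coeffMat F ψ) x = bq (P3D i (s 0) (s 1)) (Φ x) := by
  obtain ⟨α, h⟩ := h
  obtain ⟨Φ, hinj, h⟩ := h.congr (Equivalent.smul (pfisterQF_equivalent s hs i) γ)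
  refine ⟨γ⁻¹ * α, Φ, hinj, fun x => ?_⟩
  have := h x
  rw [_root_.smul_apply, _root_.smul_apply, bqForm_apply, smul_eq_mul, smul_eq_mul,
    apply_eq_quadVal] at this
  rw [mul_assoc, this, inv_mul_cancel_left₀ hγ]

lemma wittEquiv_pfister_iff {p q r t a b γ y : F} {d : Fin 3 → F} {s : Fin 2 → F} (hγ : γ ≠ 0)
    (hs : ∀ j, s j ≠ 0) :
    WittEquiv ((binQF p q).prod ((binQF r t).prod (binsQF ![1, a, b] d)))
      (γ • pfisterQF 2 s y) ↔
    w p q + w r t + w 1 (d 0) + w a (d 1) + w b (d 2) = sc γ (P3 y (s 0) (s 1)) := by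
  let e : Fin 3 → F × F := fun i => ((![1, a, b] : Fin 3 → F) i, d i)
  let D := Sum.elim (fun _ : Unit => (p, q)) (Sum.elim (fun _ : Unit => (r, t)) e)
  have h1 : (bqForm D).Equivalent ((binQF p q).prod ((binQF r t).prod (binsQF ![1, a, b] d))) :=
    (bqForm_sum_equivalent _ _).trans ((bqForm_unique_equivalent p q).prod
      ((bqForm_sum_equivalent _ _).trans ((bqForm_unique_equivalent r t).prod
        (Equivalent.refl _))))
  have h2 := smul_pfisterQF_equivalent s hs y hγ
  have h3 : cl D = w p q + w r t + w 1 (d 0) + w a (d 1) + w b (d 2) := by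
    simp [D, e, cl, Fin.sum_univ_three, add_assoc]
  have h4 : cl (scD γ (P3D y (s 0) (s 1))) = sc γ (P3 y (s 0) (s 1)) := by
    rw [← sc_cl hγ, cl_P3D (hs 0) (hs 1)]
  rw [← h3, ← h4]
  exact ⟨fun h => (h.congr h1.symm h2).cl_eq, fun h => (WittEquiv.of_cl_eq h).congr h1 h2.symm⟩

lemma SimilarPhi.ne_zero {c : Fin 5 → Fin 5 → F} {p q a b : F} (h : SimilarPhi c p q a b)
    (hc : ∀ x, quadVal c x = 0 → x = 0) : a ≠ 0 ∧ b ≠ 0 := by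
  obtain ⟨α, S, hα, hS, h⟩ := h
  have hani := anisotropic_of_injective hα hS h hc
  constructor
  · rintro rfl
    have := hani ![0, 0, 0, 1, 0] (by rw [quadVal_phiC]; simp)
    simpa using congrFun this 3
  · rintro rfl
    have := hani ![0, 0, 0, 0, 1] (by rw [quadVal_phiC]; simp)
    simpa using congrFun this 4

lemma exists_decomposition_of_isotropic {φ : QuadraticForm F (Fin 5 → F)} (hφa : φ.Anisotropic)
    (hφt : HasTypeRS φ 1 3) (hφpn : ¬ IsPfisterNeighbour φ) {n : ℕ} (hn1 : 2 ≤ n + 1)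
    (hn : n + 1 ≤ 4) {ψ : QuadraticForm F (Fin (n + 1) → F)} (hψ : ψ.Anisotropic)
    (hi : ¬ (extendQF F (funFieldMap F ψ) φ).Anisotropic)
    {r t a' β : F} (hβ : β ≠ 0) {T : (Fin (n + 1) → F) →ₗ[F] (Fin 4 → F)}
    (hT : ∀ x, β * ψ x = quadVal (psiC r t a') (T x)) {y0 y1 y2 : Fin (n + 1) → F}
    (h0 : T y0 = ![1, 0, 0, 0]) (h1 : T y1 = ![0, 1, 0, 0]) (h2 : T y2 = ![0, 0, 1, 0])
    (h3 : (∀ x, T x 3 = 0) ∨ ∃ y3, T y3 = ![0, 0, 0, 1]) :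
    ∃ (p q : F) (a b α : Fˣ) (d : Fin 3 → F) (γ : Fˣ) (s : Fin 2 → Fˣ) (cc : F),
      WeaklyDominated ψ ((γ : F) • pfisterQF 2 (fun i => (s i : F)) cc) ∧
      ((α : F) • φ).Equivalent ((binQF p q).prod (diagQF ![(1 : F), (a : F), (b : F)])) ∧
      (∀ x, β * ψ x = quadVal (psiC r t a) (T x)) ∧
      WittEquiv ((binQF p q).prod ((binQF r t).prod (binsQF ![(1 : F), (a : F), (b : F)] d)))
          ((γ : F) • pfisterQF 2 (fun i => (s i : F)) cc) := by
  obtain ⟨K, _, _, g, hg, hiff⟩ := exists_quadricField hn1 hψ φ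
  have hφani : ∀ x, quadVal (coeffMat F φ) x = 0 → x = 0 := fun x hx =>
    hφa x ((apply_eq_quadVal φ x).trans hx)
  have hψani : ∀ x, quadVal (coeffMat F ψ) x = 0 → x = 0 := fun x hx =>
    hψ x ((apply_eq_quadVal ψ x).trans hx)
  have hc : coeffMat F ψ 0 0 ≠ 0 := fun h => by
    have := hψani (Pi.single 0 1) ((quadVal_single (coeffMat F ψ) 0).trans h)
    simpa using congrFun this 0
  obtain ⟨α0, p0, q0, c0, hα0, hc0, hE⟩ := hφt.exists_normal_form hφa
  have hc0' : c0 = ![1, c0 1, c0 2] := by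
    funext j; fin_cases j <;> simp [hc0]
  rw [hc0'] at hE
  have hS : SimilarPhi (coeffMat F φ) p0 q0 (c0 1) (c0 2) :=
    similarPhi_iff.2 ⟨Units.mk0 α0 hα0, hE⟩
  simp only [apply_eq_quadVal ψ] at hT
  obtain ⟨p, q, a, b, γ, i, s, s', d1, d2, d3, δ, Φ, hS, hT', hγ, hs, hs', hδ, e, hΦ⟩ :=
    hg.exists_data hψani hc hn hφani (fun p q a b hS γ i s s' d1 d2 d3 hγ hs hs' e =>
      hφpn (isPfisterNeighbour_of_class hφa hS hγ hs hs' e)) (hiff.1 hi) hS hβ hT h0 h1 h2 h3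
  obtain ⟨α, hα⟩ := similarPhi_iff.1 hS
  obtain ⟨ha, hb⟩ := hS.ne_zero hφani
  refine ⟨p, q, Units.mk0 a ha, Units.mk0 b hb, α, ![d1, d2, d3], Units.mk0 γ hγ,
    ![Units.mk0 s hs, Units.mk0 s' hs'], i,
    weaklyDominated_of_bq hψ hδ hγ (fun j => Units.ne_zero _) hΦ, hα,
    fun x => by rw [apply_eq_quadVal ψ]; exact hT' x,
    (wittEquiv_pfister_iff hγ fun j => Units.ne_zero _).2 e⟩

lemma isotropic_of_decomposition {φ : QuadraticForm F (Fin 5 → F)} {n : ℕ} (hn1 : 2 ≤ n + 1)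
    {ψ : QuadraticForm F (Fin (n + 1) → F)} (hψ : ψ.Anisotropic)
    {p q r t a b β cc : F} {α γ : Fˣ} {d : Fin 3 → F} {s : Fin 2 → Fˣ}
    {T : (Fin (n + 1) → F) →ₗ[F] (Fin 4 → F)}
    (hT : ∀ x, β * ψ x = quadVal (psiC r t a) (T x)) {y0 : Fin (n + 1) → F}
    (h0 : T y0 0 ≠ 0)
    (hdom : WeaklyDominated ψ ((γ : F) • pfisterQF 2 (fun i => (s i : F)) cc))
    (hα : ((α : F) • φ).Equivalent ((binQF p q).prod (diagQF ![1, a, b])))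
    (hw : WittEquiv ((binQF p q).prod ((binQF r t).prod (binsQF ![1, a, b] d)))
          ((γ : F) • pfisterQF 2 (fun i => (s i : F)) cc)) :
    ¬ (extendQF F (funFieldMap F ψ) φ).Anisotropic := by
  obtain ⟨K, _, _, g, hg, hiff⟩ := exists_quadricField hn1 hψ φ
  have hs : ∀ j, (fun i => (s i : F)) j ≠ 0 := fun j => (s j).ne_zero
  obtain ⟨δ, Φ, hinj, hΦ⟩ := hdom.exists_bq γ.ne_zero hs
  simp only [apply_eq_quadVal ψ] at hT
  exact hiff.2 (hg.isotropic_of_data (similarPhi_iff.2 ⟨α, hα⟩) hT h0 (hs 0) (hs 1)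
    ((wittEquiv_pfister_iff γ.ne_zero hs).1 hw) hinj hΦ)

end Main

theorem stmt5 (F : Type) [Field F] [CharP F 2]
    (φ : QuadraticForm F (Fin 5 → F)) (hφa : φ.Anisotropic) (hφt : HasTypeRS φ 1 3)
    (hφpn : ¬ IsPfisterNeighbour φ)
    (m : ℕ) (ψ : QuadraticForm F (Fin m → F)) (hψa : ψ.Anisotropic)
    (hψt : (m = 3 ∧ HasTypeRS ψ 1 1) ∨ (m = 4 ∧ HasTypeRS ψ 1 2)) :
    (¬ (extendQF F (funFieldMap F ψ) φ).Anisotropic ↔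
      ∃ (R₁ R₂ : QuadraticForm F (Fin 2 → F)) (a b α β : Fˣ) (d : Fin 3 → F)
        (γ : Fˣ) (p : Fin 2 → Fˣ) (cc : F),
        HasTypeRS R₁ 1 0 ∧ HasTypeRS R₂ 1 0 ∧
        WeaklyDominated ψ ((γ : F) • pfisterQF 2 (fun i => (p i : F)) cc) ∧
        ((α : F) • φ).Equivalent (R₁.prod (diagQF ![(1 : F), (a : F), (b : F)])) ∧
        ((m = 3 ∧ ((β : F) • ψ).Equivalent (R₂.prod (diagQF ![(1 : F)]))) ∨
         (m = 4 ∧ ((β : F) • ψ).Equivalent (R₂.prod (diagQF ![(1 : F), (a : F)])))) ∧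
        WittEquiv (R₁.prod (R₂.prod (binsQF ![(1 : F), (a : F), (b : F)] d)))
          ((γ : F) • pfisterQF 2 (fun i => (p i : F)) cc)) := by
  constructor
  · intro hi
    obtain ⟨rfl, hψt⟩ | ⟨rfl, hψt⟩ := hψt
    · obtain ⟨β, r, t, c, hβ, hc, ⟨e⟩⟩ := hψt.exists_normal_form hψa
      have hc' : c = ![1] := by
        funext j; fin_cases j; simp [hc]
      subst hc'
      obtain ⟨p, q, a, b, α, d, γ, s, cc, hdom, hα, hT, hw⟩ :=
        exists_decomposition_of_isotropic hφa hφt hφpn (by norm_num) (by norm_num) hψa hi hβ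
          (r := r) (t := t) (a' := 0) (T := (psiMapThree F).comp e.toLinearEquiv.toLinearMap)
          (fun x => ((quadVal_psiMapThree r t 0 (e x)).trans (e.map_app x)).symm)
          (y0 := e.symm (![1, 0], ![0])) (y1 := e.symm (![0, 1], ![0]))
          (y2 := e.symm (![0, 0], ![1]))
          ((congrArg (psiMapThree F) (e.apply_symm_apply _)).trans (by simp [psiMapThree]))
          ((congrArg (psiMapThree F) (e.apply_symm_apply _)).trans (by simp [psiMapThree]))
          ((congrArg (psiMapThree F) (e.apply_symm_apply _)).trans (by simp [psiMapThree]))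
          (Or.inl fun x => rfl)
      exact ⟨binQF p q, binQF r t, a, b, α, Units.mk0 β hβ, d, γ, s, cc, hasTypeRS_binQF _ _,
        hasTypeRS_binQF _ _, hdom, hα, Or.inl ⟨rfl, ⟨e⟩⟩, hw⟩
    · obtain ⟨β, r, t, c, hβ, hc, ⟨e⟩⟩ := hψt.exists_normal_form hψa
      have hc' : c = ![1, c 1] := by
        funext j; fin_cases j <;> simp [hc]
      rw [hc'] at e
      obtain ⟨p, q, a, b, α, d, γ, s, cc, hdom, hα, hT, hw⟩ :=
        exists_decomposition_of_isotropic hφa hφt hφpn (by norm_num) (by norm_num) hψa hi hβ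
          (r := r) (t := t) (a' := c 1) (T := (psiMapFour F).comp e.toLinearEquiv.toLinearMap)
          (fun x => ((quadVal_psiMapFour r t (c 1) (e x)).trans (e.map_app x)).symm)
          (y0 := e.symm (![1, 0], ![0, 0])) (y1 := e.symm (![0, 1], ![0, 0]))
          (y2 := e.symm (![0, 0], ![1, 0]))
          ((congrArg (psiMapFour F) (e.apply_symm_apply _)).trans (by simp [psiMapFour]))
          ((congrArg (psiMapFour F) (e.apply_symm_apply _)).trans (by simp [psiMapFour]))
          ((congrArg (psiMapFour F) (e.apply_symm_apply _)).trans (by simp [psiMapFour]))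
          (Or.inr ⟨e.symm (![0, 0], ![0, 1]),
            (congrArg (psiMapFour F) (e.apply_symm_apply _)).trans (by simp [psiMapFour])⟩)
      refine ⟨binQF p q, binQF r t, a, b, α, Units.mk0 β hβ, d, γ, s, cc, hasTypeRS_binQF _ _,
        hasTypeRS_binQF _ _, hdom, hα, Or.inr ⟨rfl, ?_⟩, hw⟩
      exact equivalent_of_linearEquiv e.toLinearEquiv fun x =>
        (quadVal_psiMapFour r t a (e x)).symm.trans (hT x).symm
  · rintro ⟨R₁, R₂, a, b, α, β, d, γ, s, cc, h1, h2, hdom, hα, hβ, hw⟩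
    obtain ⟨p, q, h1⟩ := h1.exists_binQF
    obtain ⟨r, t, h2⟩ := h2.exists_binQF
    have hα' := hα.trans (h1.prod (Equivalent.refl _))
    have hE : (R₁.prod (R₂.prod (binsQF ![(1 : F), (a : F), (b : F)] d))).Equivalent
        ((binQF p q).prod ((binQF r t).prod (binsQF ![(1 : F), (a : F), (b : F)] d))) :=
      h1.prod (h2.prod (Equivalent.refl _))
    have hw' : WittEquiv
        ((binQF p q).prod ((binQF r t).prod (binsQF ![(1 : F), (a : F), (b : F)] d)))
        ((γ : F) • pfisterQF 2 (fun i => (s i : F)) cc) := hw.congr hE (Equivalent.refl _)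
    obtain ⟨rfl, hβ⟩ | ⟨rfl, hβ⟩ := hβ
    · obtain ⟨e⟩ := hβ.trans (h2.prod (Equivalent.refl _))
      exact isotropic_of_decomposition (by norm_num) hψa (β := β)
        (T := (psiMapThree F).comp e.toLinearEquiv.toLinearMap)
        (fun x => ((quadVal_psiMapThree r t a (e x)).trans (e.map_app x)).symm)
        (y0 := e.symm (![1, 0], ![0]))
        (((congrFun (congrArg (psiMapThree F) (e.apply_symm_apply _)) 0).trans
          (by simp [psiMapThree] : _ = (1 : F))).trans_ne one_ne_zero) hdom hα' hw'
    · obtain ⟨e⟩ := hβ.trans (h2.prod (Equivalent.refl _))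
      exact isotropic_of_decomposition (by norm_num) hψa (β := β)
        (T := (psiMapFour F).comp e.toLinearEquiv.toLinearMap)
        (fun x => ((quadVal_psiMapFour r t a (e x)).trans (e.map_app x)).symm)
        (y0 := e.symm (![1, 0], ![0, 0]))
        (((congrFun (congrArg (psiMapFour F) (e.apply_symm_apply _)) 0).trans
          (by simp [psiMapFour] : _ = (1 : F))).trans_ne one_ne_zero) hdom hα' hw'
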